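/- Consider constrained-degree percolation on ℤ^d, d ≥ 2, with parameter κ ∈ {2,…,2d}. For every p < p_c there exists α_p > 0 such that for all n ≥ 1 the one-arm probability satisfies θ_n(p) ≤ e^{−α_p n}. -/

import Mathlib

open MeasureTheory

namespace CDP

/-- Vertices of the hypercubic lattice `ℤ^d`. -/
abbrev Vertex (d : ℕ) := Fin d → ℤ

/-- Nearest-neighbour adjacency in `ℤ^d`. -/
def adj {d : ℕ} (x y : Vertex d) : Prop := (∑ i, |x i - y i|) = 1

/-- `e` is a nearest-neighbour (non-oriented) edge of `ℤ^d`, i.e. an element of `𝓔`. -/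
def IsNNEdge {d : ℕ} (e : Sym2 (Vertex d)) : Prop := ∃ x y, adj x y ∧ e = s(x, y)

/-- Configurations: labels attached to (unordered) pairs of vertices; only the labels of
nearest-neighbour edges (elements of `𝓔`) are ever relevant. -/
abbrev Config (d : ℕ) := Sym2 (Vertex d) → ℝ

/-- `ℓ^1` norm of a vertex. -/
def norm1 {d : ℕ} (x : Vertex d) : ℤ := ∑ i, |x i|

/-- The set `Ω`: configurations with values in `[0,1]`, pairwise distinct coordinates on `𝓔`,
and no infinite walk along which the labels are strictly monotone. -/
def goodConfigs (d : ℕ) : Set (Config d) :=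
  {U | (∀ e, IsNNEdge e → U e ∈ Set.Icc (0 : ℝ) 1) ∧
    (∀ e f, IsNNEdge e → IsNNEdge f → U e = U f → e = f) ∧
    ¬ ∃ w : ℕ → Vertex d, (∀ i, adj (w i) (w (i + 1))) ∧
      (StrictMono (fun i => U s(w i, w (i + 1))) ∨ StrictAnti (fun i => U s(w i, w (i + 1))))}

/-- A labelling `σ` of the edges by "ever opens" which is consistent with the
constrained-degree dynamics driven by `U`: an edge (attempting to open at time `U e`)
opens iff at that moment both of its end-vertices have degree `< κ` among the
previously opened edges. -/
def Consistent {d : ℕ} (κ : ℕ) (U : Config d) (σ : Sym2 (Vertex d) → Prop) : Prop :=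
  ∀ e, IsNNEdge e →
    (σ e ↔ ∀ v ∈ e,
      Set.ncard {f : Sym2 (Vertex d) | IsNNEdge f ∧ v ∈ f ∧ f ≠ e ∧ U f < U e ∧ σ f} < κ)

/-- `ω_p(U, e) = 1`, i.e. the edge `e` is `p`-open in the constrained-degree percolation
process with constraint `κ` driven by `U`. -/
def openEdge {d : ℕ} (κ : ℕ) (U : Config d) (p : ℝ) (e : Sym2 (Vertex d)) : Prop :=
  IsNNEdge e ∧ U e ≤ p ∧ ∃ σ, Consistent κ U σ ∧ σ e

/-- `x 0, …, x k` is a path: consecutive vertices adjacent, all vertices distinct. -/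
def IsPathOn {d : ℕ} (k : ℕ) (x : ℕ → Vertex d) : Prop :=
  (∀ i < k, adj (x i) (x (i + 1))) ∧ ∀ i ≤ k, ∀ j ≤ k, x i = x j → i = j

/-- The modified one-arm event `E_n(p)`: a path `x_0, …, x_k` with `‖x_0‖₁ = n`,
`‖x_i‖₁ < n` for `1 ≤ i ≤ k`, `x_k = 0`, whose head consists of `p`-open edges and whose
tail is decreasing (values `≤ p`, strictly decreasing towards the origin). -/
def modifiedOneArm {d : ℕ} (κ n : ℕ) (p : ℝ) (U : Config d) : Prop :=
  ∃ (k : ℕ) (x : ℕ → Vertex d),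
    IsPathOn k x ∧ norm1 (x 0) = (n : ℤ) ∧ (∀ i, 1 ≤ i → i ≤ k → norm1 (x i) < (n : ℤ)) ∧
    x k = 0 ∧
    ∃ l ≤ k,
      (∀ i < l, openEdge κ U p s(x i, x (i + 1))) ∧
      (∀ i, l ≤ i → i < k → U s(x i, x (i + 1)) ≤ p) ∧
      (∀ i, l ≤ i → i + 1 < k → U s(x (i + 1), x (i + 2)) < U s(x i, x (i + 1)))

/-- `a` and `b` are connected by a `p`-open path. -/
def openConn {d : ℕ} (κ : ℕ) (U : Config d) (p : ℝ) (a b : Vertex d) : Prop :=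
  ∃ (k : ℕ) (x : ℕ → Vertex d), IsPathOn k x ∧ x 0 = a ∧ x k = b ∧
    ∀ i < k, openEdge κ U p s(x i, x (i + 1))

/-- There is an infinite `p`-open path starting at the origin. -/
def zeroToInf {d : ℕ} (κ : ℕ) (U : Config d) (p : ℝ) : Prop :=
  ∃ x : ℕ → Vertex d, x 0 = 0 ∧ (∀ i, adj (x i) (x (i + 1))) ∧ Function.Injective x ∧
    ∀ i, openEdge κ U p s(x i, x (i + 1))

/-- `P` is the law of i.i.d. `Uniform[0,1]` labels: a probability measure whose
finite-dimensional cylinder probabilities are products of uniform probabilities. -/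
def IsProductUniform {d : ℕ} (P : Measure (Config d)) : Prop :=
  IsProbabilityMeasure P ∧
    ∀ (s : Finset (Sym2 (Vertex d))) (f : Sym2 (Vertex d) → Set ℝ),
      (∀ e ∈ s, MeasurableSet (f e)) →
      P {U | ∀ e ∈ s, U e ∈ f e} = ∏ e ∈ s, volume (f e ∩ Set.Icc 0 1)

/-- The one-arm probability `θ_n(p)`. -/
noncomputable def theta {d : ℕ} (κ : ℕ) (P : Measure (Config d)) (n : ℕ) (p : ℝ) : ℝ :=
  (P {U | U ∈ goodConfigs d ∧ ∃ b, norm1 b = (n : ℤ) ∧ openConn κ U p 0 b}).toReal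

/-- `θ(p) = ℙ(0 ↔ ∞)`. -/
noncomputable def thetaInf {d : ℕ} (κ : ℕ) (P : Measure (Config d)) (p : ℝ) : ℝ :=
  (P {U | U ∈ goodConfigs d ∧ zeroToInf κ U p}).toReal

/-- The critical point `p_c`. -/
noncomputable def pc {d : ℕ} (κ : ℕ) (P : Measure (Config d)) : ℝ :=
  sSup {p : ℝ | p ∈ Set.Icc (0 : ℝ) 1 ∧ thetaInf κ P p = 0}

/-- The modified one-arm probability `τ_n(p)`. -/
noncomputable def tau {d : ℕ} (κ : ℕ) (P : Measure (Config d)) (n : ℕ) (p : ℝ) : ℝ :=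
  (P {U | U ∈ goodConfigs d ∧ modifiedOneArm κ n p U}).toReal

/-- `e` is `p`-pivotal for `E_n(p)` at `U`. -/
def pPivotal {d : ℕ} (κ n : ℕ) (p : ℝ) (e : Sym2 (Vertex d)) (U : Config d) : Prop :=
  U ∈ goodConfigs d ∧ p < U e ∧ Function.update U e p ∈ goodConfigs d ∧
    ¬ (modifiedOneArm κ n p U ↔ modifiedOneArm κ n p (Function.update U e p))

/-- `e` is `U`-pivotal for `E_n(p)` at `U`. -/
def uPivotal {d : ℕ} (κ n : ℕ) (p : ℝ) (e : Sym2 (Vertex d)) (U : Config d) : Prop :=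
  U ∈ goodConfigs d ∧ ∃ U' ∈ goodConfigs d, (∀ f, f ≠ e → U' f = U f) ∧
    ¬ (modifiedOneArm κ n p U ↔ modifiedOneArm κ n p U')

/-! ### Edges and their neighbourhoods -/

/-- The lattice vectors of `ℓ¹` norm one. -/
noncomputable def unitVectors (d : ℕ) : Finset (Vertex d) :=
  (Finset.Icc (-1) 1).filter fun z => ∑ i, |z i| = 1

/-- The lattice edges incident to `v`. -/
noncomputable def edgesAt {d : ℕ} (v : Vertex d) : Finset (Sym2 (Vertex d)) :=
  (unitVectors d).image fun z => s(v, v + z)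

/-- Two lattice edges which share an endpoint. -/
def AdjE {d : ℕ} (e f : Sym2 (Vertex d)) : Prop :=
  IsNNEdge e ∧ IsNNEdge f ∧ ∃ v, v ∈ e ∧ v ∈ f

open Classical in
/-- The lattice edges sharing an endpoint with the lattice edge `e`. -/
noncomputable def edgeNbrs {d : ℕ} (e : Sym2 (Vertex d)) : Finset (Sym2 (Vertex d)) :=
  if IsNNEdge e then e.toFinset.biUnion edgesAt else ∅

theorem mem_unitVectors {d : ℕ} (z : Vertex d) : z ∈ unitVectors d ↔ ∑ i, |z i| = 1 := by
  simp only [unitVectors, Finset.mem_filter, Finset.mem_Icc, and_iff_right_iff_imp]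
  intro h
  have key : ∀ i, |z i| ≤ 1 := fun i => by
    rw [← h]
    exact Finset.single_le_sum (f := fun i => |z i|) (fun j _ => abs_nonneg _) (Finset.mem_univ i)
  exact ⟨fun i => (abs_le.1 (key i)).1, fun i => (abs_le.1 (key i)).2⟩

theorem adj_comm {d : ℕ} (x y : Vertex d) : adj x y ↔ adj y x := by
  simp only [adj, abs_sub_comm]

theorem isNNEdge_mk {d : ℕ} (x y : Vertex d) : IsNNEdge s(x, y) ↔ adj x y := by
  constructor
  · rintro ⟨a, b, h, he⟩
    rcases Sym2.eq_iff.1 he with ⟨rfl, rfl⟩ | ⟨rfl, rfl⟩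
    · exact h
    · exact (adj_comm _ _).1 h
  · exact fun h => ⟨x, y, h, rfl⟩

theorem adj_ne {d : ℕ} {x y : Vertex d} (h : adj x y) : x ≠ y := by
  rintro rfl
  simp [adj] at h

theorem mem_edgesAt {d : ℕ} (v : Vertex d) (e : Sym2 (Vertex d)) :
    e ∈ edgesAt v ↔ IsNNEdge e ∧ v ∈ e := by
  simp only [edgesAt, Finset.mem_image, mem_unitVectors]
  constructor
  · rintro ⟨z, hz, rfl⟩
    refine ⟨(isNNEdge_mk _ _).2 ?_, Sym2.mem_mk_left _ _⟩
    simpa [adj] using hz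
  · rintro ⟨he, hv⟩
    obtain ⟨w, rfl⟩ := Sym2.mem_iff_exists.1 hv
    refine ⟨w - v, ?_, by simp⟩
    have := (adj_comm _ _).1 ((isNNEdge_mk _ _).1 he)
    simpa [adj] using this

theorem mem_edgeNbrs {d : ℕ} (e f : Sym2 (Vertex d)) : f ∈ edgeNbrs e ↔ AdjE e f := by
  unfold edgeNbrs AdjE
  split_ifs with h
  · simp only [Finset.mem_biUnion, Sym2.mem_toFinset, mem_edgesAt]
    tauto
  · simp [h]

theorem AdjE.symm {d : ℕ} {e f : Sym2 (Vertex d)} (h : AdjE e f) : AdjE f e :=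
  ⟨h.2.1, h.1, h.2.2.imp fun _ hv => hv.symm⟩

theorem AdjE.refl {d : ℕ} {e : Sym2 (Vertex d)} (h : IsNNEdge e) : AdjE e e :=
  ⟨h, h, by obtain ⟨x, y, -, rfl⟩ := h; exact ⟨x, by simp, by simp⟩⟩

theorem card_edgesAt_le {d : ℕ} (v : Vertex d) : (edgesAt v).card ≤ (unitVectors d).card :=
  Finset.card_image_le

/-- A bound for the number of neighbours of an edge. -/
noncomputable def nbrBound (d : ℕ) : ℕ := 2 * (unitVectors d).card + 1

theorem card_edgeNbrs_le {d : ℕ} (e : Sym2 (Vertex d)) : (edgeNbrs e).card ≤ nbrBound d := by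
  unfold edgeNbrs nbrBound
  split_ifs with h
  · refine (Finset.card_biUnion_le_card_mul _ _ _ fun v _ => card_edgesAt_le v).trans ?_
    have : e.toFinset.card ≤ 2 := by
      rw [Sym2.card_toFinset]; split_ifs <;> simp
    nlinarith
  · simp

/-! ### The dynamics -/

open Classical in
/-- The number of edges at `v` other than `e`, with label below that of `e`, which satisfy `σ`. -/
noncomputable def lowerDegree {d : ℕ} (U : Config d) (σ : Sym2 (Vertex d) → Prop)
    (e : Sym2 (Vertex d)) (v : Vertex d) : ℕ :=
  ((edgesAt v).filter fun f => f ≠ e ∧ U f < U e ∧ σ f).card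

/-- Iterates of the recursion defining the dynamics, started from the empty configuration. -/
def openStep {d : ℕ} (κ : ℕ) (U : Config d) : ℕ → Sym2 (Vertex d) → Prop
  | 0, _ => False
  | m + 1, e => ∀ v ∈ e, lowerDegree U (openStep κ U m) e v < κ

/-- The edge `e` ever opens. -/
def Opens {d : ℕ} (κ : ℕ) (U : Config d) (e : Sym2 (Vertex d)) : Prop :=
  ∃ M, ∀ m ≥ M, openStep κ U m e

/-- `f` is a neighbour of `e` with a smaller label. -/
def Below {d : ℕ} (U : Config d) (f e : Sym2 (Vertex d)) : Prop := AdjE f e ∧ U f < U e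

theorem lowerDegree_congr {d : ℕ} {U V : Config d} {σ ρ : Sym2 (Vertex d) → Prop}
    {e : Sym2 (Vertex d)} {v : Vertex d}
    (h : ∀ f, IsNNEdge f → v ∈ f → f ≠ e → ((U f < U e ∧ σ f) ↔ (V f < V e ∧ ρ f))) :
    lowerDegree U σ e v = lowerDegree V ρ e v := by
  classical
  unfold lowerDegree
  refine congrArg Finset.card (Finset.filter_congr fun f hf => ?_)
  rw [mem_edgesAt] at hf
  constructor
  · rintro ⟨h1, h2⟩; exact ⟨h1, (h f hf.1 hf.2 h1).1 h2⟩
  · rintro ⟨h1, h2⟩; exact ⟨h1, (h f hf.1 hf.2 h1).2 h2⟩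

theorem openStep_eventually {d κ : ℕ} {U : Config d} (hU : WellFounded (Below U))
    (e : Sym2 (Vertex d)) (he : IsNNEdge e) :
    ∃ M, ∀ m ≥ M, (openStep κ U m e ↔ ∀ v ∈ e, lowerDegree U (Opens κ U) e v < κ) := by
  induction e using hU.induction with
  | _ e ih =>
    have h1 : ∀ f, ∃ M, Below U f e → ∀ m ≥ M, (openStep κ U m f ↔ Opens κ U f) := by
      intro f
      by_cases hf : Below U f e
      · obtain ⟨M, hM⟩ := ih f hf hf.1.1
        refine ⟨M, fun _ m hm => ?_⟩
        rw [hM m hm]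
        constructor
        · exact fun h => ⟨M, fun k hk => (hM k hk).2 h⟩
        · rintro ⟨N, hN⟩
          exact (hM _ (le_max_left M N)).1 (hN _ (le_max_right M N))
      · exact ⟨0, fun h => absurd h hf⟩
    choose M hM using h1
    refine ⟨(edgeNbrs e).sup M + 1, fun m hm => ?_⟩
    obtain ⟨k, rfl⟩ : ∃ k, m = k + 1 := ⟨m - 1, by omega⟩
    refine forall₂_congr fun v hv => ?_
    rw [lowerDegree_congr]
    intro f hf hvf _
    refine and_congr_right fun hlt => ?_
    have hb : Below U f e := ⟨⟨hf, he, v, hvf, hv⟩, hlt⟩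
    refine hM f hb k (le_trans (Finset.le_sup (f := M) ?_) (Nat.le_of_succ_le_succ hm))
    exact (mem_edgeNbrs _ _).2 hb.1.symm

theorem opens_iff {d κ : ℕ} {U : Config d} (hU : WellFounded (Below U))
    {e : Sym2 (Vertex d)} (he : IsNNEdge e) :
    Opens κ U e ↔ ∀ v ∈ e, lowerDegree U (Opens κ U) e v < κ := by
  obtain ⟨M, hM⟩ := openStep_eventually (κ := κ) hU e he
  constructor
  · rintro ⟨N, hN⟩
    exact (hM _ (le_max_left M N)).1 (hN _ (le_max_right M N))
  · exact fun h => ⟨M, fun k hk => (hM k hk).2 h⟩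

theorem ncard_eq_lowerDegree {d : ℕ} (U : Config d) (σ : Sym2 (Vertex d) → Prop)
    (e : Sym2 (Vertex d)) (v : Vertex d) :
    Set.ncard {f : Sym2 (Vertex d) | IsNNEdge f ∧ v ∈ f ∧ f ≠ e ∧ U f < U e ∧ σ f} =
      lowerDegree U σ e v := by
  classical
  unfold lowerDegree
  rw [← Set.ncard_coe_finset]
  congr 1
  ext f
  simp [mem_edgesAt, and_assoc]

theorem consistent_iff {d κ : ℕ} {U : Config d} (hU : WellFounded (Below U))
    {σ : Sym2 (Vertex d) → Prop} :
    Consistent κ U σ ↔ ∀ e, IsNNEdge e → (σ e ↔ Opens κ U e) := by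
  simp only [Consistent, ncard_eq_lowerDegree]
  constructor
  · intro h e he
    induction e using hU.induction with
    | _ e ih =>
      rw [h e he, opens_iff hU he]
      refine forall₂_congr fun v hv => ?_
      rw [lowerDegree_congr]
      intro f hf hvf _
      exact and_congr_right fun hlt => ih f ⟨⟨hf, he, v, hvf, hv⟩, hlt⟩ hf
  · intro h e he
    rw [h e he, opens_iff hU he]
    refine forall₂_congr fun v hv => ?_
    rw [lowerDegree_congr]
    intro f hf _ _
    exact and_congr_right fun _ => (h f hf).symm

theorem openEdge_iff {d κ : ℕ} {U : Config d} (hU : WellFounded (Below U)) (p : ℝ)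
    (e : Sym2 (Vertex d)) :
    openEdge κ U p e ↔ IsNNEdge e ∧ U e ≤ p ∧ Opens κ U e := by
  unfold openEdge
  refine and_congr_right fun he => and_congr_right fun _ => ?_
  constructor
  · rintro ⟨σ, hσ, h⟩
    exact ((consistent_iff hU).1 hσ e he).1 h
  · exact fun h => ⟨Opens κ U, (consistent_iff hU).2 fun _ _ => Iff.rfl, h⟩

/-- The set of `p`-open edges. -/
def openSet {d : ℕ} (κ : ℕ) (U : Config d) (p : ℝ) : Set (Sym2 (Vertex d)) :=
  {e | IsNNEdge e ∧ U e ≤ p ∧ Opens κ U e}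

/-- The graph of `p`-open edges. -/
def openGraph {d : ℕ} (κ : ℕ) (U : Config d) (p : ℝ) : SimpleGraph (Vertex d) :=
  SimpleGraph.fromEdgeSet (openSet κ U p)

theorem openGraph_adj {d κ : ℕ} {U : Config d} {p : ℝ} {x y : Vertex d} :
    (openGraph κ U p).Adj x y ↔ s(x, y) ∈ openSet κ U p := by
  rw [openGraph, SimpleGraph.fromEdgeSet_adj, and_iff_left_iff_imp]
  exact fun h => adj_ne ((isNNEdge_mk _ _).1 h.1)

theorem openSet_mono {d κ : ℕ} (U : Config d) {p q : ℝ} (h : p ≤ q) :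
    openSet κ U p ⊆ openSet κ U q := fun _ he => ⟨he.1, he.2.1.trans h, he.2.2⟩

/-! ### Well-foundedness -/

theorem wellFounded_below_of_finite {d : ℕ} {U V : Config d} (hU : WellFounded (Below U))
    {D : Set (Sym2 (Vertex d))} (hD : D.Finite) (h : ∀ e, IsNNEdge e → e ∉ D → V e = U e) :
    WellFounded (Below V) := by
  rw [wellFounded_iff_isEmpty_descending_chain] at hU ⊢
  refine ⟨fun ⟨x, hx⟩ => ?_⟩
  have hanti : StrictAnti fun n => V (x n) := strictAnti_nat_of_succ_lt fun n => (hx n).2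
  have hinj : Function.Injective x := fun a b hab => hanti.injective (by simp [hab])
  have hfin : {n | x n ∈ D}.Finite := hD.preimage hinj.injOn
  obtain ⟨N, hN⟩ := hfin.bddAbove
  have hN' : ∀ n, V (x (N + 1 + n)) = U (x (N + 1 + n)) := by
    intro n
    refine h _ (hx _).1.2.1 fun hmem => ?_
    have := hN hmem
    omega
  refine hU.false ⟨fun n => x (N + 1 + n), fun n => ⟨(hx _).1, ?_⟩⟩
  have := (hx (N + 1 + n)).2
  rw [hN' n] at this
  rw [show N + 1 + n + 1 = N + 1 + (n + 1) by ring] at this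
  rwa [hN' (n + 1)] at this

theorem wellFounded_below_update {d : ℕ} {U : Config d} (hU : WellFounded (Below U))
    (e : Sym2 (Vertex d)) (t : ℝ) : WellFounded (Below (Function.update U e t)) :=
  wellFounded_below_of_finite hU (Set.finite_singleton e) fun f _ hf => by
    rw [Function.update_of_ne (by simpa using hf)]

/-- Labels of distinct lattice edges are distinct. -/
def DistinctLabels {d : ℕ} (U : Config d) : Prop :=
  ∀ e f, IsNNEdge e → IsNNEdge f → U e = U f → e = f

open Classical in
theorem card_openSet_le {d κ : ℕ} {U : Config d} (hU : WellFounded (Below U))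
    (hdist : DistinctLabels U) (p : ℝ) (v : Vertex d) :
    ((edgesAt v).filter (· ∈ openSet κ U p)).card ≤ κ := by
  set A := (edgesAt v).filter (· ∈ openSet κ U p) with hA
  rcases A.eq_empty_or_nonempty with h | h
  · simp [h]
  obtain ⟨e, heA, hmax⟩ := A.exists_max_image U h
  have he := (Finset.mem_filter.1 heA)
  have hve := (mem_edgesAt _ _).1 he.1
  have hlt := (opens_iff hU hve.1).1 he.2.2.2 v hve.2
  have hsub : A.erase e ⊆ (edgesAt v).filter fun f => f ≠ e ∧ U f < U e ∧ Opens κ U f := by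
    intro f hf
    have hfA := Finset.mem_of_mem_erase hf
    have hfe := Finset.ne_of_mem_erase hf
    have hf' := Finset.mem_filter.1 hfA
    refine Finset.mem_filter.2 ⟨hf'.1, hfe, lt_of_le_of_ne (hmax f hfA) fun heq => hfe ?_, hf'.2.2.2⟩
    exact hdist f e hf'.2.1 hve.1 heq
  have := Finset.card_le_card hsub
  rw [Finset.card_erase_of_mem heA] at this
  unfold lowerDegree at hlt
  omega

/-! ### Surgery -/

/-- The edge `e` has an endpoint in `S`. -/
def Touches {d : ℕ} (S : Set (Vertex d)) (e : Sym2 (Vertex d)) : Prop := ∃ v ∈ e, v ∈ S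

open Classical in
/-- The edge set `Q` can be opened at the vertices of `S`, everything else touching `S` being
closed. -/
structure Admissible {d : ℕ} (κ : ℕ) (U : Config d) (p : ℝ) (S : Set (Vertex d))
    (Q : Set (Sym2 (Vertex d))) : Prop where
  isNN : ∀ e ∈ Q, IsNNEdge e
  touches : ∀ e ∈ Q, Touches S e
  outer : ∀ e ∈ Q, (∃ v ∈ e, v ∉ S) → e ∈ openSet κ U p
  deg : ∀ v ∈ S, ((edgesAt v).filter (· ∈ Q)).card ≤ κ

theorem Admissible.mono {d κ : ℕ} {U : Config d} {p : ℝ} {S : Set (Vertex d)}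
    {Q Q' : Set (Sym2 (Vertex d))} (h : Admissible κ U p S Q) (hQ : Q' ⊆ Q) :
    Admissible κ U p S Q' where
  isNN e he := h.isNN e (hQ he)
  touches e he := h.touches e (hQ he)
  outer e he := h.outer e (hQ he)
  deg v hv := by
    classical
    refine (Finset.card_le_card ?_).trans (h.deg v hv)
    intro f hf
    rw [Finset.mem_filter] at hf ⊢
    exact ⟨hf.1, hQ hf.2⟩

/-- The edges of `K` which are resampled in the surgery. -/
def resampled {d : ℕ} (κ : ℕ) (U : Config d) (p : ℝ) (S : Set (Vertex d))
    (K : Set (Sym2 (Vertex d))) : Set (Sym2 (Vertex d)) :=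
  {e | e ∈ K ∧ ¬ (e ∈ openSet κ U p ∧ ¬ Touches S e)}

theorem lowerDegree_lt_of {d κ : ℕ} {V : Config d} {σ : Sym2 (Vertex d) → Prop}
    {e : Sym2 (Vertex d)} {v : Vertex d} {A : Finset (Sym2 (Vertex d))} (heA : e ∈ A)
    (hA : A.card ≤ κ) (h : ∀ f, IsNNEdge f → v ∈ f → f ≠ e → V f < V e → σ f → f ∈ A) :
    lowerDegree V σ e v < κ := by
  classical
  unfold lowerDegree
  refine lt_of_lt_of_le (Finset.card_lt_card ⟨?_, fun hsub => ?_⟩) hA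
  · intro f hf
    obtain ⟨h1, h2, h3, h4⟩ := Finset.mem_filter.1 hf
    rw [mem_edgesAt] at h1
    exact h f h1.1 h1.2 h2 h3 h4
  · exact (Finset.mem_filter.1 (hsub heA)).2.1 rfl

theorem mem_openSet_surgery {d κ : ℕ} {U V : Config d} {p : ℝ} (hU : WellFounded (Below U))
    (hV : WellFounded (Below V)) (hd : DistinctLabels U) {S : Set (Vertex d)}
    {K Q : Set (Sym2 (Vertex d))} (hK : ∀ e f, Touches S e → AdjE e f → f ∈ K)
    (hQ : Admissible κ U p S Q) (hVQ : ∀ e ∈ Q, V e ≤ p)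
    (hVD : ∀ e ∈ resampled κ U p S K, e ∉ Q → p < V e)
    (hVU : ∀ e ∉ resampled κ U p S K, V e = U e) (e : Sym2 (Vertex d)) :
    e ∈ openSet κ V p ↔ (e ∈ openSet κ U p ∧ ¬ Touches S e) ∨ e ∈ Q := by
  classical
  have keep : ∀ f, V f ≤ p → f ∉ Q → f ∈ K → f ∈ openSet κ U p ∧ ¬ Touches S f := by
    intro f hf hfQ hfK
    by_contra hcon
    exact absurd (hVD f ⟨hfK, hcon⟩ hfQ) (not_lt.2 hf)
  have same : ∀ f, V f ≤ p → f ∉ Q → V f = U f := by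
    intro f hf hfQ
    refine hVU f fun hD => absurd (hVD f hD hfQ) (not_lt.2 hf)
  have claim : ∀ e, IsNNEdge e → V e ≤ p →
      (Opens κ V e ↔ e ∈ Q ∨ (Opens κ U e ∧ ¬ Touches S e)) := by
    intro e
    induction e using hV.induction with
    | _ e ih =>
      intro he hep
      have ih' : ∀ v ∈ e, ∀ f, IsNNEdge f → v ∈ f → V f < V e →
          (Opens κ V f ↔ f ∈ Q ∨ (Opens κ U f ∧ ¬ Touches S f)) := fun v hv f hf hvf hlt =>
        ih f ⟨⟨hf, he, v, hvf, hv⟩, hlt⟩ hf (hlt.le.trans hep)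
      have memO : ∀ f, IsNNEdge f → V f ≤ p → f ∉ Q → Opens κ U f → f ∈ openSet κ U p :=
        fun f hf hfp hfQ ho => ⟨hf, same f hfp hfQ ▸ hfp, ho⟩
      have lowO : ∀ v ∈ e, v ∉ S → e ∈ openSet κ U p → lowerDegree V (Opens κ V) e v < κ := by
        intro v hv hvS heO
        refine lowerDegree_lt_of (A := (edgesAt v).filter (· ∈ openSet κ U p)) ?_
          (card_openSet_le hU hd p v) ?_
        · exact Finset.mem_filter.2 ⟨(mem_edgesAt _ _).2 ⟨he, hv⟩, heO⟩
        · intro f hf hvf _ hlt ho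
          refine Finset.mem_filter.2 ⟨(mem_edgesAt _ _).2 ⟨hf, hvf⟩, ?_⟩
          by_cases hfQ : f ∈ Q
          · exact hQ.outer f hfQ ⟨v, hvf, hvS⟩
          · rcases (ih' v hv f hf hvf hlt).1 ho with h | h
            · exact absurd h hfQ
            · exact memO f hf (hlt.le.trans hep) hfQ h.1
      by_cases heQ : e ∈ Q
      · refine iff_of_true ((opens_iff hV he).2 fun v hv => ?_) (Or.inl heQ)
        by_cases hvS : v ∈ S
        · refine lowerDegree_lt_of (A := (edgesAt v).filter (· ∈ Q)) ?_ (hQ.deg v hvS) ?_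
          · exact Finset.mem_filter.2 ⟨(mem_edgesAt _ _).2 ⟨he, hv⟩, heQ⟩
          · intro f hf hvf _ hlt ho
            refine Finset.mem_filter.2 ⟨(mem_edgesAt _ _).2 ⟨hf, hvf⟩, ?_⟩
            rcases (ih' v hv f hf hvf hlt).1 ho with h | h
            · exact h
            · exact absurd ⟨v, hvf, hvS⟩ h.2
        · exact lowO v hv hvS (hQ.outer e heQ ⟨v, hv, hvS⟩)
      by_cases heK : e ∈ K
      · obtain ⟨heO, heT⟩ := keep e hep heQ heK
        refine iff_of_true ((opens_iff hV he).2 fun v hv => ?_) (Or.inr ⟨heO.2.2, heT⟩)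
        exact lowO v hv (fun hvS => heT ⟨v, hv, hvS⟩) heO
      · have heT : ¬ Touches S e := fun h => heK (hK e e h (AdjE.refl he))
        have key : Opens κ V e ↔ Opens κ U e := by
          rw [opens_iff hV he, opens_iff hU he]
          refine forall₂_congr fun v hv => ?_
          rw [lowerDegree_congr]
          intro f hf hvf _
          have hfT : ¬ Touches S f := fun h => heK (hK f e h ⟨hf, he, v, hvf, hv⟩)
          have hfQ : f ∉ Q := fun h => hfT (hQ.touches f h)
          have heU := same e hep heQ
          constructor
          · rintro ⟨hlt, ho⟩
            have ho' := ((ih' v hv f hf hvf hlt).1 ho).resolve_left hfQ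
            exact ⟨by rwa [← same f (hlt.le.trans hep) hfQ, ← heU], ho'.1⟩
          · rintro ⟨hlt, ho⟩
            have hVf : V f = U f := hVU f fun hD => hD.2
              ⟨⟨hf, hlt.le.trans (heU ▸ hep), ho⟩, hfT⟩
            have hlt' : V f < V e := by rwa [hVf, heU]
            exact ⟨hlt', (ih' v hv f hf hvf hlt').2 (Or.inr ⟨ho, hfT⟩)⟩
        rw [key]
        tauto
  constructor
  · rintro ⟨he, hep, ho⟩
    by_cases heQ : e ∈ Q
    · exact Or.inr heQ
    · have := ((claim e he hep).1 ho).resolve_left heQ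
      exact Or.inl ⟨⟨he, same e hep heQ ▸ hep, this.1⟩, this.2⟩
  · rintro (⟨heO, heT⟩ | heQ)
    · have hVe : V e = U e := hVU e fun hD => hD.2 ⟨heO, heT⟩
      have hep : V e ≤ p := hVe ▸ heO.2.1
      exact ⟨heO.1, hep, (claim e heO.1 hep).2 (Or.inr ⟨heO.2.2, heT⟩)⟩
    · have he := hQ.isNN e heQ
      exact ⟨he, hVQ e heQ, (claim e he (hVQ e heQ)).2 (Or.inl heQ)⟩

/-! ### Chains of edges -/

/-- The lists `c` of length `m` such that `e :: c` is a chain of adjacent edges. -/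
noncomputable def chains {d : ℕ} (e : Sym2 (Vertex d)) : ℕ → Finset (List (Sym2 (Vertex d)))
  | 0 => {[]}
  | m + 1 => by
      classical
      exact (edgeNbrs e).biUnion fun f => (chains f m).image (f :: ·)

theorem mem_chains {d : ℕ} (e : Sym2 (Vertex d)) (m : ℕ) (c : List (Sym2 (Vertex d))) :
    c ∈ chains e m ↔ c.length = m ∧ (e :: c).IsChain AdjE := by
  classical
  induction m generalizing e c with
  | zero =>
    simp only [chains, Finset.mem_singleton, List.length_eq_zero_iff]
    exact ⟨fun h => by simp [h], fun h => h.1⟩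
  | succ m ih =>
    simp only [chains, Finset.mem_biUnion, Finset.mem_image, mem_edgeNbrs, ih]
    constructor
    · rintro ⟨f, hf, l, ⟨rfl, hl⟩, rfl⟩
      exact ⟨rfl, List.isChain_cons_cons.2 ⟨hf, hl⟩⟩
    · rintro ⟨h1, h2⟩
      cases c with
      | nil => simp at h1
      | cons f l =>
        rw [List.isChain_cons_cons] at h2
        exact ⟨f, h2.1, l, ⟨by simpa using h1, h2.2⟩, rfl⟩

theorem card_chains_le {d : ℕ} (e : Sym2 (Vertex d)) (m : ℕ) :
    (chains e m).card ≤ nbrBound d ^ m := by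
  classical
  induction m generalizing e with
  | zero => simp [chains]
  | succ m ih =>
    rw [chains]
    refine (Finset.card_biUnion_le_card_mul _ _ (nbrBound d ^ m) fun f _ =>
      Finset.card_image_le.trans (ih f)).trans ?_
    rw [pow_succ, mul_comm]
    exact Nat.mul_le_mul_left _ (card_edgeNbrs_le e)

/-- The endpoints of the edges in a list. -/
def verts {d : ℕ} (l : List (Sym2 (Vertex d))) : Set (Vertex d) := {v | ∃ g ∈ l, v ∈ g}

/-- The edges at distance at most two from a list of edges. -/
noncomputable def hull {d : ℕ} (l : List (Sym2 (Vertex d))) : Finset (Sym2 (Vertex d)) := by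
  classical
  exact l.toFinset.biUnion fun g => (edgeNbrs g).biUnion edgeNbrs

theorem mem_hull {d : ℕ} (l : List (Sym2 (Vertex d))) (f : Sym2 (Vertex d)) :
    f ∈ hull l ↔ ∃ g ∈ l, ∃ h, AdjE g h ∧ AdjE h f := by
  classical
  simp [hull, mem_edgeNbrs]

theorem card_hull_le {d : ℕ} (l : List (Sym2 (Vertex d))) :
    (hull l).card ≤ l.length * (nbrBound d * nbrBound d) := by
  classical
  unfold hull
  refine (Finset.card_biUnion_le_card_mul _ _ (nbrBound d * nbrBound d) fun g _ => ?_).trans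
    (Nat.mul_le_mul_right _ (List.toFinset_card_le l))
  refine (Finset.card_biUnion_le_card_mul _ _ (nbrBound d) fun h _ => card_edgeNbrs_le h).trans ?_
  exact Nat.mul_le_mul_right _ (card_edgeNbrs_le g)

theorem hull_of_touches {d : ℕ} {l : List (Sym2 (Vertex d))} (hl : ∀ g ∈ l, IsNNEdge g)
    {e f : Sym2 (Vertex d)} (he : Touches (verts l) e) (hef : AdjE e f) : f ∈ hull l := by
  obtain ⟨v, hv, g, hg, hvg⟩ := he
  exact (mem_hull _ _).2 ⟨g, hg, e, ⟨hl g hg, hef.1, v, hvg, hv⟩, hef⟩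

/-- `c` is a chain of edges starting next to `e`, along which the labels increase. -/
def IncChain {d : ℕ} (U : Config d) (e : Sym2 (Vertex d)) (c : List (Sym2 (Vertex d))) : Prop :=
  (e :: c).IsChain AdjE ∧ c.IsChain (U · < U ·)

theorem IncChain.isNN {d : ℕ} {U : Config d} {e : Sym2 (Vertex d)}
    {c : List (Sym2 (Vertex d))} (h : IncChain U e c) (he : IsNNEdge e) :
    ∀ g ∈ e :: c, IsNNEdge g := by
  have : ∀ (c : List (Sym2 (Vertex d))) (e : Sym2 (Vertex d)), IsNNEdge e →
      (e :: c).IsChain AdjE → ∀ g ∈ e :: c, IsNNEdge g := by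
    intro c
    induction c with
    | nil => intro e he _ g hg; simpa using (List.mem_singleton.1 hg) ▸ he
    | cons f c ih =>
      intro e he h g hg
      rw [List.isChain_cons_cons] at h
      rcases List.mem_cons.1 hg with rfl | hg
      · exact he
      · exact ih f h.1.2.1 h.2 g hg
  exact this c e he h.1

theorem IncChain.append {d : ℕ} {U : Config d} {e f g : Sym2 (Vertex d)}
    {c : List (Sym2 (Vertex d))} (h : IncChain U e c) (hg : (e :: c).getLast? = some g)
    (hgf : AdjE g f) (hlt : c ≠ [] → U g < U f) : IncChain U e (c ++ [f]) := by
  refine ⟨?_, ?_⟩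
  · rw [← List.cons_append, List.isChain_append]
    refine ⟨h.1, List.isChain_singleton _, ?_⟩
    intro x hx y hy
    rw [hg] at hx
    simp only [Option.mem_def, Option.some.injEq, List.head?_cons] at hx hy
    subst hx hy
    exact hgf
  · rw [List.isChain_append]
    refine ⟨h.2, List.isChain_singleton _, ?_⟩
    intro x hx y hy
    have hc : c ≠ [] := by rintro rfl; simp at hx
    have : x = g := by
      rw [List.getLast?_cons_of_ne_nil hc] at hg
      simp only [Option.mem_def] at hx
      rw [hg] at hx
      simpa using hx.symm
    simp only [Option.mem_def, Option.some.injEq, List.head?_cons] at hy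
    subst hy this
    exact hlt hc

/-- Where the dynamics driven by two configurations differing at one edge disagree, there is a
chain of edges leading to the modified edge. -/
theorem exists_incChain_of_opens_ne {d κ : ℕ} {U V : Config d} (hU : WellFounded (Below U))
    (hV : WellFounded (Below V)) {e : Sym2 (Vertex d)} (hUV : ∀ g, g ≠ e → V g = U g)
    (f : Sym2 (Vertex d)) (hf : IsNNEdge f) (hne : f ≠ e)
    (h : ¬ (Opens κ U f ↔ Opens κ V f)) :
    ∃ c, IncChain U e c ∧ c.getLast? = some f := by
  induction f using hU.induction with
  | _ f ih =>
    rw [opens_iff hU hf, opens_iff hV hf] at h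
    obtain ⟨v, hv, g, hg, hvg, hgf⟩ : ∃ v ∈ f, ∃ g, IsNNEdge g ∧ v ∈ g ∧
        ¬ ((U g < U f ∧ Opens κ U g) ↔ (V g < V f ∧ Opens κ V g)) := by
      by_contra! hcon
      refine h (forall₂_congr fun v hv => ?_)
      rw [lowerDegree_congr]
      intro g hg hvg _
      exact hcon v hv g hg hvg
    by_cases hge : g = e
    · subst hge
      refine ⟨[f], ⟨?_, List.isChain_singleton _⟩, rfl⟩
      exact List.isChain_cons_cons.2 ⟨⟨hg, hf, v, hvg, hv⟩, List.isChain_singleton _⟩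
    · rw [hUV g hge, hUV f hne] at hgf
      have hlt : U g < U f := by by_contra hcon; exact hgf (by simp [hcon])
      have hgo : ¬ (Opens κ U g ↔ Opens κ V g) := fun hcon => hgf (by simp [hcon])
      obtain ⟨c, hc, hcg⟩ := ih g ⟨⟨hg, hf, v, hvg, hv⟩, hlt⟩ hg hge hgo
      have hc0 : c ≠ [] := by rintro rfl; simp at hcg
      refine ⟨c ++ [f], hc.append (g := g) ?_ ⟨hg, hf, v, hvg, hv⟩ fun _ => hlt, by simp⟩
      rw [List.getLast?_cons_of_ne_nil hc0, hcg]

theorem exists_incChain_of_mem_openSet {d κ : ℕ} {U V : Config d} {p : ℝ}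
    (hU : WellFounded (Below U)) (hV : WellFounded (Below V)) {e : Sym2 (Vertex d)}
    (hUV : ∀ g, g ≠ e → V g = U g) {f : Sym2 (Vertex d)} (hfV : f ∈ openSet κ V p)
    (hfU : f ∉ openSet κ U p) : ∃ c, IncChain U e c ∧ f ∈ e :: c := by
  by_cases hfe : f = e
  · exact ⟨[], ⟨List.isChain_singleton _, List.isChain_nil⟩, by simp [hfe]⟩
  · obtain ⟨c, hc, hcf⟩ := exists_incChain_of_opens_ne (κ := κ) hU hV hUV f hfV.1 hfe fun h =>
      hfU ⟨hfV.1, hUV f hfe ▸ hfV.2.1, h.2 hfV.2.2⟩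
    exact ⟨c, hc, List.mem_cons_of_mem _ (List.mem_of_getLast? hcf)⟩

theorem IncChain.isNN_head {d : ℕ} {U : Config d} {e f : Sym2 (Vertex d)}
    {c : List (Sym2 (Vertex d))} (h : IncChain U e c) (hf : f ∈ e :: c) (hfN : IsNNEdge f) :
    IsNNEdge e := by
  cases c with
  | nil => exact (List.mem_singleton.1 hf) ▸ hfN
  | cons g c => exact (List.isChain_cons_cons.1 h.1).1.1

/-! ### Reconnecting -/

theorem exists_boundary_of_reachable {V : Type*} {G : SimpleGraph V} {a b : V}
    (h : G.Reachable a b) (S : Set V) (ha : a ∈ S) (hb : b ∉ S) :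
    ∃ x y, G.Adj x y ∧ x ∈ S ∧ y ∉ S := by
  obtain ⟨w⟩ := h
  obtain ⟨D, -, h1, h2⟩ := w.exists_boundary_dart S ha hb
  exact ⟨_, _, D.adj, h1, h2⟩

theorem ncard_neighborSet_le_two {V : Type*} {G : SimpleGraph V} {a b : V} {w : G.Walk a b}
    (hw : w.IsPath) (v : V) : (w.toSubgraph.neighborSet v).ncard ≤ 2 := by
  by_cases hv : v ∈ w.support
  · obtain ⟨i, rfl, hi⟩ := SimpleGraph.Walk.mem_support_iff_exists_getVert.1 hv
    by_cases hnil : w.Nil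
    · have hl := SimpleGraph.Walk.length_eq_zero_iff.2 hnil
      cases w with
      | nil => simp
      | cons _ _ => simp at hl
    rcases Nat.eq_zero_or_pos i with rfl | h0
    · rw [SimpleGraph.Walk.getVert_zero, hw.neighborSet_toSubgraph_startpoint hnil]
      simp
    rcases hi.eq_or_lt with rfl | h1
    · rw [SimpleGraph.Walk.getVert_length, hw.neighborSet_toSubgraph_endpoint hnil]
      simp
    · rw [hw.ncard_neighborSet_toSubgraph_internal_eq_two h0.ne' h1]
  · have : w.toSubgraph.neighborSet v = ∅ := by
      ext x
      simp only [SimpleGraph.Subgraph.mem_neighborSet, Set.mem_empty_iff_false, iff_false]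
      exact fun h => hv (SimpleGraph.Walk.mem_verts_toSubgraph w |>.1 h.fst_mem)
    simp [this]

theorem reachable_of_chain {d : ℕ} {G : SimpleGraph (Vertex d)} {e : Sym2 (Vertex d)}
    {c : List (Sym2 (Vertex d))} (hc : (e :: c).IsChain AdjE)
    (hG : ∀ g ∈ e :: c, ∀ x y, x ∈ g → y ∈ g → G.Reachable x y) :
    ∀ x ∈ e, ∀ g ∈ e :: c, ∀ y ∈ g, G.Reachable x y := by
  induction c generalizing e with
  | nil =>
    intro x hx g hg y hy
    rw [List.mem_singleton] at hg
    subst hg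
    exact hG g (by simp) x y hx hy
  | cons f c ih =>
    rw [List.isChain_cons_cons] at hc
    intro x hx g hg y hy
    rcases List.mem_cons.1 hg with rfl | hg
    · exact hG g (by simp) x y hx hy
    · obtain ⟨v, hve, hvf⟩ := hc.1.2.2
      exact (hG e (by simp) x v hx hve).trans
        (ih hc.2 (fun g hg => hG g (List.mem_cons_of_mem _ hg)) v hvf g hg y hy)

/-- Vertices connected to the vertex set of a connected list of edges can be connected to each
other by opening an admissible finite set of edges. -/
theorem exists_admissible {d κ : ℕ} (hκ : 2 ≤ κ) {U : Config d} {p : ℝ} {e : Sym2 (Vertex d)}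
    {c₁ c₂ : List (Sym2 (Vertex d))} (he : IsNNEdge e) (h₁ : IncChain U e c₁)
    (h₂ : IncChain U e c₂) {a b x y : Vertex d}
    (hx : x ∈ verts (e :: (c₁ ++ c₂))) (hy : y ∈ verts (e :: (c₁ ++ c₂)))
    (hax : (openGraph κ U p).Reachable a x) (hby : (openGraph κ U p).Reachable b y) :
    ∃ Q : Finset (Sym2 (Vertex d)), Admissible κ U p (verts (e :: (c₁ ++ c₂))) (Q : Set _) ∧
      ∀ G : Set (Sym2 (Vertex d)),
        (∀ f ∈ openSet κ U p, ¬ Touches (verts (e :: (c₁ ++ c₂))) f → f ∈ G) → (∀ f ∈ Q, f ∈ G) →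
        (SimpleGraph.fromEdgeSet G).Reachable a b := by
  classical
  set S := verts (e :: (c₁ ++ c₂)) with hS
  set T : Set (Sym2 (Vertex d)) := {f | IsNNEdge f ∧ ∀ v ∈ f, v ∈ S} with hT
  set Γ := SimpleGraph.fromEdgeSet (openSet κ U p ∪ T) with hΓ
  have hle : openGraph κ U p ≤ Γ := SimpleGraph.fromEdgeSet_mono Set.subset_union_left
  have hnn : ∀ g ∈ e :: (c₁ ++ c₂), IsNNEdge g := by
    intro g hg
    have i1 := h₁.isNN he
    have i2 := h₂.isNN he
    simp only [List.mem_cons, List.mem_append] at hg i1 i2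
    rcases hg with h | h | h
    · exact i1 g (Or.inl h)
    · exact i1 g (Or.inr h)
    · exact i2 g (Or.inr h)
  have hedge : ∀ g ∈ e :: (c₁ ++ c₂), ∀ x y, x ∈ g → y ∈ g → Γ.Reachable x y := by
    intro g hg x y hx hy
    by_cases hxy : x = y
    · subst hxy; rfl
    · have hgxy : g = s(x, y) := (Sym2.mem_and_mem_iff hxy).1 ⟨hx, hy⟩
      refine SimpleGraph.Adj.reachable ?_
      rw [hΓ, SimpleGraph.fromEdgeSet_adj]
      refine ⟨Or.inr ⟨hgxy ▸ hnn g hg, ?_⟩, hxy⟩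
      rw [← hgxy]
      exact fun v hv => ⟨g, hg, hv⟩
  obtain ⟨z, hz⟩ : ∃ z, z ∈ e := by obtain ⟨z, w, -, rfl⟩ := he; exact ⟨z, by simp⟩
  have hzS : ∀ v ∈ S, Γ.Reachable z v := by
    rintro v ⟨g, hg, hv⟩
    have j1 := reachable_of_chain h₁.1 (G := Γ) (fun g hg => hedge g (by
      simp only [List.mem_cons, List.mem_append] at hg ⊢; tauto)) z hz
    have j2 := reachable_of_chain h₂.1 (G := Γ) (fun g hg => hedge g (by
      simp only [List.mem_cons, List.mem_append] at hg ⊢; tauto)) z hz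
    simp only [List.mem_cons, List.mem_append] at hg j1 j2
    rcases hg with h | h | h
    · exact j1 g (Or.inl h) v hv
    · exact j1 g (Or.inr h) v hv
    · exact j2 g (Or.inr h) v hv
  have hab : Γ.Reachable a b :=
    ((hax.mono hle).trans (hzS x hx).symm).trans ((hzS y hy).trans (hby.mono hle).symm)
  obtain ⟨w, hw⟩ := hab.exists_isPath
  have hwΓ : ∀ f ∈ w.edges, f ∈ openSet κ U p ∪ T := by
    intro f hf
    have := w.edges_subset_edgeSet hf
    rw [hΓ, SimpleGraph.edgeSet_fromEdgeSet] at this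
    exact this.1
  refine ⟨w.edges.toFinset.filter (Touches S), ?_, ?_⟩
  · have hmem : ∀ f, f ∈ ((w.edges.toFinset.filter (Touches S) : Finset _) : Set (Sym2 (Vertex d)))
        ↔ f ∈ w.edges ∧ Touches S f := by simp
    refine ⟨?_, ?_, ?_, ?_⟩
    · intro f hf
      rcases hwΓ f ((hmem f).1 hf).1 with h | h
      · exact h.1
      · exact h.1
    · exact fun f hf => ((hmem f).1 hf).2
    · rintro f hf ⟨v, hv, hvS⟩
      rcases hwΓ f ((hmem f).1 hf).1 with h | h
      · exact h
      · exact absurd (h.2 v hv) hvS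
    · intro v _
      refine le_trans ?_ ((ncard_neighborSet_le_two hw v).trans hκ)
      rw [← Set.ncard_coe_finset]
      have hfin : (w.toSubgraph.neighborSet v).Finite := w.finite_neighborSet_toSubgraph
      refine le_trans (Set.ncard_le_ncard ?_ (hfin.image fun u => s(v, u)))
        (Set.ncard_image_le hfin)
      intro f hf
      obtain ⟨hf1, hf2⟩ := (@Finset.mem_filter _ _ (_) _ _).1 (Finset.mem_coe.1 hf)
      obtain ⟨u, rfl⟩ := Sym2.mem_iff_exists.1 ((mem_edgesAt _ _).1 hf1).2
      exact ⟨u, by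
        rw [SimpleGraph.Subgraph.mem_neighborSet, ← SimpleGraph.Subgraph.mem_edgeSet,
          SimpleGraph.Walk.mem_edges_toSubgraph]
        exact ((hmem _).1 hf2).1, rfl⟩
  · intro G hG1 hG2
    have hall : ∀ f ∈ w.edges, f ∈ (SimpleGraph.fromEdgeSet G).edgeSet := by
      intro f hf
      have hfΓ := w.edges_subset_edgeSet hf
      rw [hΓ, SimpleGraph.edgeSet_fromEdgeSet] at hfΓ
      rw [SimpleGraph.edgeSet_fromEdgeSet]
      refine ⟨?_, hfΓ.2⟩
      by_cases hfS : Touches S f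
      · exact hG2 f (by simp [hf, hfS])
      · rcases hfΓ.1 with h | h
        · exact hG1 f h hfS
        · obtain ⟨u, v, -, rfl⟩ := h.1
          exact absurd ⟨u, by simp, h.2 u (by simp)⟩ hfS
    exact ⟨w.transfer _ hall⟩

/-! ### The product measure -/

/-- The uniform law of one label. -/
noncomputable def labelLaw : Measure ℝ := volume.restrict (Set.Icc 0 1)

instance : IsProbabilityMeasure labelLaw := ⟨by simp [labelLaw]⟩

theorem IsProductUniform.cyl {d : ℕ} {P : Measure (Config d)} (hP : IsProductUniform P)
    (s : Finset (Sym2 (Vertex d))) (f : Sym2 (Vertex d) → Set ℝ)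
    (hf : ∀ e ∈ s, MeasurableSet (f e)) :
    P {U | ∀ e ∈ s, U e ∈ f e} = ∏ e ∈ s, labelLaw (f e) := by
  rw [hP.2 s f hf]
  exact Finset.prod_congr rfl fun e he => (Measure.restrict_apply (hf e he)).symm

theorem IsProductUniform.eq_infinitePi {d : ℕ} {P : Measure (Config d)}
    (hP : IsProductUniform P) : P = Measure.infinitePi fun _ => labelLaw :=
  Measure.eq_infinitePi _ fun s t ht => by
    rw [← hP.cyl s t fun e _ => ht e]; rfl

theorem IsProductUniform.comp_perm {d : ℕ} {P : Measure (Config d)} (hP : IsProductUniform P)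
    (σ : Equiv.Perm (Sym2 (Vertex d))) :
    MeasurePreserving (fun U : Config d => U ∘ σ) P P := by
  classical
  have hm : Measurable fun U : Config d => U ∘ σ :=
    measurable_pi_lambda _ fun e => measurable_pi_apply (σ e)
  refine ⟨hm, ?_⟩
  rw [hP.eq_infinitePi]
  refine Measure.eq_infinitePi _ fun s t ht => ?_
  rw [← hP.eq_infinitePi, Measure.map_apply hm (MeasurableSet.pi s.countable_toSet fun e _ => ht e)]
  have := hP.cyl (s.map σ.toEmbedding) (fun e => t (σ.symm e)) fun e _ => ht _
  rw [Finset.prod_map] at this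
  simp only [Equiv.coe_toEmbedding, Equiv.symm_apply_apply] at this
  rw [← this]
  congr 1
  ext U
  simp only [Set.mem_preimage, Set.mem_pi, Finset.mem_coe, Function.comp_apply, Set.mem_ofPred_eq,
    Finset.mem_map_equiv]
  exact ⟨fun h e he => by simpa using h _ he, fun h e he => by simpa using h (σ e) (by simpa)⟩

/-- Exchanging the labels of the edges in `D` between two configurations. -/
noncomputable def swap {d : ℕ} (D : Set (Sym2 (Vertex d))) (X : Config d × Config d) :
    Config d × Config d := by
  classical
  exact (D.piecewise X.2 X.1, D.piecewise X.1 X.2)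

theorem swap_swap {d : ℕ} (D : Set (Sym2 (Vertex d))) (X : Config d × Config d) :
    swap D (swap D X) = X := by
  classical
  refine Prod.ext (funext fun e => ?_) (funext fun e => ?_) <;> by_cases he : e ∈ D <;>
    simp [swap, he]

theorem measurable_swap {d : ℕ} (D : Set (Sym2 (Vertex d))) : Measurable (swap D) := by
  classical
  refine Measurable.prodMk (measurable_pi_lambda _ fun e => ?_)
    (measurable_pi_lambda _ fun e => ?_) <;> by_cases he : e ∈ D <;> simp [he] <;> fun_prop

/-- The exchange as a measurable equivalence. -/
noncomputable def swapEquiv {d : ℕ} (D : Set (Sym2 (Vertex d))) :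
    Config d × Config d ≃ᵐ Config d × Config d where
  toFun := swap D
  invFun := swap D
  left_inv := swap_swap D
  right_inv := swap_swap D
  measurable_toFun := measurable_swap D
  measurable_invFun := measurable_swap D

theorem IsProductUniform.map_swap {d : ℕ} {P : Measure (Config d)} (hP : IsProductUniform P)
    (D : Set (Sym2 (Vertex d))) : (P.prod P).map (swap D) = P.prod P := by
  classical
  have := hP.1
  symm
  let C : Set (Set (Config d)) := squareCylinders fun _ => {s : Set ℝ | MeasurableSet s}
  have hgen : MeasurableSpace.generateFrom C = MeasurableSpace.pi := generateFrom_squareCylinders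
  have hpi : IsPiSystem C := isPiSystem_squareCylinders
    (fun _ => MeasurableSpace.isPiSystem_measurableSet) fun _ => by simp
  have huniv : Set.univ ∈ C := by
    exact ⟨∅, fun _ => Set.univ, by simp [Set.pi]⟩
  let sp : P.FiniteSpanningSetsIn C :=
    { set := fun _ => Set.univ
      set_mem := fun _ => huniv
      finite := fun _ => by simp
      spanning := Set.iUnion_const _ }
  refine Measure.prod_eq_generateFrom hgen hgen hpi hpi sp sp ?_
  rintro s ⟨I, f, hf, rfl⟩ t ⟨J, g, hg, rfl⟩
  replace hf : ∀ e, MeasurableSet (f e) := fun e => hf e trivial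
  replace hg : ∀ e, MeasurableSet (g e) := fun e => hg e trivial
  set f' : Sym2 (Vertex d) → Set ℝ := fun e => if e ∈ I then f e else Set.univ with hf'
  set g' : Sym2 (Vertex d) → Set ℝ := fun e => if e ∈ J then g e else Set.univ with hg'
  have hf'm : ∀ e, MeasurableSet (f' e) := fun e => by
    by_cases h : e ∈ I <;> simp [hf', h, hf e]
  have hg'm : ∀ e, MeasurableSet (g' e) := fun e => by
    by_cases h : e ∈ J <;> simp [hg', h, hg e]
  have e1 : (I : Set (Sym2 (Vertex d))).pi f = {U : Config d | ∀ e ∈ I ∪ J, U e ∈ f' e} := by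
    ext U
    simp only [Set.mem_pi, Finset.mem_coe, Set.mem_ofPred_eq, Finset.mem_union, hf']
    refine forall_congr' fun e => ?_
    by_cases h : e ∈ I <;> simp [h]
  have e2 : (J : Set (Sym2 (Vertex d))).pi g = {U : Config d | ∀ e ∈ I ∪ J, U e ∈ g' e} := by
    ext U
    simp only [Set.mem_pi, Finset.mem_coe, Set.mem_ofPred_eq, Finset.mem_union, hg']
    refine forall_congr' fun e => ?_
    by_cases h : e ∈ J <;> simp [h]
  have hms : ∀ F : Sym2 (Vertex d) → Set ℝ, (∀ e, MeasurableSet (F e)) →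
      MeasurableSet {U : Config d | ∀ e ∈ I ∪ J, U e ∈ F e} := fun F hF => by
    have : {U : Config d | ∀ e ∈ I ∪ J, U e ∈ F e} =
        ((I ∪ J : Finset _) : Set (Sym2 (Vertex d))).pi F := by ext; simp [Set.mem_pi]
    rw [this]
    exact MeasurableSet.pi (Finset.countable_toSet _) fun e _ => hF e
  rw [e1, e2, Measure.map_apply (measurable_swap D) ((hms f' hf'm).prod (hms g' hg'm))]
  have e3 : swap D ⁻¹' ({U : Config d | ∀ e ∈ I ∪ J, U e ∈ f' e} ×ˢ
        {U : Config d | ∀ e ∈ I ∪ J, U e ∈ g' e}) =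
      {U : Config d | ∀ e ∈ I ∪ J, U e ∈ (if e ∈ D then g' e else f' e)} ×ˢ
        {U : Config d | ∀ e ∈ I ∪ J, U e ∈ (if e ∈ D then f' e else g' e)} := by
    ext ⟨X, Y⟩
    simp only [Set.mem_preimage, Set.mem_prod, Set.mem_ofPred_eq, swap, ← forall_and]
    refine forall_congr' fun e => ?_
    by_cases h : e ∈ D <;> simp [h] <;> tauto
  rw [e3, Measure.prod_prod, hP.cyl, hP.cyl, hP.cyl, hP.cyl, ← Finset.prod_mul_distrib,
    ← Finset.prod_mul_distrib]
  · refine Finset.prod_congr rfl fun e _ => ?_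
    by_cases h : e ∈ D <;> simp [h, mul_comm]
  all_goals
    intro e _
    try split_ifs
    all_goals first | exact hf'm e | exact hg'm e

theorem IsProductUniform.prod_preimage_swap {d : ℕ} {P : Measure (Config d)}
    (hP : IsProductUniform P) (D : Set (Sym2 (Vertex d))) (S : Set (Config d × Config d)) :
    P.prod P (swap D ⁻¹' S) = P.prod P S :=
  MeasurePreserving.measure_preimage_equiv (f := swapEquiv D)
    ⟨measurable_swap D, hP.map_swap D⟩ S

/-- If exchanging the labels in `D` maps `F × R` into `G × O`, then `P F * P R ≤ P G * P O`. -/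
theorem IsProductUniform.mul_le_of_swap {d : ℕ} {P : Measure (Config d)}
    (hP : IsProductUniform P) (D : Set (Sym2 (Vertex d))) {F R G O : Set (Config d)}
    (h : ∀ X ∈ F, ∀ Y ∈ R, (swap D (X, Y)).1 ∈ G ∧ (swap D (X, Y)).2 ∈ O) :
    P F * P R ≤ P G * P O := by
  have := hP.1
  rw [← Measure.prod_prod, ← Measure.prod_prod, ← hP.prod_preimage_swap D (G ×ˢ O)]
  exact measure_mono fun X hX => h X.1 hX.1 X.2 hX.2

/-- The label of an edge is independent of the events which do not depend on it. -/
theorem IsProductUniform.label_inter {d : ℕ} {P : Measure (Config d)}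
    (hP : IsProductUniform P) (e : Sym2 (Vertex d)) {I : Set ℝ} (hI : MeasurableSet I)
    {B : Set (Config d)} (hB : ∀ U t, Function.update U e t ∈ B ↔ U ∈ B) :
    P ({U | U e ∈ I} ∩ B) = labelLaw I * P B := by
  classical
  have := hP.1
  have h1 : P {U | U e ∈ I} = labelLaw I := by
    have := hP.cyl {e} (fun _ => I) fun _ _ => hI
    simpa using this
  have h2 := hP.prod_preimage_swap {e} (({U | U e ∈ I} ∩ B) ×ˢ Set.univ)
  rw [Measure.prod_prod, measure_univ, mul_one] at h2
  rw [← h2, ← h1, mul_comm, ← Measure.prod_prod]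
  congr 1
  ext ⟨X, Y⟩
  have hs : (swap {e} (X, Y)).1 = Function.update X e (Y e) := by
    funext f
    by_cases hf : f = e
    · subst hf; simp [swap]
    · simp [swap, hf]
  simp only [Set.mem_prod, Set.mem_preimage, Set.mem_inter_iff, Set.mem_ofPred_eq, Set.mem_univ,
    and_true, hs, hB, Function.update_self]
  tauto

/-! ### Ordered labels -/

theorem IsProductUniform.strictMono_le {d : ℕ} {P : Measure (Config d)}
    (hP : IsProductUniform P) {m : ℕ} (i : Fin m ↪ Sym2 (Vertex d)) :
    P {U | StrictMono (U ∘ i)} ≤ ((m.factorial : ℕ) : ENNReal)⁻¹ := by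
  classical
  have := hP.1
  set O : Set (Config d) := {U | StrictMono (U ∘ i)} with hO
  have hOm : MeasurableSet O := by
    have : O = ⋂ a : Fin m, ⋂ b : Fin m, ⋂ _ : a < b, {U : Config d | U (i a) < U (i b)} := by
      ext U
      simp only [hO, Set.mem_ofPred_eq, Set.mem_iInter]
      exact ⟨fun h a b hab => h hab, fun h a b hab => h a b hab⟩
    rw [this]
    refine MeasurableSet.iInter fun a => MeasurableSet.iInter fun b => MeasurableSet.iInter
      fun _ => measurableSet_lt (measurable_pi_apply _) (measurable_pi_apply _)
  have hpre : ∀ σ : Equiv.Perm (Fin m),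
      P ((fun U : Config d => U ∘ (σ.viaEmbedding i)) ⁻¹' O) = P O := fun σ =>
    (hP.comp_perm _).measure_preimage hOm.nullMeasurableSet
  have hdisj : Pairwise (Function.onFun Disjoint fun σ : Equiv.Perm (Fin m) =>
      (fun U : Config d => U ∘ (σ.viaEmbedding i)) ⁻¹' O) := by
    intro σ τ hστ
    rw [Function.onFun, Set.disjoint_left]
    intro U h1 h2
    apply hστ
    have key : ∀ ρ : Equiv.Perm (Fin m), (U ∘ (ρ.viaEmbedding i)) ∘ i = (U ∘ i) ∘ ρ := by
      intro ρ; funext a; simp [Equiv.Perm.viaEmbedding_apply]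
    simp only [hO, Set.mem_preimage, Set.mem_ofPred_eq] at h1 h2
    rw [key] at h1 h2
    have heq := Tuple.unique_monotone h1.monotone h2.monotone
    have hinj : Function.Injective (U ∘ i) := by
      have := h1.injective.comp σ.symm.injective
      rwa [Function.comp_assoc, Equiv.self_comp_symm, Function.comp_id] at this
    ext a
    exact congrArg Fin.val (hinj (congrFun heq a))
  have hsum : ∑ σ : Equiv.Perm (Fin m),
      P ((fun U : Config d => U ∘ (σ.viaEmbedding i)) ⁻¹' O) ≤ 1 := by
    have hU := measure_biUnion_finset (μ := P) (s := Finset.univ)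
      (f := fun σ : Equiv.Perm (Fin m) => (fun U : Config d => U ∘ (σ.viaEmbedding i)) ⁻¹' O)
      (fun a _ b _ hab => hdisj hab) (fun σ _ => (hP.comp_perm _).measurable hOm)
    rw [← hU]
    exact prob_le_one
  simp only [hpre, Finset.sum_const, Finset.card_univ, Fintype.card_perm, Fintype.card_fin,
    nsmul_eq_mul] at hsum
  rw [ENNReal.le_inv_iff_mul_le, mul_comm]
  exact hsum

theorem IsProductUniform.isChain_le {d : ℕ} {P : Measure (Config d)}
    (hP : IsProductUniform P) (c : List (Sym2 (Vertex d))) :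
    P {U | c.IsChain (U · < U ·)} ≤ ((c.length.factorial : ℕ) : ENNReal)⁻¹ := by
  have key : ∀ U : Config d, c.IsChain (U · < U ·) → StrictMono (U ∘ c.get) := by
    intro U h
    have : Trans (fun a b : Sym2 (Vertex d) => U a < U b) (fun a b => U a < U b)
        (fun a b => U a < U b) := ⟨fun h1 h2 => h1.trans h2⟩
    have := (List.isChain_iff_pairwise).1 h
    exact fun a b hab => List.pairwise_iff_get.1 this a b hab
  by_cases hc : Function.Injective c.get
  · exact (measure_mono fun U hU => key U hU).trans (hP.strictMono_le ⟨c.get, hc⟩)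
  · have : {U : Config d | c.IsChain (U · < U ·)} = ∅ := by
      ext U
      simp only [Set.mem_ofPred_eq, Set.mem_empty_iff_false, iff_false]
      exact fun h => hc ((key U h).injective.of_comp)
    simp [this]

/-! ### Good configurations -/

/-- Configurations with distinct labels in `[0,1]` and monotone chains of bounded length. -/
structure Good {d : ℕ} (U : Config d) : Prop where
  mem_Icc : ∀ e, U e ∈ Set.Icc (0 : ℝ) 1
  distinct : DistinctLabels U
  inc : ∀ e, ∃ m, ∀ c ∈ chains e m, ¬ c.IsChain (U · < U ·)
  dec : ∀ e, ∃ m, ∀ c ∈ chains e m, ¬ c.IsChain (U · > U ·)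

theorem isChain_map_range' {α : Type*} {R : α → α → Prop} {x : ℕ → α}
    (h : ∀ n, R (x n) (x (n + 1))) (k m : ℕ) : ((List.range' k m).map x).IsChain R := by
  induction m generalizing k with
  | zero => simp
  | succ m ih =>
    cases m with
    | zero => simp
    | succ m =>
      have := ih (k + 1)
      rw [List.range'_succ, List.map_cons] at this ⊢
      rw [List.range'_succ, List.map_cons, List.isChain_cons_cons]
      exact ⟨h k, this⟩

theorem no_infinite_chain {d : ℕ} {R : Sym2 (Vertex d) → Sym2 (Vertex d) → Prop}
    (h : ∀ e, ∃ m, ∀ c ∈ chains e m, ¬ c.IsChain R) (x : ℕ → Sym2 (Vertex d))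
    (hadj : ∀ n, AdjE (x n) (x (n + 1))) : ¬ ∀ n, R (x n) (x (n + 1)) := by
  intro hR
  obtain ⟨m, hm⟩ := h (x 0)
  refine hm ((List.range' 1 m).map x) ((mem_chains _ _ _).2 ⟨by simp, ?_⟩)
    (isChain_map_range' hR 1 m)
  have := isChain_map_range' hadj 0 (m + 1)
  rwa [List.range'_succ, List.map_cons] at this

theorem Good.wf {d : ℕ} {U : Config d} (h : Good U) : WellFounded (Below U) := by
  rw [wellFounded_iff_isEmpty_descending_chain]
  exact ⟨fun ⟨x, hx⟩ => no_infinite_chain h.dec x (fun n => (hx n).1.symm) fun n => (hx n).2⟩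

theorem Good.mem_goodConfigs {d : ℕ} {U : Config d} (h : Good U) : U ∈ goodConfigs d := by
  refine ⟨fun e _ => h.mem_Icc e, h.distinct, ?_⟩
  rintro ⟨w, hw, hm⟩
  have hadj : ∀ n, AdjE s(w n, w (n + 1)) s(w (n + 1), w (n + 1 + 1)) := fun n =>
    ⟨(isNNEdge_mk _ _).2 (hw n), (isNNEdge_mk _ _).2 (hw (n + 1)), w (n + 1), by simp, by simp⟩
  rcases hm with hm | hm
  · exact no_infinite_chain h.inc (fun n => s(w n, w (n + 1))) hadj fun n => hm n.lt_succ_self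
  · exact no_infinite_chain h.dec (fun n => s(w n, w (n + 1))) hadj fun n => hm n.lt_succ_self

theorem exists_pow_mul_inv_factorial_lt (B : ℕ) {ε : ENNReal} (hε : 0 < ε) :
    ∃ m : ℕ, ((B ^ m : ℕ) : ENNReal) * ((m.factorial : ℕ) : ENNReal)⁻¹ < ε := by
  have h := FloorSemiring.tendsto_pow_div_factorial_atTop (K := ℝ) (B : ℝ)
  have h2 := (ENNReal.continuous_ofReal.tendsto 0).comp h
  rw [ENNReal.ofReal_zero] at h2
  obtain ⟨m, hm⟩ := (h2.eventually (gt_mem_nhds hε)).exists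
  refine ⟨m, lt_of_eq_of_lt ?_ hm⟩
  rw [Function.comp_apply, ENNReal.ofReal_div_of_pos (by positivity), ← Nat.cast_pow,
    ENNReal.ofReal_natCast, ENNReal.ofReal_natCast, div_eq_mul_inv]

theorem IsProductUniform.label_ne {d : ℕ} {P : Measure (Config d)} (hP : IsProductUniform P)
    {e f : Sym2 (Vertex d)} (hef : e ≠ f) : ∀ᵐ U ∂P, U e ≠ U f := by
  classical
  have := hP.1
  have hm : MeasurableSet {X : Config d × Config d | X.2 e = X.1 f} :=
    measurableSet_eq_fun (by fun_prop) (by fun_prop)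
  have h0 : P.prod P {X : Config d × Config d | X.2 e = X.1 f} = 0 := by
    rw [Measure.measure_prod_null hm]
    refine Filter.Eventually.of_forall fun X => ?_
    have := hP.cyl {e} (fun _ => {X f}) fun _ _ => measurableSet_singleton _
    simpa [labelLaw] using this
  have h1 := hP.prod_preimage_swap {e} ({U : Config d | U e = U f} ×ˢ Set.univ)
  have h2 : swap {e} ⁻¹' ({U : Config d | U e = U f} ×ˢ Set.univ) =
      {X : Config d × Config d | X.2 e = X.1 f} := by
    ext X
    simp [swap, hef.symm]
  rw [h2, h0, Measure.prod_prod, measure_univ, mul_one] at h1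
  rw [ae_iff]
  simpa using h1.symm

theorem ae_no_chain {d : ℕ} {P : Measure (Config d)}
    (R : Config d → Sym2 (Vertex d) → Sym2 (Vertex d) → Prop)
    (hR : ∀ c : List (Sym2 (Vertex d)),
      P {U | c.IsChain (R U)} ≤ ((c.length.factorial : ℕ) : ENNReal)⁻¹)
    (e : Sym2 (Vertex d)) : ∀ᵐ U ∂P, ∃ m, ∀ c ∈ chains e m, ¬ c.IsChain (R U) := by
  rw [ae_iff]
  refine le_antisymm (le_of_forall_gt fun ε hε => ?_) zero_le
  obtain ⟨m, hm⟩ := exists_pow_mul_inv_factorial_lt (nbrBound d) hε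
  refine lt_of_le_of_lt ?_ hm
  have hsub : {U : Config d | ¬ ∃ m, ∀ c ∈ chains e m, ¬ c.IsChain (R U)} ⊆
      ⋃ c ∈ chains e m, {U | c.IsChain (R U)} := by
    intro U hU
    simp only [Set.mem_ofPred_eq, not_exists, not_forall, not_not] at hU
    obtain ⟨c, hc, h⟩ := hU m
    exact Set.mem_biUnion hc h
  refine (measure_mono hsub).trans ((measure_biUnion_finset_le _ _).trans ?_)
  refine (Finset.sum_le_card_nsmul _ _ ((m.factorial : ℕ) : ENNReal)⁻¹ fun c hc => ?_).trans ?_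
  · have := hR c
    rwa [((mem_chains _ _ _).1 hc).1] at this
  · rw [nsmul_eq_mul]
    gcongr
    exact card_chains_le e m

theorem IsProductUniform.ae_good {d : ℕ} {P : Measure (Config d)} (hP : IsProductUniform P) :
    ∀ᵐ U ∂P, Good U := by
  have h1 : ∀ᵐ U ∂P, ∀ e, U e ∈ Set.Icc (0 : ℝ) 1 := by
    rw [ae_all_iff]
    intro e
    rw [ae_iff]
    have := hP.cyl {e} (fun _ => (Set.Icc 0 1)ᶜ) fun _ _ => measurableSet_Icc.compl
    simpa [labelLaw] using this
  have h2 : ∀ᵐ U ∂P, ∀ e f, e ≠ f → U e ≠ U f := by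
    rw [ae_all_iff]; intro e
    rw [ae_all_iff]; intro f
    by_cases h : e = f
    · simp [h]
    · filter_upwards [hP.label_ne h] with U hU _ using hU
  have h3 : ∀ᵐ U ∂P, ∀ e, ∃ m, ∀ c ∈ chains e m, ¬ c.IsChain (U · < U ·) := by
    rw [ae_all_iff]
    exact ae_no_chain (fun U a b => U a < U b) hP.isChain_le
  have h4 : ∀ᵐ U ∂P, ∀ e, ∃ m, ∀ c ∈ chains e m, ¬ c.IsChain (U · > U ·) := by
    rw [ae_all_iff]
    refine ae_no_chain (fun U a b => U a > U b) fun c => ?_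
    have := hP.isChain_le c.reverse
    rw [List.length_reverse] at this
    convert this using 4 with U
    rw [List.isChain_reverse]
  filter_upwards [h1, h2, h3, h4] with U i1 i2 i3 i4
  exact ⟨i1, fun e f _ _ h => by_contra fun hne => i2 e f hne h, i3, i4⟩

/-! ### Measurability -/

theorem measurable_label {d : ℕ} (e : Sym2 (Vertex d)) : Measurable fun U : Config d => U e :=
  measurable_pi_apply e

theorem measurableSet_openStep {d κ : ℕ} (m : ℕ) (e : Sym2 (Vertex d)) :
    MeasurableSet {U : Config d | openStep κ U m e} := by
  classical
  induction m generalizing e with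
  | zero => simp [openStep]
  | succ m ih =>
    simp only [openStep]
    have : {U : Config d | ∀ v ∈ e, lowerDegree U (openStep κ U m) e v < κ} =
        ⋂ v : Vertex d, ⋂ _ : v ∈ e, {U | lowerDegree U (openStep κ U m) e v < κ} := by
      ext; simp
    rw [this]
    refine MeasurableSet.iInter fun v => MeasurableSet.iInter fun _ => ?_
    refine measurableSet_lt ?_ measurable_const
    simp only [lowerDegree, Finset.card_filter]
    refine Finset.measurable_sum _ fun f _ => ?_
    refine Measurable.ite ?_ measurable_const measurable_const
    exact (MeasurableSet.const _).inter
      ((measurableSet_lt (measurable_label f) (measurable_label e)).inter (ih f))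

theorem measurableSet_mem_openSet {d κ : ℕ} (p : ℝ) (e : Sym2 (Vertex d)) :
    MeasurableSet {U : Config d | e ∈ openSet κ U p} := by
  refine (MeasurableSet.const _).inter
    ((measurableSet_le (measurable_label e) measurable_const).inter ?_)
  have : {U : Config d | Opens κ U e} = ⋃ M : ℕ, ⋂ m : ℕ, ⋂ _ : m ≥ M, {U | openStep κ U m e} := by
    ext; simp [Opens]
  change MeasurableSet {U : Config d | Opens κ U e}
  rw [this]
  exact MeasurableSet.iUnion fun M => MeasurableSet.iInter fun m => MeasurableSet.iInter
    fun _ => measurableSet_openStep m e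

theorem measurableSet_reachable {α V : Type*} [MeasurableSpace α] [Countable V]
    (G : α → SimpleGraph V) (hG : ∀ x y, MeasurableSet {u | (G u).Adj x y}) (a b : V) :
    MeasurableSet {u | (G u).Reachable a b} := by
  have key : ∀ n : ℕ, ∀ a, MeasurableSet {u | ∃ w : (G u).Walk a b, w.length = n} := by
    intro n
    induction n with
    | zero =>
      intro a
      by_cases hab : a = b
      · subst hab
        convert MeasurableSet.univ
        exact Set.eq_univ_of_forall fun u => ⟨SimpleGraph.Walk.nil, rfl⟩
      · convert MeasurableSet.empty
        refine Set.eq_empty_of_forall_notMem fun u => ?_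
        rintro ⟨w, hw⟩
        exact hab (SimpleGraph.Walk.eq_of_length_eq_zero hw)
    | succ n ih =>
      intro a
      have : {u | ∃ w : (G u).Walk a b, w.length = n + 1} =
          ⋃ c : V, {u | (G u).Adj a c} ∩ {u | ∃ w : (G u).Walk c b, w.length = n} := by
        ext u
        simp only [Set.mem_ofPred_eq, Set.mem_iUnion, Set.mem_inter_iff]
        constructor
        · rintro ⟨w, hw⟩
          cases w with
          | nil => simp at hw
          | cons h w => exact ⟨_, h, w, by simpa using hw⟩
        · rintro ⟨c, h, w, rfl⟩
          exact ⟨SimpleGraph.Walk.cons h w, rfl⟩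
      rw [this]
      exact MeasurableSet.iUnion fun c => (hG a c).inter (ih c)
  have : {u | (G u).Reachable a b} = ⋃ n : ℕ, {u | ∃ w : (G u).Walk a b, w.length = n} := by
    ext u
    simp only [Set.mem_ofPred_eq, Set.mem_iUnion]
    exact ⟨fun ⟨w⟩ => ⟨_, w, rfl⟩, fun ⟨_, w, _⟩ => ⟨w⟩⟩
  rw [this]
  exact MeasurableSet.iUnion fun n => key n a

/-! ### The one-arm event -/

/-- The origin is connected to the sphere of radius `n` by edges in `S`. -/
def Arm {d : ℕ} (n : ℕ) (S : Set (Sym2 (Vertex d))) : Prop :=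
  ∃ b : Vertex d, norm1 b = n ∧ (SimpleGraph.fromEdgeSet S).Reachable 0 b

theorem Arm.mono {d n : ℕ} {S T : Set (Sym2 (Vertex d))} (h : Arm n S) (hST : S ⊆ T) :
    Arm n T :=
  let ⟨b, hb, hr⟩ := h
  ⟨b, hb, hr.mono (SimpleGraph.fromEdgeSet_mono hST)⟩

/-- The event that the origin is joined to the sphere of radius `n` by `p`-open edges. -/
def armEvent {d : ℕ} (κ n : ℕ) (p : ℝ) : Set (Config d) := {U | Arm n (openSet κ U p)}

theorem measurableSet_openConnected {d κ : ℕ} (p : ℝ) (a b : Vertex d) :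
    MeasurableSet {U : Config d | (openGraph κ U p).Reachable a b} :=
  measurableSet_reachable _ (fun x y => by
    simp only [openGraph_adj]; exact measurableSet_mem_openSet p _) a b

theorem measurableSet_armEvent {d κ n : ℕ} (p : ℝ) :
    MeasurableSet (armEvent κ n p : Set (Config d)) := by
  have : (armEvent κ n p : Set (Config d)) =
      ⋃ b : Vertex d, ⋃ _ : norm1 b = n, {U | (openGraph κ U p).Reachable 0 b} := by
    ext U
    simp [armEvent, Arm, openGraph]
  rw [this]
  exact MeasurableSet.iUnion fun b => MeasurableSet.iUnion fun _ =>
    measurableSet_openConnected p 0 b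

/-! ### Balls of edges -/

/-- The edges at graph distance at most `r` from `e`. -/
noncomputable def ball {d : ℕ} (e : Sym2 (Vertex d)) : ℕ → Finset (Sym2 (Vertex d))
  | 0 => {e}
  | r + 1 => by
      classical
      exact (ball e r).biUnion edgeNbrs

theorem mem_ball_succ {d : ℕ} {e f : Sym2 (Vertex d)} {r : ℕ} :
    f ∈ ball e (r + 1) ↔ ∃ g ∈ ball e r, AdjE g f := by
  classical
  simp [ball, mem_edgeNbrs]

theorem mem_ball_succ' {d : ℕ} {e f : Sym2 (Vertex d)} {r : ℕ} :
    f ∈ ball e (r + 1) ↔ ∃ g, AdjE e g ∧ f ∈ ball g r := by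
  induction r generalizing f with
  | zero => rw [mem_ball_succ]; simp [ball]
  | succ r ih =>
    rw [mem_ball_succ]
    constructor
    · rintro ⟨g, hg, hgf⟩
      obtain ⟨h, h1, h2⟩ := ih.1 hg
      exact ⟨h, h1, mem_ball_succ.2 ⟨g, h2, hgf⟩⟩
    · rintro ⟨g, hg, hf⟩
      obtain ⟨h, h1, h2⟩ := mem_ball_succ.1 hf
      exact ⟨h, ih.2 ⟨g, hg, h1⟩, h2⟩

theorem mem_ball_comm {d : ℕ} {e f : Sym2 (Vertex d)} {r : ℕ} : f ∈ ball e r ↔ e ∈ ball f r := by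
  induction r generalizing e f with
  | zero => simp [ball, eq_comm]
  | succ r ih =>
    rw [mem_ball_succ, mem_ball_succ']
    constructor
    · rintro ⟨g, h1, h2⟩; exact ⟨g, h2.symm, ih.1 h1⟩
    · rintro ⟨g, h1, h2⟩; exact ⟨g, ih.2 h2, h1.symm⟩

theorem card_ball_le {d : ℕ} (e : Sym2 (Vertex d)) (r : ℕ) :
    (ball e r).card ≤ nbrBound d ^ r := by
  classical
  induction r with
  | zero => simp [ball]
  | succ r ih =>
    rw [ball, pow_succ]
    exact (Finset.card_biUnion_le_card_mul _ _ _ fun f _ => card_edgeNbrs_le f).trans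
      (Nat.mul_le_mul_right _ ih)

theorem ball_mono {d : ℕ} {e : Sym2 (Vertex d)} (he : IsNNEdge e) : Monotone (ball e) := by
  refine monotone_nat_of_le_succ fun r f hf => mem_ball_succ.2 ⟨f, hf, AdjE.refl ?_⟩
  cases r with
  | zero => exact (Finset.mem_singleton.1 hf) ▸ he
  | succ r => obtain ⟨g, -, h⟩ := mem_ball_succ.1 hf; exact h.2.1

theorem mem_ball_of_isChain {d : ℕ} {e : Sym2 (Vertex d)} (he : IsNNEdge e)
    {c : List (Sym2 (Vertex d))} (hc : (e :: c).IsChain AdjE) :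
    ∀ g ∈ e :: c, g ∈ ball e c.length := by
  induction c generalizing e with
  | nil => intro g hg; simpa [ball] using hg
  | cons f c ih =>
    rw [List.isChain_cons_cons] at hc
    intro g hg
    rcases List.mem_cons.1 hg with rfl | hg
    · exact ball_mono he (Nat.zero_le _) (by simp [ball])
    · exact mem_ball_succ'.2 ⟨f, hc.1, ih hc.1.2.1 hc.2 g hg⟩

theorem hull_subset_ball {d : ℕ} {e : Sym2 (Vertex d)} (he : IsNNEdge e)
    {c₁ c₂ : List (Sym2 (Vertex d))} (h₁ : (e :: c₁).IsChain AdjE)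
    (h₂ : (e :: c₂).IsChain AdjE) :
    hull (e :: (c₁ ++ c₂)) ⊆ ball e (c₁.length + c₂.length + 2) := by
  intro f hf
  obtain ⟨g, hg, h, hgh, hhf⟩ := (mem_hull _ _).1 hf
  have hg' : g ∈ ball e (c₁.length + c₂.length) := by
    rw [← List.cons_append, List.mem_append] at hg
    rcases hg with hg | hg
    · exact ball_mono he (Nat.le_add_right _ _) (mem_ball_of_isChain he h₁ g hg)
    · exact ball_mono he (Nat.le_add_left _ _)
        (mem_ball_of_isChain he h₂ g (List.mem_cons_of_mem _ hg))
  exact mem_ball_succ.2 ⟨h, mem_ball_succ.2 ⟨g, hg', hgh⟩, hhf⟩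

theorem tsum_sum_ball_le {d : ℕ} (X : Sym2 (Vertex d) → ENNReal) (r : ℕ) :
    ∑' e, ∑ f ∈ ball e r, X f ≤ (nbrBound d ^ r : ℕ) * ∑' f, X f := by
  classical
  have h1 : ∀ e : Sym2 (Vertex d), ∑ f ∈ ball e r, X f =
      ∑' f, if f ∈ ball e r then X f else 0 := by
    intro e
    rw [tsum_eq_sum (s := ball e r) fun f hf => by simp [hf]]
    exact Finset.sum_congr rfl fun f hf => by simp [hf]
  simp_rw [h1]
  rw [ENNReal.tsum_comm, ← ENNReal.tsum_mul_left]
  refine ENNReal.tsum_le_tsum fun f => ?_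
  simp_rw [mem_ball_comm (f := f)]
  rw [tsum_eq_sum (s := ball f r) fun e he => by simp [he]]
  refine (Finset.sum_le_card_nsmul _ _ (X f) fun e he => by simp [he]).trans ?_
  rw [nsmul_eq_mul]
  gcongr
  exact card_ball_le f r

/-! ### Local modification -/

/-- Opening a suitable finite set of edges and closing the other edges in a neighbourhood of two
chains starting from `e` always leads to the event `G f`, for some `f` nearby. -/
def Surgeable {d : ℕ} (κ : ℕ) (p : ℝ) (e : Sym2 (Vertex d))
    (G : Sym2 (Vertex d) → Set (Config d)) (U : Config d) : Prop :=
  ∃ c₁ c₂, IncChain U e c₁ ∧ IncChain U e c₂ ∧ ∃ Q : Finset (Sym2 (Vertex d)),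
    (Q : Set _) ⊆ resampled κ U p (verts (e :: (c₁ ++ c₂))) (hull (e :: (c₁ ++ c₂))) ∧
    ∃ f ∈ hull (e :: (c₁ ++ c₂)), ∀ V : Config d, (∀ g ∈ Q, V g ≤ p) →
      (∀ g ∈ resampled κ U p (verts (e :: (c₁ ++ c₂))) (hull (e :: (c₁ ++ c₂))),
        g ∉ Q → p < V g) →
      (∀ g ∉ resampled κ U p (verts (e :: (c₁ ++ c₂))) (hull (e :: (c₁ ++ c₂))), V g = U g) →
      V ∈ G f

/-- The weight of a pair of chains of given lengths in the union bound. -/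
noncomputable def weight (d : ℕ) (c₀ : ENNReal) (m₁ m₂ : ℕ) : ENNReal :=
  (nbrBound d ^ m₁ : ℕ) * ((nbrBound d ^ m₂ : ℕ) *
    ((4 * c₀⁻¹) ^ ((m₁ + m₂ + 1) * (nbrBound d * nbrBound d)) *
      (((max m₁ m₂).factorial : ℕ) : ENNReal)⁻¹))

theorem mem_resampled_of_mem {d κ : ℕ} {U : Config d} {p : ℝ} {l : List (Sym2 (Vertex d))}
    (hl : ∀ g ∈ l, IsNNEdge g) {g : Sym2 (Vertex d)} (hg : g ∈ l) :
    g ∈ resampled κ U p (verts l) (hull l) := by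
  have hT : Touches (verts l) g := by
    obtain ⟨x, y, -, rfl⟩ := hl g hg
    exact ⟨x, by simp, _, hg, by simp⟩
  exact ⟨hull_of_touches hl hT (AdjE.refl (hl g hg)), fun h => h.2 hT⟩

theorem isNN_append {d : ℕ} {U : Config d} {e : Sym2 (Vertex d)} (he : IsNNEdge e)
    {c₁ c₂ : List (Sym2 (Vertex d))} (h₁ : IncChain U e c₁) (h₂ : IncChain U e c₂) :
    ∀ g ∈ e :: (c₁ ++ c₂), IsNNEdge g := by
  intro g hg
  rw [← List.cons_append, List.mem_append] at hg
  rcases hg with h | h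
  · exact h₁.isNN he g h
  · exact h₂.isNN he g (List.mem_cons_of_mem _ h)

theorem measure_surgery_le {d κ : ℕ} {P : Measure (Config d)} (hP : IsProductUniform P)
    {p : ℝ} {c₀ : ENNReal} (hc₀ : c₀ ≠ 0) (h1 : c₀ ≤ labelLaw (Set.Iic p))
    (h2 : c₀ ≤ labelLaw (Set.Ioi p)) {e : Sym2 (Vertex d)} (he : IsNNEdge e)
    (c₁ c₂ : List (Sym2 (Vertex d))) (D Q : Finset (Sym2 (Vertex d)))
    (hQ : Q ⊆ D) (hD : D ⊆ hull (e :: (c₁ ++ c₂))) (G : Set (Config d)) :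
    P {U | IncChain U e c₁ ∧ IncChain U e c₂ ∧
        resampled κ U p (verts (e :: (c₁ ++ c₂))) (hull (e :: (c₁ ++ c₂))) = D ∧
        ∀ V : Config d, (∀ g ∈ Q, V g ≤ p) → (∀ g ∈ D, g ∉ Q → p < V g) →
          (∀ g ∉ D, V g = U g) → V ∈ G} ≤
      (c₀⁻¹) ^ ((c₁.length + c₂.length + 1) * (nbrBound d * nbrBound d)) *
        (((max c₁.length c₂.length).factorial : ℕ) : ENNReal)⁻¹ * P G := by
  classical
  have := hP.1
  set F := {U | IncChain U e c₁ ∧ IncChain U e c₂ ∧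
        resampled κ U p (verts (e :: (c₁ ++ c₂))) (hull (e :: (c₁ ++ c₂))) = D ∧
        ∀ V : Config d, (∀ g ∈ Q, V g ≤ p) → (∀ g ∈ D, g ∉ Q → p < V g) →
          (∀ g ∉ D, V g = U g) → V ∈ G} with hF
  set k := (hull (e :: (c₁ ++ c₂))).card with hk
  have hkN : k ≤ (c₁.length + c₂.length + 1) * (nbrBound d * nbrBound d) := by
    have := card_hull_le (e :: (c₁ ++ c₂))
    simpa using this
  set I : Sym2 (Vertex d) → Set ℝ := fun g => if g ∈ Q then Set.Iic p else Set.Ioi p with hI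
  set R : Set (Config d) := {W | ∀ g ∈ hull (e :: (c₁ ++ c₂)), W g ∈ I g} with hR
  have hPR : c₀ ^ k ≤ P R := by
    rw [hR, hP.cyl _ _ fun g _ => by
      simp only [hI]; split_ifs
      · exact measurableSet_Iic
      · exact measurableSet_Ioi]
    rw [hk, ← Finset.prod_const]
    refine Finset.prod_le_prod' fun g _ => ?_
    simp only [hI]
    split_ifs <;> assumption
  obtain ⟨c, hc, hlen⟩ : ∃ c, (c = c₁ ∨ c = c₂) ∧ c.length = max c₁.length c₂.length := by
    rcases le_total c₁.length c₂.length with h | h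
    · exact ⟨c₂, Or.inr rfl, (max_eq_right h).symm⟩
    · exact ⟨c₁, Or.inl rfl, (max_eq_left h).symm⟩
  have hmul : P F * P R ≤ P G * P {U | c.IsChain (U · < U ·)} := by
    refine hP.mul_le_of_swap (D : Set _) fun X hX Y hY => ⟨?_, ?_⟩
    · refine hX.2.2.2 _ (fun g hg => ?_) (fun g hg hgQ => ?_) fun g hg => ?_
      · have := hY g (hD (hQ hg))
        simpa [swap, hQ hg, hI, hg] using this
      · have := hY g (hD hg)
        simpa [swap, hg, hI, hgQ] using this
      · simp [swap, hg]
    · have hcX : c.IsChain (X · < X ·) := by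
        rcases hc with rfl | rfl
        · exact hX.1.2
        · exact hX.2.1.2
      have hmap : c.map (swap (D : Set _) (X, Y)).2 = c.map X := by
        refine List.map_congr_left fun g hg => ?_
        have hgD : g ∈ (D : Set (Sym2 (Vertex d))) := by
          rw [← hX.2.2.1]
          refine mem_resampled_of_mem (isNN_append he hX.1 hX.2.1) ?_
          rcases hc with rfl | rfl <;> simp [hg]
        simp [swap, Finset.mem_coe.1 hgD]
      have := (List.isChain_map (R := (· < ·)) X).2 hcX
      rw [← hmap, List.isChain_map] at this
      exact this
  have hck : c₀ ^ k ≠ 0 := pow_ne_zero _ hc₀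
  have hc1 : c₀ ≤ 1 := h1.trans prob_le_one
  have hck' : c₀ ^ k ≠ ⊤ := (pow_le_one₀ zero_le hc1).trans_lt ENNReal.one_lt_top |>.ne
  have hfin : P F * c₀ ^ k ≤ P G * (((max c₁.length c₂.length).factorial : ℕ) : ENNReal)⁻¹ := by
    refine (mul_le_mul_right hPR _).trans (hmul.trans (mul_le_mul_right ?_ _))
    rw [← hlen]
    exact hP.isChain_le c
  calc P F = (c₀ ^ k)⁻¹ * (P F * c₀ ^ k) := by
        rw [mul_comm, mul_assoc, ENNReal.mul_inv_cancel hck hck', mul_one]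
    _ ≤ (c₀⁻¹) ^ k * (P G * (((max c₁.length c₂.length).factorial : ℕ) : ENNReal)⁻¹) := by
        rw [← ENNReal.inv_pow]
        gcongr
    _ ≤ (c₀⁻¹) ^ ((c₁.length + c₂.length + 1) * (nbrBound d * nbrBound d)) *
          (P G * (((max c₁.length c₂.length).factorial : ℕ) : ENNReal)⁻¹) := by
        gcongr
        exact ENNReal.one_le_inv.2 hc1
    _ = _ := by ring

theorem measure_surgeable_le {d κ : ℕ} {P : Measure (Config d)} (hP : IsProductUniform P)
    {p : ℝ} {c₀ : ENNReal} (hc₀ : c₀ ≠ 0) (h1 : c₀ ≤ labelLaw (Set.Iic p))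
    (h2 : c₀ ≤ labelLaw (Set.Ioi p)) {e : Sym2 (Vertex d)} (he : IsNNEdge e)
    (G : Sym2 (Vertex d) → Set (Config d)) :
    P {U | Surgeable κ p e G U} ≤
      ∑' m₁, ∑' m₂, weight d c₀ m₁ m₂ * ∑ f ∈ ball e (m₁ + m₂ + 2), P (G f) := by
  classical
  set K : List (Sym2 (Vertex d)) → List (Sym2 (Vertex d)) → Finset (Sym2 (Vertex d)) :=
    fun c₁ c₂ => hull (e :: (c₁ ++ c₂)) with hK
  set F : List (Sym2 (Vertex d)) → List (Sym2 (Vertex d)) → Finset (Sym2 (Vertex d)) →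
      Finset (Sym2 (Vertex d)) → Set (Config d) → Set (Config d) := fun c₁ c₂ D Q G =>
    {U | IncChain U e c₁ ∧ IncChain U e c₂ ∧
        resampled κ U p (verts (e :: (c₁ ++ c₂))) (hull (e :: (c₁ ++ c₂))) = D ∧
        ∀ V : Config d, (∀ g ∈ Q, V g ≤ p) → (∀ g ∈ D, g ∉ Q → p < V g) →
          (∀ g ∉ D, V g = U g) → V ∈ G} with hF
  have hsub : {U | Surgeable κ p e G U} ⊆ ⋃ m₁, ⋃ m₂, ⋃ f ∈ ball e (m₁ + m₂ + 2),
      ⋃ c₁ ∈ chains e m₁, ⋃ c₂ ∈ chains e m₂, ⋃ D ∈ (K c₁ c₂).powerset,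
        ⋃ Q ∈ D.powerset, F c₁ c₂ D Q (G f) := by
    rintro U ⟨c₁, c₂, hc₁, hc₂, Q, hQ, f, hf, hV⟩
    simp only [Set.mem_iUnion]
    have hfin : (resampled κ U p (verts (e :: (c₁ ++ c₂))) (hull (e :: (c₁ ++ c₂)))).Finite :=
      (Finset.finite_toSet _).subset fun g hg => hg.1
    refine ⟨c₁.length, c₂.length, f, hull_subset_ball he hc₁.1 hc₂.1 hf, c₁,
      (mem_chains _ _ _).2 ⟨rfl, hc₁.1⟩, c₂, (mem_chains _ _ _).2 ⟨rfl, hc₂.1⟩, hfin.toFinset,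
      ?_, Q, ?_, hc₁, hc₂, hfin.coe_toFinset.symm, fun V h1 h2 h3 => hV V h1 ?_ ?_⟩
    · rw [Finset.mem_powerset]
      intro g hg
      exact (hfin.mem_toFinset.1 hg).1
    · rw [Finset.mem_powerset]
      intro g hg
      exact hfin.mem_toFinset.2 (hQ hg)
    · exact fun g hg => h2 g (hfin.mem_toFinset.2 hg)
    · exact fun g hg => h3 g fun h => hg (hfin.mem_toFinset.1 h)
  refine (measure_mono hsub).trans ((measure_iUnion_le _).trans (ENNReal.tsum_le_tsum fun m₁ => ?_))
  refine (measure_iUnion_le _).trans (ENNReal.tsum_le_tsum fun m₂ => ?_)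
  refine (measure_biUnion_finset_le _ _).trans ?_
  rw [Finset.mul_sum]
  refine Finset.sum_le_sum fun f _ => ?_
  set N := (m₁ + m₂ + 1) * (nbrBound d * nbrBound d) with hN
  set b : ENNReal := c₀⁻¹ ^ N * (((max m₁ m₂).factorial : ℕ) : ENNReal)⁻¹ * P (G f) with hb
  have hDQ : ∀ c₁ ∈ chains e m₁, ∀ c₂ ∈ chains e m₂,
      P (⋃ D ∈ (K c₁ c₂).powerset, ⋃ Q ∈ D.powerset, F c₁ c₂ D Q (G f)) ≤ 4 ^ N * b := by
    intro c₁ hc₁ c₂ hc₂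
    have hl₁ := ((mem_chains _ _ _).1 hc₁).1
    have hl₂ := ((mem_chains _ _ _).1 hc₂).1
    have hKN : (K c₁ c₂).card ≤ N := by
      have := card_hull_le (e :: (c₁ ++ c₂))
      simpa [hN, hl₁, hl₂] using this
    have hpow : ∀ D ⊆ K c₁ c₂, (D.powerset.card : ENNReal) ≤ 2 ^ N := by
      intro D hD
      rw [Finset.card_powerset]
      push_cast
      exact pow_le_pow_right₀ (by norm_num) ((Finset.card_le_card hD).trans hKN)
    calc P (⋃ D ∈ (K c₁ c₂).powerset, ⋃ Q ∈ D.powerset, F c₁ c₂ D Q (G f))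
        ≤ ∑ D ∈ (K c₁ c₂).powerset, 2 ^ N * b := by
          refine (measure_biUnion_finset_le _ _).trans (Finset.sum_le_sum fun D hD => ?_)
          rw [Finset.mem_powerset] at hD
          refine (measure_biUnion_finset_le _ _).trans ?_
          refine (Finset.sum_le_card_nsmul _ _ b fun Q hQ => ?_).trans ?_
          · rw [Finset.mem_powerset] at hQ
            have := measure_surgery_le hP hc₀ h1 h2 he c₁ c₂ D Q hQ hD (G f) (κ := κ)
            rwa [hl₁, hl₂] at this
          · rw [nsmul_eq_mul]
            gcongr
            exact hpow D hD
      _ ≤ 2 ^ N * (2 ^ N * b) := by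
          rw [Finset.sum_const, nsmul_eq_mul]
          gcongr
          exact hpow _ subset_rfl
      _ = 4 ^ N * b := by
          rw [← mul_assoc, ← mul_pow]; norm_num
  calc P (⋃ c₁ ∈ chains e m₁, ⋃ c₂ ∈ chains e m₂, ⋃ D ∈ (K c₁ c₂).powerset,
        ⋃ Q ∈ D.powerset, F c₁ c₂ D Q (G f))
      ≤ ∑ c₁ ∈ chains e m₁, (nbrBound d ^ m₂ : ℕ) * (4 ^ N * b) := by
        refine (measure_biUnion_finset_le _ _).trans (Finset.sum_le_sum fun c₁ hc₁ => ?_)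
        refine (measure_biUnion_finset_le _ _).trans ?_
        refine (Finset.sum_le_card_nsmul _ _ (4 ^ N * b) fun c₂ hc₂ => hDQ c₁ hc₁ c₂ hc₂).trans ?_
        rw [nsmul_eq_mul]
        gcongr
        exact card_chains_le e m₂
    _ ≤ (nbrBound d ^ m₁ : ℕ) * ((nbrBound d ^ m₂ : ℕ) * (4 ^ N * b)) := by
        rw [Finset.sum_const, nsmul_eq_mul]
        gcongr
        exact card_chains_le e m₁
    _ = weight d c₀ m₁ m₂ * P (G f) := by
        rw [weight, hb, mul_pow]
        ring

/-- The total weight. -/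
noncomputable def totalWeight (d : ℕ) (c₀ : ENNReal) : ENNReal :=
  ∑' m₁, ∑' m₂, weight d c₀ m₁ m₂ * (nbrBound d ^ (m₁ + m₂ + 2) : ℕ)

theorem pow_mul_inv_factorial_le (a : ℝ) (ha : 1 ≤ a) (m₁ m₂ : ℕ) :
    a ^ (m₁ + m₂) * ((max m₁ m₂).factorial : ℝ)⁻¹ ≤
      Real.exp (4 * a ^ 2) * ((1 / 2) ^ m₁ * (1 / 2) ^ m₂) := by
  set m := max m₁ m₂ with hm
  have hle : m₁ + m₂ ≤ 2 * m := by
    have := le_max_left m₁ m₂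
    have := le_max_right m₁ m₂
    omega
  have h1 : (2 * a) ^ (m₁ + m₂) ≤ (4 * a ^ 2) ^ m := by
    calc (2 * a) ^ (m₁ + m₂) ≤ (2 * a) ^ (2 * m) := pow_le_pow_right₀ (by linarith) hle
      _ = (4 * a ^ 2) ^ m := by rw [pow_mul]; ring
  have h2 := Real.pow_div_factorial_le_exp (4 * a ^ 2) (by positivity) m
  have h3 : (2 * a) ^ (m₁ + m₂) * (m.factorial : ℝ)⁻¹ ≤ Real.exp (4 * a ^ 2) := by
    rw [← div_eq_mul_inv]
    refine le_trans ?_ h2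
    gcongr
  have h4 : a ^ (m₁ + m₂) = (2 * a) ^ (m₁ + m₂) * ((1 / 2) ^ m₁ * (1 / 2) ^ m₂) := by
    rw [← pow_add, ← mul_pow]
    congr 1
    ring
  rw [h4, mul_assoc, mul_comm ((1 / 2 : ℝ) ^ m₁ * (1 / 2) ^ m₂), ← mul_assoc]
  gcongr

theorem totalWeight_ne_top (d : ℕ) {c₀ : ENNReal} (hc₀ : c₀ ≠ 0) : totalWeight d c₀ ≠ ⊤ := by
  set B : ℝ := (nbrBound d : ℝ) with hB
  have hB1 : 1 ≤ B := by
    rw [hB]; exact_mod_cast (show 1 ≤ nbrBound d by unfold nbrBound; omega)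
  set M : ℕ := nbrBound d * nbrBound d with hM
  set q : ℝ := (max 1 (4 * c₀⁻¹)).toReal with hq
  have hqtop : max 1 (4 * c₀⁻¹) ≠ ⊤ := by
    refine (max_lt ENNReal.one_lt_top ?_).ne
    exact ENNReal.mul_lt_top (by norm_num) (ENNReal.inv_lt_top.2 (pos_iff_ne_zero.2 hc₀))
  have hq1 : 1 ≤ q := by
    have := ENNReal.toReal_mono hqtop (le_max_left 1 (4 * c₀⁻¹))
    simpa using this
  have hqE : ENNReal.ofReal q = max 1 (4 * c₀⁻¹) := ENNReal.ofReal_toReal hqtop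
  set a : ℝ := B ^ 2 * q ^ M with ha
  have ha1 : 1 ≤ a := one_le_mul_of_one_le_of_one_le (one_le_pow₀ hB1) (one_le_pow₀ hq1)
  set C : ℝ := B ^ 2 * q ^ M * Real.exp (4 * a ^ 2) with hC
  have hterm : ∀ m₁ m₂ : ℕ, weight d c₀ m₁ m₂ * (nbrBound d ^ (m₁ + m₂ + 2) : ℕ) ≤
      ENNReal.ofReal C * ((1 / 2) ^ m₁ * (1 / 2) ^ m₂) := by
    intro m₁ m₂
    have e1 : weight d c₀ m₁ m₂ * (nbrBound d ^ (m₁ + m₂ + 2) : ℕ) ≤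
        ENNReal.ofReal (B ^ m₁ * (B ^ m₂ * (q ^ ((m₁ + m₂ + 1) * M) *
          ((max m₁ m₂).factorial : ℝ)⁻¹)) * B ^ (m₁ + m₂ + 2)) := by
      have hBn : ∀ n : ℕ, ((nbrBound d ^ n : ℕ) : ENNReal) = ENNReal.ofReal (B ^ n) := by
        intro n
        rw [hB, ← Nat.cast_pow, ENNReal.ofReal_natCast]
      have hf : (((max m₁ m₂).factorial : ℕ) : ENNReal)⁻¹ =
          ENNReal.ofReal ((max m₁ m₂).factorial : ℝ)⁻¹ := by
        rw [ENNReal.ofReal_inv_of_pos (by positivity), ENNReal.ofReal_natCast]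
      rw [ENNReal.ofReal_mul (by positivity), ENNReal.ofReal_mul (by positivity),
        ENNReal.ofReal_mul (by positivity), ENNReal.ofReal_mul (by positivity), weight,
        hBn, hBn, hBn, hf, ENNReal.ofReal_pow (by positivity : 0 ≤ q), hqE]
      gcongr
      exact le_max_right _ _
    refine e1.trans ?_
    have e2 : (1 / 2 : ENNReal) = ENNReal.ofReal (1 / 2) := by
      rw [ENNReal.ofReal_div_of_pos (by norm_num)]; simp
    rw [e2, ← ENNReal.ofReal_pow (by norm_num), ← ENNReal.ofReal_pow (by norm_num),
      ← ENNReal.ofReal_mul (by positivity), ← ENNReal.ofReal_mul (by positivity)]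
    refine ENNReal.ofReal_le_ofReal ?_
    have e3 := pow_mul_inv_factorial_le a ha1 m₁ m₂
    calc B ^ m₁ * (B ^ m₂ * (q ^ ((m₁ + m₂ + 1) * M) * ((max m₁ m₂).factorial : ℝ)⁻¹)) *
          B ^ (m₁ + m₂ + 2)
        = B ^ 2 * q ^ M * (a ^ (m₁ + m₂) * ((max m₁ m₂).factorial : ℝ)⁻¹) := by
          rw [ha, mul_pow, ← pow_mul, ← pow_mul]
          ring
      _ ≤ B ^ 2 * q ^ M * (Real.exp (4 * a ^ 2) * ((1 / 2) ^ m₁ * (1 / 2) ^ m₂)) := by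
          gcongr
      _ = C * ((1 / 2) ^ m₁ * (1 / 2) ^ m₂) := by rw [hC]; ring
  have hgeo : ∑' m : ℕ, (1 / 2 : ENNReal) ^ m = 2 := by
    rw [ENNReal.tsum_geometric]; simp
  have hle : totalWeight d c₀ ≤ ENNReal.ofReal C * (2 * 2) := by
    calc totalWeight d c₀ ≤ ∑' m₁ : ℕ, ∑' m₂ : ℕ,
          ENNReal.ofReal C * ((1 / 2) ^ m₁ * (1 / 2) ^ m₂) :=
          ENNReal.tsum_le_tsum fun m₁ => ENNReal.tsum_le_tsum fun m₂ => hterm m₁ m₂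
      _ = ENNReal.ofReal C * (2 * 2) := by
          simp_rw [ENNReal.tsum_mul_left, hgeo, ENNReal.tsum_mul_right, hgeo]
  exact (hle.trans_lt (ENNReal.mul_lt_top ENNReal.ofReal_lt_top (by norm_num))).ne

/-! ### Translation invariance -/

/-- Translation of edges. -/
def shift {d : ℕ} (z : Vertex d) : Equiv.Perm (Sym2 (Vertex d)) where
  toFun := Sym2.map (· + z)
  invFun := Sym2.map (· - z)
  left_inv e := by
    induction e with
    | _ x y => simp
  right_inv e := by
    induction e with
    | _ x y => simp

@[simp] theorem shift_mk {d : ℕ} (z x y : Vertex d) : shift z s(x, y) = s(x + z, y + z) := rfl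

theorem mem_shift {d : ℕ} (z v : Vertex d) (e : Sym2 (Vertex d)) :
    v + z ∈ shift z e ↔ v ∈ e := by
  induction e with
  | _ x y => simp

theorem isNNEdge_shift {d : ℕ} (z : Vertex d) (e : Sym2 (Vertex d)) :
    IsNNEdge (shift z e) ↔ IsNNEdge e := by
  induction e with
  | _ x y => simp [isNNEdge_mk, adj]

theorem lowerDegree_shift {d : ℕ} (z : Vertex d) (U : Config d) (σ : Sym2 (Vertex d) → Prop)
    (e : Sym2 (Vertex d)) (v : Vertex d) :
    lowerDegree (U ∘ shift z) (fun f => σ (shift z f)) e v =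
      lowerDegree U σ (shift z e) (v + z) := by
  classical
  unfold lowerDegree
  refine Finset.card_bij (fun f _ => shift z f) ?_ ?_ ?_
  · intro f hf
    simp only [Finset.mem_filter, mem_edgesAt, isNNEdge_shift, mem_shift, Function.comp,
      (shift z).injective.ne_iff] at hf ⊢
    exact hf
  · exact fun f _ g _ h => (shift z).injective h
  · intro f hf
    obtain ⟨g, rfl⟩ := (shift z).surjective f
    refine ⟨g, ?_, rfl⟩
    simp only [Finset.mem_filter, mem_edgesAt, isNNEdge_shift, mem_shift, Function.comp,
      (shift z).injective.ne_iff] at hf ⊢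
    exact hf

theorem openStep_shift {d κ : ℕ} (z : Vertex d) (U : Config d) (m : ℕ) (e : Sym2 (Vertex d)) :
    openStep κ (U ∘ shift z) m e ↔ openStep κ U m (shift z e) := by
  induction m generalizing e with
  | zero => exact Iff.rfl
  | succ m ih =>
    have h : openStep κ (U ∘ shift z) m = fun f => openStep κ U m (shift z f) :=
      funext fun f => propext (ih f)
    simp only [openStep, h, lowerDegree_shift]
    constructor
    · intro H v hv
      have := H (v - z) ((mem_shift z _ e).1 (by simpa using hv))
      simpa using this
    · exact fun H v hv => H _ ((mem_shift z v e).2 hv)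

theorem mem_openSet_shift {d κ : ℕ} (z : Vertex d) (U : Config d) (p : ℝ)
    (e : Sym2 (Vertex d)) :
    e ∈ openSet κ (U ∘ shift z) p ↔ shift z e ∈ openSet κ U p := by
  simp only [openSet, Set.mem_ofPred_eq, Opens, openStep_shift, isNNEdge_shift,
    Function.comp]

theorem reachable_shift {d κ : ℕ} (z : Vertex d) (U : Config d) (p : ℝ) {a b : Vertex d}
    (h : (openGraph κ U p).Reachable (a + z) (b + z)) :
    (openGraph κ (U ∘ shift z) p).Reachable a b := by
  let φ : openGraph κ U p →g openGraph κ (U ∘ shift z) p :=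
    { toFun := fun x => x - z
      map_rel' := by
        intro x y hxy
        rw [openGraph_adj] at hxy ⊢
        rw [mem_openSet_shift]
        simpa using hxy }
  have := h.map φ
  simpa [φ] using this

theorem abs_norm1_sub_le {d : ℕ} (x y : Vertex d) : |norm1 x - norm1 y| ≤ norm1 (x - y) := by
  unfold norm1
  rw [← Finset.sum_sub_distrib]
  refine (Finset.abs_sum_le_sum_abs _ _).trans (Finset.sum_le_sum fun i _ => ?_)
  exact abs_abs_sub_abs_le_abs_sub _ _

theorem norm1_zero {d : ℕ} : norm1 (0 : Vertex d) = 0 := by simp [norm1]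

theorem norm1_nonneg {d : ℕ} (x : Vertex d) : 0 ≤ norm1 x :=
  Finset.sum_nonneg fun _ _ => abs_nonneg _

theorem norm1_le_of_adj {d : ℕ} {x y : Vertex d} (h : adj x y) : norm1 y ≤ norm1 x + 1 := by
  have := abs_norm1_sub_le y x
  have h2 : norm1 (y - x) = 1 := by
    have := (adj_comm _ _).1 h
    simpa [norm1, adj] using this
  rw [h2] at this
  linarith [(abs_le.1 this).2]

theorem arm_of_reachable {d n : ℕ} {S : Set (Sym2 (Vertex d))} (hS : ∀ e ∈ S, IsNNEdge e)
    {b : Vertex d} (hb : (n : ℤ) ≤ norm1 b)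
    (h : (SimpleGraph.fromEdgeSet S).Reachable 0 b) : Arm n S := by
  rcases Nat.eq_zero_or_pos n with rfl | hn
  · exact ⟨0, by simp [norm1], SimpleGraph.Reachable.refl _⟩
  obtain ⟨x, y, hxy, hx, hy⟩ := exists_boundary_of_reachable h
    {v | (SimpleGraph.fromEdgeSet S).Reachable 0 v → norm1 v < n}
    (by simp [norm1_zero, hn]) (by simpa [h] using hb)
  simp only [Set.mem_ofPred_eq, not_forall, not_lt] at hx hy
  obtain ⟨hy1, hy2⟩ := hy
  have := hx (hy1.trans hxy.symm.reachable)
  have h3 := norm1_le_of_adj ((isNNEdge_mk _ _).1 (hS _ ((SimpleGraph.fromEdgeSet_adj _).1 hxy).1))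
  exact ⟨y, by omega, hy1⟩

theorem openSet_isNN {d κ : ℕ} {U : Config d} {p : ℝ} : ∀ e ∈ openSet κ U p, IsNNEdge e :=
  fun _ he => he.1

theorem Arm.anti {d m n : ℕ} (hmn : m ≤ n) {S : Set (Sym2 (Vertex d))}
    (hS : ∀ e ∈ S, IsNNEdge e) (h : Arm n S) : Arm m S := by
  obtain ⟨b, hb, hr⟩ := h
  exact arm_of_reachable hS (by rw [hb]; exact_mod_cast hmn) hr

/-- The event that `x` is joined to the sphere of radius `k` by `p`-open edges. -/
def toSphere {d : ℕ} (κ k : ℕ) (p : ℝ) (x : Vertex d) : Set (Config d) :=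
  {U | ∃ s, norm1 s = k ∧ (openGraph κ U p).Reachable x s}

theorem measure_toSphere_le {d κ : ℕ} {P : Measure (Config d)} (hP : IsProductUniform P)
    (p : ℝ) (x : Vertex d) (k : ℕ) :
    P (toSphere κ k p x) ≤ P (armEvent κ (|norm1 x - k|).toNat p) := by
  rw [← (hP.comp_perm (shift x)).measure_preimage
    (measurableSet_armEvent (κ := κ) p).nullMeasurableSet]
  refine measure_mono ?_
  rintro U ⟨s, hs, hr⟩
  refine arm_of_reachable openSet_isNN (b := s - x) ?_ ?_
  · rw [Int.toNat_of_nonneg (abs_nonneg _), abs_sub_comm, ← hs]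
    exact abs_norm1_sub_le s x
  · exact reachable_shift x U p (by simpa using hr)

/-! ### Two applications of the local modification -/

theorem admissible_subset_resampled {d κ : ℕ} {U : Config d} {p : ℝ}
    {l : List (Sym2 (Vertex d))} (hl : ∀ g ∈ l, IsNNEdge g) {Q : Set (Sym2 (Vertex d))}
    (hQ : Admissible κ U p (verts l) Q) : Q ⊆ resampled κ U p (verts l) (hull l) :=
  fun e he => ⟨hull_of_touches hl (hQ.touches e he) (AdjE.refl (hQ.isNN e he)),
    fun h => h.2 (hQ.touches e he)⟩

theorem finite_resampled {d κ : ℕ} {U : Config d} {p : ℝ} {S : Set (Vertex d)}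
    (K : Finset (Sym2 (Vertex d))) : (resampled κ U p S K).Finite :=
  K.finite_toSet.subset fun _ he => he.1

theorem Good.openSet_surgery {d κ : ℕ} {U V : Config d} (hU : Good U) {p : ℝ}
    {l : List (Sym2 (Vertex d))} (hl : ∀ g ∈ l, IsNNEdge g) {Q : Set (Sym2 (Vertex d))}
    (hQ : Admissible κ U p (verts l) Q) (hVQ : ∀ e ∈ Q, V e ≤ p)
    (hVD : ∀ e ∈ resampled κ U p (verts l) (hull l), e ∉ Q → p < V e)
    (hVU : ∀ e ∉ resampled κ U p (verts l) (hull l), V e = U e) :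
    openSet κ V p = {e | e ∈ openSet κ U p ∧ ¬ Touches (verts l) e} ∪ Q := by
  ext e
  exact mem_openSet_surgery hU.wf
    (wellFounded_below_of_finite hU.wf (finite_resampled (hull l)) fun e _ he => hVU e he)
    hU.distinct (fun e f he hef => hull_of_touches hl he hef) hQ hVQ hVD hVU e

theorem surgeable_connect {d κ : ℕ} (hκ : 2 ≤ κ) {U : Config d} (hU : Good U) {p : ℝ}
    {e : Sym2 (Vertex d)} (he : IsNNEdge e) {c : List (Sym2 (Vertex d))} (hc : IncChain U e c)
    {x y : Vertex d} (hx : x ∈ e) (hy : y ∈ verts (e :: c)) {k : ℕ}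
    (h : U ∈ toSphere κ k p y) : Surgeable κ p e (fun _ => toSphere κ k p x) U := by
  obtain ⟨s, hs, hr⟩ := h
  have hc₂ : IncChain U e [] := ⟨List.isChain_singleton _, List.isChain_nil⟩
  obtain ⟨Q, hQ, hQr⟩ := exists_admissible hκ he hc hc₂ (p := p) (x := x) (y := y) (a := x) (b := s)
    ⟨e, by simp, hx⟩ (by simpa using hy) (SimpleGraph.Reachable.refl _) hr.symm
  have hl := isNN_append he hc hc₂
  refine ⟨c, [], hc, hc₂, Q, admissible_subset_resampled hl hQ, e,
    (mem_resampled_of_mem (κ := κ) (U := U) (p := p) hl (by simp)).1, fun V h1 h2 h3 => ?_⟩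
  refine ⟨s, hs, ?_⟩
  rw [openGraph, hU.openSet_surgery hl hQ h1 h2 h3]
  exact hQr _ (fun f h1 h2 => Or.inl ⟨h1, h2⟩) fun f hf => Or.inr hf

/-- Opening `f` creates an arm. -/
def pivotal {d : ℕ} (κ n : ℕ) (p : ℝ) (f : Sym2 (Vertex d)) : Set (Config d) :=
  {V | ¬ Arm n (openSet κ (Function.update V f 2) p) ∧
    Arm n (openSet κ (Function.update V f p) p)}

/-- There is no arm but some value of the label of `e` creates one. -/
def labelPivotal {d : ℕ} (κ n : ℕ) (p : ℝ) (e : Sym2 (Vertex d)) : Set (Config d) :=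
  {U | U ∉ armEvent κ n p ∧ ∃ t, Function.update U e t ∈ armEvent κ n p}

theorem exists_critical {α : Type*} [DecidableEq α] (A : Finset α → Prop) (h0 : ¬ A ∅)
    (Q : Finset α) (hQ : A Q) : ∃ Q' ⊆ Q, ∃ f ∈ Q, f ∉ Q' ∧ ¬ A Q' ∧ A (insert f Q') := by
  induction Q using Finset.induction_on with
  | empty => exact absurd hQ h0
  | insert f Q hf ih =>
    by_cases h : A Q
    · obtain ⟨Q', h1, g, h2, h3⟩ := ih h
      exact ⟨Q', h1.trans (Finset.subset_insert _ _), g, Finset.mem_insert_of_mem h2, h3⟩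
    · exact ⟨Q, Finset.subset_insert _ _, f, Finset.mem_insert_self _ _, hf, h, hQ⟩

theorem exists_discrepancy {d κ : ℕ} {U V : Config d} {p : ℝ} (hU : WellFounded (Below U))
    (hV : WellFounded (Below V)) {e : Sym2 (Vertex d)} (hUV : ∀ g, g ≠ e → V g = U g)
    {a b : Vertex d} (hab : (openGraph κ V p).Reachable a b)
    (hab' : ¬ (openGraph κ U p).Reachable a b) :
    IsNNEdge e ∧ ∃ c x, IncChain U e c ∧ x ∈ verts (e :: c) ∧ (openGraph κ U p).Reachable a x := by
  obtain ⟨x, y, hxy, hx, hy⟩ := exists_boundary_of_reachable hab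
    {v | (openGraph κ U p).Reachable a v} (SimpleGraph.Reachable.refl _) hab'
  rw [openGraph_adj] at hxy
  have hnot : s(x, y) ∉ openSet κ U p := fun h => hy (hx.trans (openGraph_adj.2 h).reachable)
  obtain ⟨c, hc, hm⟩ := exists_incChain_of_mem_openSet hU hV hUV hxy hnot
  exact ⟨hc.isNN_head hm hxy.1, c, x, hc, ⟨_, hm, by simp⟩, hx⟩

theorem surgeable_pivotal {d κ n : ℕ} (hκ : 2 ≤ κ) {U : Config d} (hU : Good U) {p : ℝ}
    (hp : p < 2) {e : Sym2 (Vertex d)} (h : U ∈ labelPivotal κ n p e) :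
    IsNNEdge e ∧ Surgeable κ p e (pivotal κ n p) U := by
  classical
  obtain ⟨hU0, t, b, hb, hr⟩ := h
  have hV := wellFounded_below_update hU.wf e t
  have hUV : ∀ g, g ≠ e → Function.update U e t g = U g := fun g hg => Function.update_of_ne hg _ _
  have hn : ¬ (openGraph κ U p).Reachable 0 b := fun h => hU0 ⟨b, hb, h⟩
  obtain ⟨he, c₁, x, hc₁, hx, hax⟩ := exists_discrepancy hU.wf hV hUV hr hn
  obtain ⟨-, c₂, y, hc₂, hy, hby⟩ := exists_discrepancy hU.wf hV hUV hr.symm fun h => hn h.symm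
  refine ⟨he, ?_⟩
  set l := e :: (c₁ ++ c₂) with hldef
  have hl : ∀ g ∈ l, IsNNEdge g := isNN_append he hc₁ hc₂
  have hx' : x ∈ verts l := by
    obtain ⟨g, hg, hxg⟩ := hx
    refine ⟨g, ?_, hxg⟩
    rcases List.mem_cons.1 hg with h | h <;> simp [hldef, h]
  have hy' : y ∈ verts l := by
    obtain ⟨g, hg, hxg⟩ := hy
    refine ⟨g, ?_, hxg⟩
    rcases List.mem_cons.1 hg with h | h <;> simp [hldef, h]
  obtain ⟨Q, hQ, hQr⟩ := exists_admissible hκ he hc₁ hc₂ hx' hy' hax hby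
  set N : Set (Sym2 (Vertex d)) := {f | f ∈ openSet κ U p ∧ ¬ Touches (verts l) f} with hN
  have hA0 : ¬ Arm n (N ∪ ((∅ : Finset (Sym2 (Vertex d))) : Set _)) := by
    intro h
    refine hU0 (h.mono ?_)
    simp only [Finset.coe_empty, Set.union_empty]
    exact fun f hf => hf.1
  have hAQ : Arm n (N ∪ (Q : Set _)) :=
    ⟨b, hb, hQr _ (fun f h1 h2 => Or.inl ⟨h1, h2⟩) fun f hf => Or.inr hf⟩
  obtain ⟨Q', hQ', f, hfQ, hfQ', h1, h2⟩ := exists_critical (fun Q => Arm n (N ∪ (Q : Set _))) hA0 Q hAQ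
  have hres := admissible_subset_resampled hl hQ
  have hfr : f ∈ resampled κ U p (verts l) (hull l) := hres hfQ
  refine ⟨c₁, c₂, hc₁, hc₂, Q', fun g hg => hres (hQ' hg), f, hfr.1, fun V v1 v2 v3 => ⟨?_, ?_⟩⟩
  · rw [hU.openSet_surgery hl (Q := Q') (hQ.mono hQ')]
    · exact h1
    · intro g hg
      rw [Function.update_of_ne (by rintro rfl; exact hfQ' hg)]
      exact v1 g hg
    · intro g hg hgQ
      by_cases hgf : g = f
      · subst hgf; simpa using hp
      · rw [Function.update_of_ne hgf]; exact v2 g hg hgQ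
    · intro g hg
      rw [Function.update_of_ne (by rintro rfl; exact hg hfr)]
      exact v3 g hg
  · rw [hU.openSet_surgery hl (Q := (insert f Q' : Finset _))
      (hQ.mono (Finset.coe_subset.2 (Finset.insert_subset hfQ hQ')))]
    · exact h2
    · intro g hg
      by_cases hgf : g = f
      · subst hgf; simp
      · rw [Function.update_of_ne hgf]
        exact v1 g ((Finset.mem_insert.1 hg).resolve_left hgf)
    · intro g hg hgQ
      rw [Finset.mem_coe, Finset.mem_insert, not_or] at hgQ
      rw [Function.update_of_ne hgQ.1]
      exact v2 g hg hgQ.2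
    · intro g hg
      rw [Function.update_of_ne (by rintro rfl; exact hg hfr)]
      exact v3 g hg

theorem tsum_measure_labelPivotal_le {d κ n : ℕ} (hκ : 2 ≤ κ) {P : Measure (Config d)}
    (hP : IsProductUniform P) {p : ℝ} (hp : p < 2) {c₀ : ENNReal} (hc₀ : c₀ ≠ 0)
    (h1 : c₀ ≤ labelLaw (Set.Iic p)) (h2 : c₀ ≤ labelLaw (Set.Ioi p)) :
    ∑' e, P (labelPivotal κ n p e) ≤ totalWeight d c₀ * ∑' f, P (pivotal κ n p f) := by
  have hle : ∀ e, P (labelPivotal κ n p e) ≤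
      ∑' m₁, ∑' m₂, weight d c₀ m₁ m₂ * ∑ f ∈ ball e (m₁ + m₂ + 2), P (pivotal κ n p f) := by
    intro e
    by_cases he : IsNNEdge e
    · refine le_trans (measure_mono_ae ?_) (measure_surgeable_le (κ := κ) hP hc₀ h1 h2 he _)
      filter_upwards [hP.ae_good] with U hU hUe
      exact (surgeable_pivotal hκ hU hp hUe).2
    · refine (measure_mono_ae (t := ∅) ?_).trans (by simp)
      filter_upwards [hP.ae_good] with U hU hUe
      exact he (surgeable_pivotal hκ hU hp hUe).1
  refine (ENNReal.tsum_le_tsum hle).trans ?_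
  rw [ENNReal.tsum_comm, totalWeight, ← ENNReal.tsum_mul_right]
  refine ENNReal.tsum_le_tsum fun m₁ => ?_
  rw [ENNReal.tsum_comm, ← ENNReal.tsum_mul_right]
  refine ENNReal.tsum_le_tsum fun m₂ => ?_
  rw [ENNReal.tsum_mul_left, mul_assoc]
  gcongr
  exact tsum_sum_ball_le _ _

theorem measure_surgeable_const_le {d κ : ℕ} {P : Measure (Config d)} (hP : IsProductUniform P)
    {p : ℝ} {c₀ : ENNReal} (hc₀ : c₀ ≠ 0) (h1 : c₀ ≤ labelLaw (Set.Iic p))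
    (h2 : c₀ ≤ labelLaw (Set.Ioi p)) {e : Sym2 (Vertex d)} (he : IsNNEdge e)
    (G : Set (Config d)) :
    P {U | Surgeable κ p e (fun _ => G) U} ≤ totalWeight d c₀ * P G := by
  refine (measure_surgeable_le hP hc₀ h1 h2 he _).trans ?_
  rw [totalWeight, ← ENNReal.tsum_mul_right]
  refine ENNReal.tsum_le_tsum fun m₁ => ?_
  rw [← ENNReal.tsum_mul_right]
  refine ENNReal.tsum_le_tsum fun m₂ => ?_
  rw [Finset.sum_const, nsmul_eq_mul, ← mul_assoc]
  gcongr
  exact card_ball_le _ _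

/-! ### Explorations -/

open Classical in
/-- The labels of the edges in `A`, the other labels being replaced by `2`. -/
noncomputable def mask {d : ℕ} (A : Finset (Sym2 (Vertex d))) (X : Config d) : Config d :=
  fun e => if e ∈ A then X e else 2

theorem mask_of_mem {d : ℕ} {A : Finset (Sym2 (Vertex d))} {X : Config d} {e : Sym2 (Vertex d)}
    (he : e ∈ A) : mask A X e = X e := if_pos he

theorem mask_congr {d : ℕ} {A : Finset (Sym2 (Vertex d))} {X Y : Config d}
    (h : ∀ e ∈ A, Y e = X e) : mask A Y = mask A X := by
  funext e
  unfold mask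
  split_ifs with he
  · exact h e he
  · rfl

theorem measurable_mask {d : ℕ} (A : Finset (Sym2 (Vertex d))) : Measurable (mask A) := by
  refine measurable_pi_lambda _ fun e => ?_
  unfold mask
  split_ifs
  · exact measurable_pi_apply e
  · exact measurable_const

open Classical in
/-- The edges revealed after `t` steps: at step `s` the edge `ex s` is revealed if the rule `Φ`
allows it in view of the labels revealed so far. -/
noncomputable def explore {d : ℕ} (ex : ℕ → Sym2 (Vertex d))
    (Φ : Finset (Sym2 (Vertex d)) → Config d → Set (Sym2 (Vertex d))) :
    ℕ → Config d → Finset (Sym2 (Vertex d))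
  | 0, _ => ∅
  | t + 1, X => if ex t ∈ Φ (explore ex Φ t X) (mask (explore ex Φ t X) X) then
      insert (ex t) (explore ex Φ t X) else explore ex Φ t X

section
variable {d : ℕ} {ex : ℕ → Sym2 (Vertex d)}
  {Φ : Finset (Sym2 (Vertex d)) → Config d → Set (Sym2 (Vertex d))}

theorem explore_subset_succ (t : ℕ) (X : Config d) :
    explore ex Φ t X ⊆ explore ex Φ (t + 1) X := by
  classical
  rw [explore]
  split_ifs
  · exact Finset.subset_insert _ _
  · exact subset_rfl

theorem explore_mono (X : Config d) : Monotone fun t => explore ex Φ t X :=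
  monotone_nat_of_le_succ fun t => explore_subset_succ t X

theorem explore_congr {t : ℕ} {X Y : Config d} (h : ∀ e ∈ explore ex Φ t X, Y e = X e) :
    explore ex Φ t Y = explore ex Φ t X := by
  induction t with
  | zero => rfl
  | succ t ih =>
    have h' : ∀ e ∈ explore ex Φ t X, Y e = X e := fun e he => h e (explore_subset_succ t X he)
    rw [explore, explore, ih h', mask_congr h']

theorem measurableSet_explore_eq (hΦ : ∀ A e, MeasurableSet {X | e ∈ Φ A X}) (t : ℕ)
    (S : Finset (Sym2 (Vertex d))) : MeasurableSet {X | explore ex Φ t X = S} := by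
  classical
  induction t generalizing S with
  | zero => exact MeasurableSet.const (∅ = S)
  | succ t ih =>
    have : {X | explore ex Φ (t + 1) X = S} = ⋃ S', {X | explore ex Φ t X = S'} ∩
        (({X | ex t ∈ Φ S' (mask S' X)} ∩ {_X | insert (ex t) S' = S}) ∪
          ({X | ex t ∈ Φ S' (mask S' X)}ᶜ ∩ {_X | S' = S})) := by
      ext X
      simp only [Set.mem_ofPred_eq, Set.mem_iUnion, Set.mem_inter_iff, Set.mem_union,
        Set.mem_compl_iff, exists_eq_left', explore]
      split_ifs with h <;> simp [h]
    rw [this]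
    have hm : ∀ S', MeasurableSet {X | ex t ∈ Φ S' (mask S' X)} :=
      fun S' => measurable_mask S' (hΦ S' (ex t))
    exact MeasurableSet.iUnion fun S' => (ih S').inter
      (((hm S').inter (MeasurableSet.const _)).union ((hm S').compl.inter (MeasurableSet.const _)))

theorem swap_fst_of_mem {D : Set (Sym2 (Vertex d))} {Z : Config d × Config d}
    {e : Sym2 (Vertex d)} (he : e ∈ D) : (swap D Z).1 e = Z.2 e := by
  classical
  simp [swap, he]

theorem swap_fst_of_notMem {D : Set (Sym2 (Vertex d))} {Z : Config d × Config d}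
    {e : Sym2 (Vertex d)} (he : e ∉ D) : (swap D Z).1 e = Z.1 e := by
  classical
  simp [swap, he]

theorem swap_snd_of_mem {D : Set (Sym2 (Vertex d))} {Z : Config d × Config d}
    {e : Sym2 (Vertex d)} (he : e ∈ D) : (swap D Z).2 e = Z.1 e := by
  classical
  simp [swap, he]

theorem swap_insert {A : Finset (Sym2 (Vertex d))} [DecidableEq (Sym2 (Vertex d))]
    (Z : Config d × Config d) {e : Sym2 (Vertex d)} (he : e ∉ A) :
    Function.update (swap (insert e A : Finset _) Z).1 e (Z.1 e) = (swap A Z).1 := by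
  funext f
  by_cases hf : f = e
  · subst hf
    rw [Function.update_self, swap_fst_of_notMem (by simpa using he)]
  · rw [Function.update_of_ne hf]
    by_cases hfA : f ∈ A
    · rw [swap_fst_of_mem (by simp [hfA]), swap_fst_of_mem (by simpa using hfA)]
    · rw [swap_fst_of_notMem (by simp [hfA, hf]), swap_fst_of_notMem (by simpa using hfA)]

/-- The event that the `s`-th step reveals a new edge. -/
def reveals (ex : ℕ → Sym2 (Vertex d))
    (Φ : Finset (Sym2 (Vertex d)) → Config d → Set (Sym2 (Vertex d))) (s : ℕ) :
    Set (Config d) :=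
  {X | ex s ∉ explore ex Φ s X ∧ ex s ∈ Φ (explore ex Φ s X) (mask (explore ex Φ s X) X)}

/-- The event that there is a label of `e` which leads to `B`, without being in `B`. -/
def switches (B : Set (Config d)) (e : Sym2 (Vertex d)) : Set (Config d) :=
  {U | U ∉ B ∧ ∃ t, Function.update U e t ∈ B}

theorem measurableSet_step (hΦ : ∀ A e, MeasurableSet {X | e ∈ Φ A X}) (s : ℕ)
    (S : Finset (Sym2 (Vertex d))) :
    MeasurableSet {X | explore ex Φ s X = S ∧ ex s ∉ S ∧ ex s ∈ Φ S (mask S X)} :=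
  (measurableSet_explore_eq hΦ s S).inter
    ((MeasurableSet.const _).inter (measurable_mask S (hΦ S (ex s))))

theorem measurableSet_reveals (hΦ : ∀ A e, MeasurableSet {X | e ∈ Φ A X}) (s : ℕ) :
    MeasurableSet (reveals ex Φ s) := by
  have : reveals ex Φ s = ⋃ S, {X | explore ex Φ s X = S ∧ ex s ∉ S ∧ ex s ∈ Φ S (mask S X)} := by
    ext X
    simp [reveals]
  rw [this]
  exact MeasurableSet.iUnion fun S => measurableSet_step hΦ s S

theorem measure_prod_step_le {P : Measure (Config d)} (hP : IsProductUniform P)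
    (hΦ : ∀ A e, MeasurableSet {X | e ∈ Φ A X}) (B : Set (Config d)) (s : ℕ) :
    P.prod P (⋃ S, {Z : Config d × Config d | explore ex Φ s Z.1 = S ∧ ex s ∉ S ∧
        ex s ∈ Φ S (mask S Z.1) ∧ (swap (insert (ex s) (S : Set _)) Z).1 ∈ switches B (ex s)}) ≤
      P (reveals ex Φ s) * P (switches B (ex s)) := by
  have := hP.1
  set F : Finset (Sym2 (Vertex d)) → Set (Config d) := fun S =>
    {X | explore ex Φ s X = S ∧ ex s ∉ S ∧ ex s ∈ Φ S (mask S X)} with hF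
  calc _ ≤ ∑' S, P (switches B (ex s)) * P (F S) := by
        refine (measure_iUnion_le _).trans (ENNReal.tsum_le_tsum fun S => ?_)
        rw [← Measure.prod_prod]
        refine (measure_mono ?_).trans_eq (hP.prod_preimage_swap (insert (ex s) (S : Set _)) _)
        rintro Z ⟨h1, h2, h3, h4⟩
        refine ⟨h4, ?_⟩
        have hagree : ∀ e ∈ S, (swap (insert (ex s) (S : Set _)) Z).2 e = Z.1 e :=
          fun e he => swap_snd_of_mem (Set.mem_insert_of_mem _ he)
        refine ⟨?_, h2, ?_⟩
        · rw [explore_congr fun e he => hagree e (by rwa [h1] at he), h1]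
        · rwa [mask_congr hagree]
    _ = P (switches B (ex s)) * P (⋃ S, F S) := by
        rw [ENNReal.tsum_mul_left, measure_iUnion]
        · intro S T hST
          exact Set.disjoint_left.2 fun X h1 h2 => hST (h1.1.symm.trans h2.1)
        · exact fun S => measurableSet_step hΦ s S
    _ ≤ _ := by
        rw [mul_comm]
        gcongr
        exact Set.iUnion_subset fun S X hX => by
          obtain ⟨rfl, h2, h3⟩ := hX
          exact ⟨h2, h3⟩

theorem tsum_reveals_le {P : Measure (Config d)}
    (hΦ : ∀ A e, MeasurableSet {X | e ∈ Φ A X}) (e : Sym2 (Vertex d)) :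
    ∑' s, P {X | ex s = e ∧ X ∈ reveals ex Φ s} ≤ P {X | ∃ t, e ∈ explore ex Φ t X} := by
  classical
  rw [← measure_iUnion]
  · refine measure_mono (Set.iUnion_subset fun s X hX => ⟨s + 1, ?_⟩)
    obtain ⟨rfl, -, h⟩ := hX
    simp [explore, h]
  · have key : ∀ s t, s < t → ∀ X, ex s = e ∧ X ∈ reveals ex Φ s →
        ¬ (ex t = e ∧ X ∈ reveals ex Φ t) := by
      rintro s t hst X ⟨rfl, -, h⟩ ⟨h1, h2, -⟩
      refine h2 (explore_mono X (Nat.succ_le_of_lt hst) ?_)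
      simp [explore, h, h1]
    intro s t hst
    refine Set.disjoint_left.2 fun X h1 h2 => ?_
    rcases lt_or_gt_of_ne hst with h | h
    · exact key s t h X h1 h2
    · exact key t s h X h2 h1
  · exact fun s => (MeasurableSet.const _).inter (measurableSet_reveals hΦ s)

/-- The **OSSS inequality** for the exploration `explore ex Φ`. -/
theorem explore_inequality {P : Measure (Config d)} (hP : IsProductUniform P)
    (hΦ : ∀ A e, MeasurableSet {X | e ∈ Φ A X}) {B : Set (Config d)} (hB : MeasurableSet B)
    {C : Finset (Sym2 (Vertex d)) → Config d → Prop} (hC : ∀ A, MeasurableSet {X | C A X})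
    (t : ℕ) (hCB : ∀ᵐ X ∂P, C (explore ex Φ t X) (mask (explore ex Φ t X) X) → X ∈ B)
    {R : Sym2 (Vertex d) → ENNReal} (hR : ∀ e, P {X | ∃ t, e ∈ explore ex Φ t X} ≤ R e) :
    P {X | C (explore ex Φ t X) (mask (explore ex Φ t X) X)} * P Bᶜ ≤
      ∑' e, R e * P (switches B e) := by
  classical
  have := hP.1
  set E : Finset (Sym2 (Vertex d)) → Set (Config d) := fun S =>
    {X | explore ex Φ t X = S ∧ C S (mask S X)} with hE
  have hEm : ∀ S, MeasurableSet (E S) := fun S =>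
    (measurableSet_explore_eq hΦ t S).inter (measurable_mask S (hC S))
  set G : Finset (Sym2 (Vertex d)) → Set (Config d × Config d) := fun S =>
    {Z | (swap (S : Set _) Z).1 ∈ Bᶜ ∧ Z.1 ∈ E S} with hG
  have hGm : ∀ S, MeasurableSet (G S) := fun S =>
    ((measurable_fst.comp (measurable_swap _)) hB.compl).inter (measurable_fst (hEm S))
  set N : ℕ → Set (Config d × Config d) := fun s =>
    ⋃ S : Finset (Sym2 (Vertex d)), {Z | explore ex Φ s Z.1 = S ∧ ex s ∉ S ∧
      ex s ∈ Φ S (mask S Z.1) ∧ (swap (insert (ex s) (S : Set _)) Z).1 ∈ switches B (ex s)} with hN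
  have hlow : P {X | C (explore ex Φ t X) (mask (explore ex Φ t X) X)} * P Bᶜ ≤
      P.prod P (⋃ S, G S) := by
    calc _ ≤ (∑' S, P (E S)) * P Bᶜ := by
          gcongr
          refine (measure_mono fun X hX => ?_).trans (measure_iUnion_le E)
          exact Set.mem_iUnion.2 ⟨_, rfl, hX⟩
      _ = ∑' S, P Bᶜ * P (E S) := by rw [ENNReal.tsum_mul_left, mul_comm]
      _ ≤ ∑' S, P.prod P (G S) := by
          refine ENNReal.tsum_le_tsum fun S => ?_
          rw [← Measure.prod_prod, ← hP.prod_preimage_swap (S : Set _)]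
          refine measure_mono fun Z hZ => ⟨hZ.1, ?_⟩
          obtain ⟨h1, h2⟩ := hZ.2
          have hagree : ∀ e ∈ S, Z.1 e = (swap (S : Set _) Z).2 e :=
            fun e he => (swap_snd_of_mem he).symm
          refine ⟨?_, ?_⟩
          · rw [explore_congr fun e he => hagree e (by rwa [h1] at he), h1]
          · rwa [mask_congr hagree]
      _ = P.prod P (⋃ S, G S) := by
          rw [measure_iUnion]
          · intro S T hST
            exact Set.disjoint_left.2 fun Z h1 h2 => hST (h1.2.1.symm.trans h2.2.1)
          · exact hGm
  have hsub : P.prod P (⋃ S, G S) ≤ P.prod P (⋃ s, N s) := by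
    refine measure_mono_ae ?_
    filter_upwards [Measure.quasiMeasurePreserving_fst.ae hCB] with Z hZ hmem
    obtain ⟨S, h1, h2, h3⟩ := Set.mem_iUnion.1 hmem
    subst h2
    have hZ0 : (swap (explore ex Φ 0 Z.1 : Set _) Z).1 ∈ B := by
      have : (swap (explore ex Φ 0 Z.1 : Set _) Z).1 = Z.1 := by
        funext e; simp [explore, swap]
      rw [this]
      exact hZ h3
    obtain ⟨s, hs1, hs2⟩ : ∃ s, (swap (explore ex Φ s Z.1 : Set _) Z).1 ∈ B ∧
        (swap (explore ex Φ (s + 1) Z.1 : Set _) Z).1 ∉ B := by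
      by_contra! hcon
      exact h1 (Nat.rec hZ0 (fun s hs => hcon s hs) t)
    refine Set.mem_iUnion.2 ⟨s, Set.mem_iUnion.2 ⟨explore ex Φ s Z.1, rfl, ?_⟩⟩
    rw [explore] at hs2
    split_ifs at hs2 with hcond
    · have hnew : ex s ∉ explore ex Φ s Z.1 := by
        intro hmem
        rw [Finset.insert_eq_of_mem hmem] at hs2
        exact hs2 hs1
      refine ⟨hnew, hcond, ?_⟩
      rw [← Finset.coe_insert]
      refine ⟨hs2, Z.1 (ex s), ?_⟩
      rwa [swap_insert Z hnew]
    · exact absurd hs1 hs2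
  refine hlow.trans (hsub.trans ((measure_iUnion_le _).trans ?_))
  calc ∑' s, P.prod P (N s) ≤ ∑' s, P (reveals ex Φ s) * P (switches B (ex s)) :=
        ENNReal.tsum_le_tsum fun s => measure_prod_step_le hP hΦ B s
    _ = ∑' s, ∑' e, P {X | ex s = e ∧ X ∈ reveals ex Φ s} * P (switches B e) := by
        refine tsum_congr fun s => ?_
        rw [tsum_eq_single (ex s)]
        · simp
        · intro e he
          simp [he.symm]
    _ = ∑' e, ∑' s, P {X | ex s = e ∧ X ∈ reveals ex Φ s} * P (switches B e) :=
        ENNReal.tsum_comm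
    _ ≤ ∑' e, R e * P (switches B e) := by
        refine ENNReal.tsum_le_tsum fun e => ?_
        rw [ENNReal.tsum_mul_right]
        gcongr
        exact (tsum_reveals_le hΦ e).trans (hR e)

theorem explore_inequality_limit {P : Measure (Config d)} (hP : IsProductUniform P)
    (hΦ : ∀ A e, MeasurableSet {X | e ∈ Φ A X}) {B : Set (Config d)} (hB : MeasurableSet B)
    {C : Finset (Sym2 (Vertex d)) → Config d → Prop} (hC : ∀ A, MeasurableSet {X | C A X})
    (hCB : ∀ t, ∀ᵐ X ∂P, C (explore ex Φ t X) (mask (explore ex Φ t X) X) → X ∈ B)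
    (hBC : ∀ᵐ X ∂P, X ∈ B → ∀ᶠ t in Filter.atTop,
      C (explore ex Φ t X) (mask (explore ex Φ t X) X))
    {R : Sym2 (Vertex d) → ENNReal} (hR : ∀ e, P {X | ∃ t, e ∈ explore ex Φ t X} ≤ R e) :
    P B * P Bᶜ ≤ ∑' e, R e * P (switches B e) := by
  set D : ℕ → Set (Config d) := fun T =>
    {X | ∀ t ≥ T, C (explore ex Φ t X) (mask (explore ex Φ t X) X)} with hD
  have hmono : Monotone D := fun S T hST X hX t ht => hX t (hST.trans ht)
  have hle : P B ≤ ⨆ T, P (D T) := by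
    rw [← hmono.measure_iUnion]
    refine measure_mono_ae ?_
    filter_upwards [hBC] with X hX hXB
    obtain ⟨T, hT⟩ := Filter.eventually_atTop.1 (hX hXB)
    exact Set.mem_iUnion.2 ⟨T, hT⟩
  calc P B * P Bᶜ ≤ (⨆ T, P (D T)) * P Bᶜ := by gcongr
    _ = ⨆ T, P (D T) * P Bᶜ := ENNReal.iSup_mul _ _
    _ ≤ _ := iSup_le fun T => le_trans (by gcongr; exact fun X hX => hX T le_rfl)
        (explore_inequality hP hΦ hB hC T (hCB T) hR)

end

/-! ### Exploring the clusters of a sphere -/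

/-- All the edges which matter for the status of `e` belong to `A`. -/
def Certified {d : ℕ} (A : Finset (Sym2 (Vertex d))) (W : Config d) (e : Sym2 (Vertex d)) : Prop :=
  ∀ f g, Relation.ReflTransGen (Below W) f e → AdjE g f → g ∈ A

theorem Certified.of_below {d : ℕ} {A : Finset (Sym2 (Vertex d))} {W : Config d}
    {e f : Sym2 (Vertex d)} (h : Certified A W e) (hfe : Below W f e) : Certified A W f :=
  fun f' g hf' hg => h f' g (hf'.tail hfe) hg

theorem Certified.mem_of_adjE {d : ℕ} {A : Finset (Sym2 (Vertex d))} {W : Config d}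
    {e f : Sym2 (Vertex d)} (h : Certified A W e) (hfe : AdjE f e) : f ∈ A :=
  h e f .refl hfe

theorem Certified.opens_iff {d κ : ℕ} {A : Finset (Sym2 (Vertex d))} {W X : Config d}
    (hW : WellFounded (Below W)) (hX : WellFounded (Below X)) (hWX : ∀ e ∈ A, W e = X e)
    {e : Sym2 (Vertex d)} (he : IsNNEdge e) (h : Certified A W e) :
    Opens κ W e ↔ Opens κ X e := by
  induction e using hW.induction with
  | _ e ih =>
    rw [CDP.opens_iff hW he, CDP.opens_iff hX he]
    refine forall₂_congr fun v hv => ?_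
    rw [lowerDegree_congr (V := X) (ρ := Opens κ X) fun f hf hvf _ => ?_]
    have hfe : AdjE f e := ⟨hf, he, v, hvf, hv⟩
    rw [← hWX f (h.mem_of_adjE hfe), ← hWX e (h.mem_of_adjE (AdjE.refl he))]
    refine and_congr_right fun hlt => ?_
    exact ih f ⟨hfe, hlt⟩ hf (h.of_below ⟨hfe, hlt⟩)

theorem Certified.mem_openSet_iff {d κ : ℕ} {A : Finset (Sym2 (Vertex d))} {W X : Config d} {p : ℝ}
    (hW : WellFounded (Below W)) (hX : WellFounded (Below X)) (hWX : ∀ e ∈ A, W e = X e)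
    {e : Sym2 (Vertex d)} (h : Certified A W e) :
    e ∈ openSet κ W p ↔ e ∈ openSet κ X p := by
  refine and_congr_right fun he => ?_
  rw [hWX e (h.mem_of_adjE (AdjE.refl he)), h.opens_iff hW hX hWX he]

theorem wellFounded_below_mask {d : ℕ} (A : Finset (Sym2 (Vertex d))) (X : Config d) :
    WellFounded (Below (mask A X)) := by
  refine wellFounded_below_of_finite (U := fun _ => 2) ⟨fun e => ⟨_, fun f hf => ?_⟩⟩
    A.finite_toSet fun e _ he => if_neg he
  exact absurd hf.2 (lt_irrefl _)

theorem Certified.mask {d : ℕ} {A : Finset (Sym2 (Vertex d))} {X : Config d}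
    {e : Sym2 (Vertex d)} (he : IsNNEdge e) (h : Certified A X e) : Certified A (mask A X) e := by
  have key : ∀ f, Relation.ReflTransGen (Below (CDP.mask A X)) f e →
      IsNNEdge f ∧ Relation.ReflTransGen (Below X) f e := by
    intro f hf
    induction hf using Relation.ReflTransGen.head_induction_on with
    | refl => exact ⟨he, .refl⟩
    | head hfg _ ih =>
      refine ⟨hfg.1.1, ih.2.head ⟨hfg.1, ?_⟩⟩
      have := hfg.2
      rwa [mask_of_mem (h _ _ ih.2 hfg.1), mask_of_mem (h _ _ ih.2 (AdjE.refl ih.1))] at this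
  exact fun f g hf hg => h f g (key f hf).2 hg

/-- The edges certified to be `p`-open. -/
def certOpen {d : ℕ} (κ : ℕ) (p : ℝ) (A : Finset (Sym2 (Vertex d))) (W : Config d) :
    Set (Sym2 (Vertex d)) :=
  {e | e ∈ openSet κ W p ∧ Certified A W e}

theorem certOpen_subset {d κ : ℕ} {p : ℝ} {A : Finset (Sym2 (Vertex d))} {X : Config d}
    (hX : WellFounded (Below X)) : certOpen κ p A (mask A X) ⊆ openSet κ X p :=
  fun _ he => (he.2.mem_openSet_iff (wellFounded_below_mask A X) hX
    fun _ hf => mask_of_mem hf).1 he.1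

/-- The vertices known to be joined to the sphere of radius `k`. -/
def reached {d : ℕ} (κ : ℕ) (p : ℝ) (k : ℕ) (A : Finset (Sym2 (Vertex d))) (W : Config d) :
    Set (Vertex d) :=
  {v | ∃ s, norm1 s = k ∧ (SimpleGraph.fromEdgeSet (certOpen κ p A W)).Reachable s v}

/-- The restriction of the relation `Below` to `A`. -/
def BelowIn {d : ℕ} (A : Finset (Sym2 (Vertex d))) (W : Config d) (f g : Sym2 (Vertex d)) : Prop :=
  Below W f g ∧ f ∈ A ∧ g ∈ A

/-- The edges which may be revealed. -/
def rule {d : ℕ} (κ : ℕ) (p : ℝ) (k : ℕ) (A : Finset (Sym2 (Vertex d))) (W : Config d) :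
    Set (Sym2 (Vertex d)) :=
  {e | IsNNEdge e ∧ ∃ v ∈ reached κ p k A W, v ∈ e ∨
    ∃ f f', v ∈ f' ∧ f' ∈ A ∧ Relation.ReflTransGen (BelowIn A W) f f' ∧ AdjE e f}

theorem reached_subset {d κ : ℕ} {p : ℝ} {k : ℕ} {A : Finset (Sym2 (Vertex d))} {X : Config d}
    (hX : WellFounded (Below X)) {v : Vertex d} (hv : v ∈ reached κ p k A (mask A X)) :
    X ∈ toSphere κ k p v := by
  obtain ⟨s, hs, hr⟩ := hv
  exact ⟨s, hs, (hr.mono (SimpleGraph.fromEdgeSet_mono (certOpen_subset hX))).symm⟩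

theorem exists_incChain_of_belowIn {d : ℕ} {A : Finset (Sym2 (Vertex d))} {X : Config d}
    {f f' : Sym2 (Vertex d)} (h : Relation.ReflTransGen (BelowIn A (mask A X)) f f')
    {e : Sym2 (Vertex d)} (hef : AdjE e f) : ∃ c, IncChain X e c ∧ f' ∈ c := by
  have key : ∃ c, (f :: c).IsChain AdjE ∧ (f :: c).IsChain (X · < X ·) ∧ f' ∈ f :: c := by
    clear hef
    induction h using Relation.ReflTransGen.head_induction_on with
    | refl => exact ⟨[], List.isChain_singleton _, List.isChain_singleton _, by simp⟩
    | head hfg _ ih =>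
      obtain ⟨c, h1, h2, h3⟩ := ih
      refine ⟨_, List.isChain_cons_cons.2 ⟨hfg.1.1, h1⟩,
        List.isChain_cons_cons.2 ⟨?_, h2⟩, List.mem_cons_of_mem _ h3⟩
      have := hfg.1.2
      rwa [mask_of_mem hfg.2.1, mask_of_mem hfg.2.2] at this
  obtain ⟨c, h1, h2, h3⟩ := key
  exact ⟨f :: c, ⟨List.isChain_cons_cons.2 ⟨hef, h1⟩, h2⟩, h3⟩

theorem surgeable_of_mem_rule {d κ : ℕ} (hκ : 2 ≤ κ) {p : ℝ} {k : ℕ}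
    {A : Finset (Sym2 (Vertex d))} {X : Config d} (hX : Good X) {e : Sym2 (Vertex d)}
    (he : e ∈ rule κ p k A (mask A X)) {x : Vertex d} (hx : x ∈ e) :
    Surgeable κ p e (fun _ => toSphere κ k p x) X := by
  obtain ⟨heN, v, hv, hve | ⟨f, f', hvf, -, hff, hef⟩⟩ := he
  · exact surgeable_connect hκ hX heN (c := []) ⟨List.isChain_singleton _, List.isChain_nil⟩ hx
      ⟨e, by simp, hve⟩ (reached_subset hX.wf hv)
  · obtain ⟨c, hc, hfc⟩ := exists_incChain_of_belowIn hff hef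
    exact surgeable_connect hκ hX heN hc hx ⟨f', List.mem_cons_of_mem _ hfc, hvf⟩
      (reached_subset hX.wf hv)

theorem exists_mem_of_mem_explore {d : ℕ} {ex : ℕ → Sym2 (Vertex d)}
    {Φ : Finset (Sym2 (Vertex d)) → Config d → Set (Sym2 (Vertex d))} {t : ℕ} {X : Config d}
    {e : Sym2 (Vertex d)} (h : e ∈ explore ex Φ t X) : ∃ A, e ∈ Φ A (mask A X) := by
  induction t with
  | zero => simp [explore] at h
  | succ t ih =>
    rw [explore] at h
    split_ifs at h with hc
    · rcases Finset.mem_insert.1 h with rfl | h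
      · exact ⟨_, hc⟩
      · exact ih h
    · exact ih h

theorem measure_explore_le {d κ : ℕ} (hκ : 2 ≤ κ) {P : Measure (Config d)}
    (hP : IsProductUniform P) {p : ℝ} {c₀ : ENNReal} (hc₀ : c₀ ≠ 0)
    (h1 : c₀ ≤ labelLaw (Set.Iic p)) (h2 : c₀ ≤ labelLaw (Set.Ioi p))
    (ex : ℕ → Sym2 (Vertex d)) (k : ℕ) (e : Sym2 (Vertex d)) :
    P {X | ∃ t, e ∈ explore ex (rule κ p k) t X} ≤
      totalWeight d c₀ * P (armEvent κ (|norm1 (Quot.out e).1 - k|).toNat p) := by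
  have hx : (Quot.out e).1 ∈ e := Sym2.out_fst_mem e
  by_cases he : IsNNEdge e
  · refine le_trans (measure_mono_ae ?_) ((measure_surgeable_const_le (κ := κ) hP hc₀ h1 h2 he
      (toSphere κ k p (Quot.out e).1)).trans ?_)
    · filter_upwards [hP.ae_good] with X hX hXe
      obtain ⟨t, ht⟩ := hXe
      obtain ⟨A, hA⟩ := exists_mem_of_mem_explore ht
      exact surgeable_of_mem_rule hκ hX hA hx
    · exact mul_le_mul' le_rfl (measure_toSphere_le hP p _ k)
  · refine le_trans (le_of_eq ?_) zero_le
    convert measure_empty (μ := P)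
    refine Set.eq_empty_of_forall_notMem fun X ⟨t, ht⟩ => ?_
    obtain ⟨A, hA⟩ := exists_mem_of_mem_explore ht
    exact he hA.1

/-! ### Measurability of the exploration -/

theorem measurableSet_reflTransGen {α V : Type*} [MeasurableSpace α] [Countable V]
    (r : α → V → V → Prop) (hr : ∀ x y, MeasurableSet {u | r u x y}) (a b : V) :
    MeasurableSet {u | Relation.ReflTransGen (r u) a b} := by
  have key : ∀ n : ℕ, ∀ a, MeasurableSet {u | ∃ c : ℕ → V, c 0 = a ∧ c n = b ∧
      ∀ i < n, r u (c i) (c (i + 1))} := by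
    intro n
    induction n with
    | zero =>
      intro a
      have : {u | ∃ c : ℕ → V, c 0 = a ∧ c 0 = b ∧ ∀ i < 0, r u (c i) (c (i + 1))} =
          {_u : α | a = b} :=
        Set.ext fun u => ⟨fun ⟨c, h1, h2, _⟩ => h1.symm.trans h2,
          fun h => ⟨fun _ => a, rfl, h, fun i hi => absurd hi (Nat.not_lt_zero i)⟩⟩
      rw [this]
      exact MeasurableSet.const _
    | succ n ih =>
      intro a
      have : {u | ∃ c : ℕ → V, c 0 = a ∧ c (n + 1) = b ∧ ∀ i < n + 1, r u (c i) (c (i + 1))} =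
          ⋃ x, {u | r u a x} ∩ {u | ∃ c : ℕ → V, c 0 = x ∧ c n = b ∧
            ∀ i < n, r u (c i) (c (i + 1))} := by
        ext u
        simp only [Set.mem_ofPred_eq, Set.mem_iUnion, Set.mem_inter_iff]
        constructor
        · rintro ⟨c, rfl, h2, h3⟩
          exact ⟨c 1, h3 0 (by omega), fun i => c (i + 1), rfl, h2, fun i hi => h3 _ (by omega)⟩
        · rintro ⟨x, h, c, rfl, h2, h3⟩
          refine ⟨fun i => Nat.casesOn i a c, rfl, h2, fun i hi => ?_⟩
          cases i with
          | zero => exact h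
          | succ i => exact h3 i (by omega)
      rw [this]
      exact MeasurableSet.iUnion fun x => (hr a x).inter (ih x)
  have : {u | Relation.ReflTransGen (r u) a b} = ⋃ n : ℕ, {u | ∃ c : ℕ → V, c 0 = a ∧ c n = b ∧
      ∀ i < n, r u (c i) (c (i + 1))} := by
    ext u
    simp only [Set.mem_ofPred_eq, Set.mem_iUnion]
    constructor
    · intro h
      induction h using Relation.ReflTransGen.head_induction_on with
      | refl => exact ⟨0, fun _ => b, rfl, rfl, by simp⟩
      | @head x y hxy _ ih =>
        obtain ⟨n, c, rfl, h2, h3⟩ := ih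
        refine ⟨n + 1, fun i => Nat.casesOn i x c, rfl, h2, fun i hi => ?_⟩
        cases i with
        | zero => exact hxy
        | succ i => exact h3 i (by omega)
    · rintro ⟨n, c, rfl, rfl, h3⟩
      have walk : ∀ m ≤ n, Relation.ReflTransGen (r u) (c 0) (c m) := by
        intro m
        induction m with
        | zero => exact fun _ => .refl
        | succ m ih => exact fun hm => (ih (by omega)).tail (h3 m (by omega))
      exact walk n le_rfl
  rw [this]
  exact MeasurableSet.iUnion fun n => key n a

theorem measurableSet_below {d : ℕ} (f e : Sym2 (Vertex d)) :
    MeasurableSet {U : Config d | Below U f e} :=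
  (MeasurableSet.const _).inter (measurableSet_lt (measurable_label f) (measurable_label e))

theorem measurableSet_certOpen {d κ : ℕ} (p : ℝ) (A : Finset (Sym2 (Vertex d)))
    (e : Sym2 (Vertex d)) : MeasurableSet {U : Config d | e ∈ certOpen κ p A U} := by
  refine (measurableSet_mem_openSet p e).inter ?_
  have : {U : Config d | Certified A U e} = ⋂ f, ⋂ g,
      ({U | Relation.ReflTransGen (Below U) f e}ᶜ ∪ {_U | AdjE g f → g ∈ A}) := by
    ext U
    simp only [Certified, Set.mem_ofPred_eq, Set.mem_iInter, Set.mem_union, Set.mem_compl_iff,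
      ← imp_iff_not_or]
  change MeasurableSet {U : Config d | Certified A U e}
  rw [this]
  exact MeasurableSet.iInter fun f => MeasurableSet.iInter fun g =>
    (measurableSet_reflTransGen _ measurableSet_below f e).compl.union (MeasurableSet.const _)

theorem measurableSet_certReachable {d κ : ℕ} (p : ℝ) (A : Finset (Sym2 (Vertex d)))
    (a b : Vertex d) : MeasurableSet
      {U : Config d | (SimpleGraph.fromEdgeSet (certOpen κ p A U)).Reachable a b} :=
  measurableSet_reachable _ (fun x y => by
    simp only [SimpleGraph.fromEdgeSet_adj]
    exact (measurableSet_certOpen p A _).inter (MeasurableSet.const _)) a b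

theorem measurableSet_reached {d κ k : ℕ} (p : ℝ) (A : Finset (Sym2 (Vertex d)))
    (v : Vertex d) : MeasurableSet {U : Config d | v ∈ reached κ p k A U} := by
  have : {U : Config d | v ∈ reached κ p k A U} = ⋃ s : Vertex d, {_U | norm1 s = k} ∩
      {U | (SimpleGraph.fromEdgeSet (certOpen κ p A U)).Reachable s v} := by
    ext U; simp [reached]
  rw [this]
  exact MeasurableSet.iUnion fun s =>
    (MeasurableSet.const _).inter (measurableSet_certReachable p A s v)

theorem measurableSet_rule {d κ k : ℕ} (p : ℝ) (A : Finset (Sym2 (Vertex d)))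
    (e : Sym2 (Vertex d)) : MeasurableSet {U : Config d | e ∈ rule κ p k A U} := by
  have : {U : Config d | e ∈ rule κ p k A U} = {_U | IsNNEdge e} ∩ ⋃ v : Vertex d,
      ({U | v ∈ reached κ p k A U} ∩ ({_U | v ∈ e} ∪ ⋃ f, ⋃ f', {_U | v ∈ f' ∧ f' ∈ A ∧ AdjE e f} ∩
        {U | Relation.ReflTransGen (BelowIn A U) f f'})) := by
    ext U
    simp only [rule, Set.mem_ofPred_eq, Set.mem_iUnion, Set.mem_inter_iff, Set.mem_union]
    constructor
    · rintro ⟨h, v, hv, h1 | ⟨f, f', h1, h2, h3, h4⟩⟩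
      · exact ⟨h, v, hv, Or.inl h1⟩
      · exact ⟨h, v, hv, Or.inr ⟨f, f', ⟨h1, h2, h4⟩, h3⟩⟩
    · rintro ⟨h, v, hv, h1 | ⟨f, f', ⟨h1, h2, h4⟩, h3⟩⟩
      · exact ⟨h, v, hv, Or.inl h1⟩
      · exact ⟨h, v, hv, Or.inr ⟨f, f', h1, h2, h3, h4⟩⟩
  rw [this]
  refine (MeasurableSet.const _).inter (MeasurableSet.iUnion fun v =>
    (measurableSet_reached p A v).inter ((MeasurableSet.const _).union ?_))
  exact MeasurableSet.iUnion fun f => MeasurableSet.iUnion fun f' =>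
    (MeasurableSet.const _).inter (measurableSet_reflTransGen _
      (fun x y => (measurableSet_below x y).inter (MeasurableSet.const _)) f f')

/-! ### The exploration eventually finds the arm -/

section
variable {d κ k : ℕ} {p : ℝ} {ex : ℕ → Sym2 (Vertex d)} {X : Config d}

theorem eventually_mem_explore {Φ : Finset (Sym2 (Vertex d)) → Config d → Set (Sym2 (Vertex d))}
    (hex : ∀ e T, ∃ t ≥ T, ex t = e) {e : Sym2 (Vertex d)}
    (h : ∀ᶠ t in Filter.atTop, e ∈ Φ (explore ex Φ t X) (mask (explore ex Φ t X) X)) :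
    ∀ᶠ t in Filter.atTop, e ∈ explore ex Φ t X := by
  classical
  obtain ⟨T, hT⟩ := Filter.eventually_atTop.1 h
  obtain ⟨t, ht, rfl⟩ := hex e T
  refine Filter.eventually_atTop.2 ⟨t + 1, fun s hs => explore_mono X hs ?_⟩
  simp [explore, hT t ht]

theorem eventually_reveal_chain (hex : ∀ e T, ∃ t ≥ T, ex t = e) {v : Vertex d}
    (hv : ∀ᶠ t in Filter.atTop, v ∈ reached κ p k (explore ex (rule κ p k) t X)
      (mask (explore ex (rule κ p k) t X) X)) {e : Sym2 (Vertex d)} (he : IsNNEdge e)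
    (hve : v ∈ e) {f : Sym2 (Vertex d)} (hf : Relation.ReflTransGen (Below X) f e) :
    ∀ᶠ t in Filter.atTop, f ∈ explore ex (rule κ p k) t X ∧ e ∈ explore ex (rule κ p k) t X ∧
      Relation.ReflTransGen (BelowIn (explore ex (rule κ p k) t X)
        (mask (explore ex (rule κ p k) t X) X)) f e := by
  induction hf using Relation.ReflTransGen.head_induction_on with
  | refl =>
    have : ∀ᶠ t in Filter.atTop, e ∈ explore ex (rule κ p k) t X :=
      eventually_mem_explore hex (hv.mono fun t ht => ⟨he, v, ht, Or.inl hve⟩)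
    exact this.mono fun t ht => ⟨ht, ht, .refl⟩
  | @head f g hfg _ ih =>
    have : ∀ᶠ t in Filter.atTop, f ∈ explore ex (rule κ p k) t X := by
      refine eventually_mem_explore hex ?_
      filter_upwards [hv, ih] with t ht h
      exact ⟨hfg.1.1, v, ht, Or.inr ⟨g, e, hve, h.2.1, h.2.2, hfg.1⟩⟩
    filter_upwards [this, ih] with t hft h
    refine ⟨hft, h.2.1, h.2.2.head ⟨⟨hfg.1, ?_⟩, hft, h.1⟩⟩
    rw [mask_of_mem hft, mask_of_mem h.1]
    exact hfg.2

theorem eventually_reveal (hex : ∀ e T, ∃ t ≥ T, ex t = e) {v : Vertex d}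
    (hv : ∀ᶠ t in Filter.atTop, v ∈ reached κ p k (explore ex (rule κ p k) t X)
      (mask (explore ex (rule κ p k) t X) X)) {e : Sym2 (Vertex d)} (he : IsNNEdge e)
    (hve : v ∈ e) {f g : Sym2 (Vertex d)} (hf : Relation.ReflTransGen (Below X) f e)
    (hgf : AdjE g f) : ∀ᶠ t in Filter.atTop, g ∈ explore ex (rule κ p k) t X := by
  refine eventually_mem_explore hex ?_
  filter_upwards [hv, eventually_reveal_chain hex hv he hve hf] with t ht h
  exact ⟨hgf.1, v, ht, Or.inr ⟨f, e, hve, h.2.1, h.2.2, hgf⟩⟩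

theorem eventually_certified (hX : WellFounded (Below X)) {A : ℕ → Finset (Sym2 (Vertex d))}
    {e : Sym2 (Vertex d)} (h : ∀ f g, Relation.ReflTransGen (Below X) f e → AdjE g f →
      ∀ᶠ t in Filter.atTop, g ∈ A t) : ∀ᶠ t in Filter.atTop, Certified (A t) X e := by
  induction e using hX.induction with
  | _ e ih =>
    have h1 : ∀ᶠ t in Filter.atTop, ∀ g ∈ edgeNbrs e, g ∈ A t :=
      (Filter.eventually_all_finset _).2 fun g hg => h e g .refl ((mem_edgeNbrs _ _).1 hg).symm
    have h2 : ∀ᶠ t in Filter.atTop, ∀ f ∈ edgeNbrs e, Below X f e → Certified (A t) X f := by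
      refine (Filter.eventually_all_finset _).2 fun f _ => ?_
      by_cases hf : Below X f e
      · exact (ih f hf fun f' g hf' hg => h f' g (hf'.tail hf) hg).mono fun t ht _ => ht
      · exact Filter.Eventually.of_forall fun t h => absurd h hf
    filter_upwards [h1, h2] with t h1 h2 f g hf hg
    rcases Relation.ReflTransGen.cases_tail hf with rfl | ⟨f', hff, hfe⟩
    · exact h1 g ((mem_edgeNbrs _ _).2 hg.symm)
    · exact h2 f' ((mem_edgeNbrs _ _).2 hfe.1.symm) hfe f g hff hg

theorem eventually_mem_certOpen (hX : WellFounded (Below X)) (hex : ∀ e T, ∃ t ≥ T, ex t = e)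
    {v : Vertex d} (hv : ∀ᶠ t in Filter.atTop, v ∈ reached κ p k (explore ex (rule κ p k) t X)
      (mask (explore ex (rule κ p k) t X) X)) {e : Sym2 (Vertex d)} (hve : v ∈ e)
    (he : e ∈ openSet κ X p) : ∀ᶠ t in Filter.atTop,
      e ∈ certOpen κ p (explore ex (rule κ p k) t X) (mask (explore ex (rule κ p k) t X) X) := by
  filter_upwards [eventually_certified hX fun f g => eventually_reveal hex hv he.1 hve] with t ht
  have hc := ht.mask he.1
  exact ⟨(hc.mem_openSet_iff (wellFounded_below_mask _ X) hX fun _ hf => mask_of_mem hf).2 he, hc⟩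

theorem eventually_reachable (hX : WellFounded (Below X)) (hex : ∀ e T, ∃ t ≥ T, ex t = e)
    {s v : Vertex d} (hs : norm1 s = k) (h : (openGraph κ X p).Reachable s v) :
    ∀ᶠ t in Filter.atTop, (SimpleGraph.fromEdgeSet (certOpen κ p (explore ex (rule κ p k) t X)
      (mask (explore ex (rule κ p k) t X) X))).Reachable s v := by
  rw [SimpleGraph.reachable_iff_reflTransGen] at h
  induction h with
  | refl => exact Filter.Eventually.of_forall fun t => SimpleGraph.Reachable.refl _
  | @tail v w _ hvw ih =>
    have hv : ∀ᶠ t in Filter.atTop, v ∈ reached κ p k (explore ex (rule κ p k) t X)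
        (mask (explore ex (rule κ p k) t X) X) := ih.mono fun t ht => ⟨s, hs, ht⟩
    filter_upwards [ih, eventually_mem_certOpen hX hex hv (Sym2.mem_mk_left v w)
      (openGraph_adj.1 hvw)] with t h1 h2
    exact h1.trans (SimpleGraph.Adj.reachable
      ((SimpleGraph.fromEdgeSet_adj _).2 ⟨h2, hvw.ne⟩))

end

/-- The arm has been found. -/
def Found {d : ℕ} (κ : ℕ) (p : ℝ) (k n : ℕ) (A : Finset (Sym2 (Vertex d))) (W : Config d) : Prop :=
  ∃ s b : Vertex d, norm1 s = k ∧ norm1 b = n ∧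
    (SimpleGraph.fromEdgeSet (certOpen κ p A W)).Reachable s 0 ∧
    (SimpleGraph.fromEdgeSet (certOpen κ p A W)).Reachable s b

theorem exists_enumeration (α : Type*) [Countable α] [Nonempty α] :
    ∃ ex : ℕ → α, ∀ a T, ∃ t ≥ T, ex t = a := by
  obtain ⟨g, hg⟩ := exists_surjective_nat α
  refine ⟨fun t => g t.unpair.1, fun a T => ?_⟩
  obtain ⟨m, rfl⟩ := hg a
  exact ⟨Nat.pair m T, Nat.right_le_pair _ _, by simp⟩

theorem arm_variance_le {d κ : ℕ} (hκ : 2 ≤ κ) {P : Measure (Config d)} (hP : IsProductUniform P)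
    {p : ℝ} {c₀ : ENNReal} (hc₀ : c₀ ≠ 0) (h1 : c₀ ≤ labelLaw (Set.Iic p))
    (h2 : c₀ ≤ labelLaw (Set.Ioi p)) {k n : ℕ} (hkn : k ≤ n) :
    P (armEvent κ n p) * P (armEvent κ n p)ᶜ ≤ ∑' e : Sym2 (Vertex d),
      totalWeight d c₀ * P (armEvent κ (|norm1 (Quot.out e).1 - k|).toNat p) *
        P (labelPivotal κ n p e) := by
  have : Nonempty (Sym2 (Vertex d)) := ⟨s(0, 0)⟩
  obtain ⟨ex, hex⟩ := exists_enumeration (Sym2 (Vertex d))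
  refine explore_inequality_limit (ex := ex) (Φ := rule κ p k) (C := Found κ p k n) hP
    (fun A e => measurableSet_rule p A e) (measurableSet_armEvent p) ?_ ?_ ?_
    (measure_explore_le hκ hP hc₀ h1 h2 ex k)
  · intro A
    have : {X : Config d | Found κ p k n A X} = ⋃ s : Vertex d, ⋃ b : Vertex d,
        {_X | norm1 s = k ∧ norm1 b = n} ∩
        ({X | (SimpleGraph.fromEdgeSet (certOpen κ p A X)).Reachable s 0} ∩
        {X | (SimpleGraph.fromEdgeSet (certOpen κ p A X)).Reachable s b}) := by
      ext X
      simp [Found, and_assoc]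
    rw [this]
    exact MeasurableSet.iUnion fun s => MeasurableSet.iUnion fun b => (MeasurableSet.const _).inter
      ((measurableSet_certReachable p A s 0).inter (measurableSet_certReachable p A s b))
  · intro t
    filter_upwards [hP.ae_good] with X hX hf
    obtain ⟨s, b, -, hb, hs0, hsb⟩ := hf
    exact ⟨b, hb, (hs0.symm.trans hsb).mono
      (SimpleGraph.fromEdgeSet_mono (certOpen_subset hX.wf))⟩
  · filter_upwards [hP.ae_good] with X hX hXB
    obtain ⟨s, hs, hs0⟩ := Arm.anti hkn openSet_isNN hXB
    obtain ⟨b, hb, hb0⟩ := hXB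
    filter_upwards [eventually_reachable (κ := κ) (p := p) hX.wf hex hs hs0.symm,
      eventually_reachable (κ := κ) (p := p) hX.wf hex hs (hs0.symm.trans hb0)] with t h3 h4
    exact ⟨s, b, hs, hb, h3, h4⟩

theorem sum_shifted_le {θ : ℕ → ENNReal} (hθ : Antitone θ) (n : ℕ) {a : ℤ} (ha : 0 ≤ a) :
    ∑ k ∈ Finset.range n, θ (|a - k|).toNat ≤ 2 * ∑ j ∈ Finset.range n, θ j := by
  lift a to ℕ using ha
  rw [← Finset.sum_filter_add_sum_filter_not _ (fun k => k ≤ a), two_mul]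
  refine add_le_add ?_ ?_
  · calc _ ≤ ∑ k ∈ (Finset.range n).filter (fun k => k ≤ a), θ (min a (n - 1) - k) := by
          refine Finset.sum_le_sum fun k hk => hθ ?_
          simp only [Finset.mem_filter, Finset.mem_range] at hk
          rw [abs_of_nonneg (by omega)]
          omega
      _ = ∑ j ∈ ((Finset.range n).filter (fun k => k ≤ a)).image
            (fun k => min a (n - 1) - k), θ j := by
          rw [Finset.sum_image]
          intro x hx y hy hxy
          simp only [Finset.coe_filter, Finset.mem_range, Set.mem_ofPred_eq] at hx hy hxy
          omega
      _ ≤ _ := by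
          refine Finset.sum_le_sum_of_subset fun j hj => ?_
          simp only [Finset.mem_image, Finset.mem_filter, Finset.mem_range] at hj ⊢
          omega
  · calc _ = ∑ k ∈ (Finset.range n).filter (fun k => ¬ k ≤ a), θ (k - a) := by
          refine Finset.sum_congr rfl fun k hk => ?_
          simp only [Finset.mem_filter, Finset.mem_range] at hk
          congr 1
          rw [abs_of_nonpos (by omega)]
          omega
      _ = ∑ j ∈ ((Finset.range n).filter (fun k => ¬ k ≤ a)).image (fun k => k - a), θ j := by
          rw [Finset.sum_image]
          intro x hx y hy hxy
          simp only [Finset.coe_filter, Finset.mem_range, Set.mem_ofPred_eq] at hx hy hxy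
          omega
      _ ≤ _ := by
          refine Finset.sum_le_sum_of_subset fun j hj => ?_
          simp only [Finset.mem_image, Finset.mem_filter, Finset.mem_range] at hj ⊢
          omega

theorem armEvent_anti {d κ : ℕ} (p : ℝ) : Antitone fun n => (armEvent κ n p : Set (Config d)) :=
  fun _ _ hmn _ hU => Arm.anti hmn openSet_isNN hU

/-- The sharp threshold inequality for the total influence. -/
theorem mul_variance_le {d κ : ℕ} (hκ : 2 ≤ κ) {P : Measure (Config d)} (hP : IsProductUniform P)
    {p : ℝ} (hp : p < 2) {c₀ : ENNReal} (hc₀ : c₀ ≠ 0) (h1 : c₀ ≤ labelLaw (Set.Iic p))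
    (h2 : c₀ ≤ labelLaw (Set.Ioi p)) (n : ℕ) :
    n * (P (armEvent κ n p) * P (armEvent κ n p)ᶜ) ≤
      2 * totalWeight d c₀ ^ 2 * (∑ j ∈ Finset.range n, P (armEvent κ j p)) *
        ∑' f, P (pivotal κ n p f) := by
  have hanti : Antitone fun j => P (armEvent κ j p : Set (Config d)) :=
    fun i j hij => measure_mono (armEvent_anti p hij)
  calc (n : ENNReal) * (P (armEvent κ n p) * P (armEvent κ n p)ᶜ)
      = ∑ _k ∈ Finset.range n, P (armEvent κ n p) * P (armEvent κ n p)ᶜ := by simp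
    _ ≤ ∑ k ∈ Finset.range n, ∑' e : Sym2 (Vertex d),
          totalWeight d c₀ * P (armEvent κ (|norm1 (Quot.out e).1 - k|).toNat p) *
            P (labelPivotal κ n p e) :=
        Finset.sum_le_sum fun k hk => arm_variance_le hκ hP hc₀ h1 h2 (Finset.mem_range.1 hk).le
    _ = ∑' e : Sym2 (Vertex d), totalWeight d c₀ *
          (∑ k ∈ Finset.range n, P (armEvent κ (|norm1 (Quot.out e).1 - k|).toNat p)) *
            P (labelPivotal κ n p e) := by
        rw [← Summable.tsum_finsetSum fun _ _ => ENNReal.summable]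
        simp only [Finset.mul_sum, Finset.sum_mul]
    _ ≤ ∑' e : Sym2 (Vertex d), totalWeight d c₀ *
          (2 * ∑ j ∈ Finset.range n, P (armEvent κ j p)) * P (labelPivotal κ n p e) := by
        refine ENNReal.tsum_le_tsum fun e => ?_
        gcongr
        exact sum_shifted_le hanti n (norm1_nonneg _)
    _ ≤ totalWeight d c₀ * (2 * ∑ j ∈ Finset.range n, P (armEvent κ j p)) *
          (totalWeight d c₀ * ∑' f, P (pivotal κ n p f)) := by
        rw [ENNReal.tsum_mul_left]
        gcongr
        exact tsum_measure_labelPivotal_le hκ hP hp hc₀ h1 h2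
    _ = _ := by ring

/-! ### Lower bound on the increments of the one-arm probability -/

theorem openSet_congr_of_le {d κ : ℕ} {U V : Config d} (hU : WellFounded (Below U))
    (hV : WellFounded (Below V)) {p : ℝ} (h : ∀ e, U e ≤ p ∨ V e ≤ p → U e = V e) :
    openSet κ U p = openSet κ V p := by
  have key : ∀ e, IsNNEdge e → U e ≤ p → (Opens κ U e ↔ Opens κ V e) := by
    intro e
    induction e using hU.induction with
    | _ e ih =>
      intro he hep
      rw [opens_iff hU he, opens_iff hV he]
      refine forall₂_congr fun v hv => ?_
      rw [lowerDegree_congr fun f hf hvf _ => ?_]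
      have hlt : U f < U e ↔ V f < V e := by
        rw [← h e (Or.inl hep)]
        constructor <;> intro hlt
        · rwa [← h f (Or.inl (hlt.le.trans hep))]
        · rwa [h f (Or.inr (hlt.le.trans hep))]
      rw [← hlt]
      exact and_congr_right fun hfe => ih f ⟨⟨hf, he, v, hvf, hv⟩, hfe⟩ hf (hfe.le.trans hep)
  ext e
  constructor
  · rintro ⟨he, hep, ho⟩
    exact ⟨he, (h e (Or.inl hep)) ▸ hep, (key e he hep).1 ho⟩
  · rintro ⟨he, hep, ho⟩
    have hep' : U e ≤ p := (h e (Or.inr hep)).symm ▸ hep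
    exact ⟨he, hep', (key e he hep').2 ho⟩

theorem openSet_update_subset {d κ : ℕ} {V : Config d} (hV : WellFounded (Below V)) {p q : ℝ}
    {f : Sym2 (Vertex d)} (hpf : p < V f) (hfq : V f ≤ q)
    (h : ∀ g ∈ edgeNbrs f, g ≠ f → V g ∉ Set.Icc p q) :
    openSet κ (Function.update V f p) p ⊆ openSet κ V q := by
  set W := Function.update V f p with hWdef
  have hW : WellFounded (Below W) := wellFounded_below_update hV f p
  have hWf : W f = p := Function.update_self ..
  have hWg : ∀ g, g ≠ f → W g = V g := fun g hg => Function.update_of_ne hg _ _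
  have key : ∀ e, IsNNEdge e → W e ≤ p → (Opens κ W e ↔ Opens κ V e) := by
    intro e
    induction e using hW.induction with
    | _ e ih =>
      intro he hep
      rw [opens_iff hW he, opens_iff hV he]
      refine forall₂_congr fun v hv => ?_
      rw [lowerDegree_congr fun g hg hvg hge => ?_]
      have hadj : AdjE g e := ⟨hg, he, v, hvg, hv⟩
      have hlt : W g < W e ↔ V g < V e := by
        by_cases hef : e = f
        · subst hef
          rw [hWf, hWg g hge]
          refine ⟨fun hlt => hlt.trans hpf, fun hlt => ?_⟩
          by_contra hcon
          exact h g ((mem_edgeNbrs _ _).2 hadj.symm) hge ⟨not_lt.1 hcon, (hlt.trans_le hfq).le⟩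
        · rw [hWg e hef] at hep ⊢
          by_cases hgf : g = f
          · subst hgf
            rw [hWf]
            have h1 := h e ((mem_edgeNbrs _ _).2 hadj) hef
            have h2 : V e < p := lt_of_le_of_ne hep fun h' =>
              h1 ⟨h'.ge, by linarith⟩
            exact ⟨fun h3 => absurd h3 (not_lt.2 h2.le),
              fun h3 => absurd h3 (not_lt.2 (h2.trans hpf).le)⟩
          · rw [hWg g hgf]
      rw [← hlt]
      exact and_congr_right fun hfe => ih g ⟨hadj, hfe⟩ hg (hfe.le.trans hep)
  rintro e ⟨he, hep, ho⟩
  refine ⟨he, ?_, (key e he hep).1 ho⟩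
  by_cases hef : e = f
  · rwa [hef]
  · rw [hWg e hef] at hep
    linarith

theorem measurableSet_pivotal {d κ n : ℕ} (p : ℝ) (f : Sym2 (Vertex d)) :
    MeasurableSet (pivotal κ n p f) := by
  classical
  have h : ∀ t : ℝ, Measurable fun V : Config d => Function.update V f t := fun t =>
    measurable_pi_iff.2 fun e => by
      by_cases he : e = f
      · subst he; simp
      · simpa [Function.update_of_ne he] using measurable_label e
  exact ((measurableSet_armEvent (κ := κ) (n := n) p).preimage (h 2)).compl.inter
    ((measurableSet_armEvent (κ := κ) (n := n) p).preimage (h p))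

theorem labelLaw_Icc {p q : ℝ} (hp : 0 ≤ p) (hq : q ≤ 1) :
    labelLaw (Set.Icc p q) = ENNReal.ofReal (q - p) := by
  rw [labelLaw, Measure.restrict_apply measurableSet_Icc, Set.inter_eq_left.2
    (Set.Icc_subset_Icc hp hq), Real.volume_Icc]

theorem labelLaw_Ioc {p q : ℝ} (hp : 0 ≤ p) (hq : q ≤ 1) :
    labelLaw (Set.Ioc p q) = ENNReal.ofReal (q - p) := by
  rw [labelLaw, Measure.restrict_apply measurableSet_Ioc, Set.inter_eq_left.2
    (Set.Ioc_subset_Icc_self.trans (Set.Icc_subset_Icc hp hq)), Real.volume_Ioc]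

theorem IsProductUniform.measure_label {d : ℕ} {P : Measure (Config d)} (hP : IsProductUniform P)
    (e : Sym2 (Vertex d)) {I : Set ℝ} (hI : MeasurableSet I) : P {U | U e ∈ I} = labelLaw I := by
  simpa using hP.cyl {e} (fun _ => I) fun _ _ => hI

/-- The label of `f` lies in `(p, q]` and is isolated among the labels of `N`. -/
def stepEvent {d : ℕ} (κ n : ℕ) (p q : ℝ) (N : Finset (Sym2 (Vertex d))) (f : Sym2 (Vertex d)) :
    Set (Config d) :=
  {V | V f ∈ Set.Ioc p q} ∩ ({V | ∀ g ∈ N, g ≠ f → V g ∉ Set.Icc p q} ∩ pivotal κ n p f)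

theorem measurableSet_stepEvent {d κ n : ℕ} (p q : ℝ) (N : Finset (Sym2 (Vertex d)))
    (f : Sym2 (Vertex d)) : MeasurableSet (stepEvent κ n p q N f) := by
  refine (measurable_label f measurableSet_Ioc).inter (.inter ?_ (measurableSet_pivotal p f))
  have : {V : Config d | ∀ g ∈ N, g ≠ f → V g ∉ Set.Icc p q} =
      ⋂ g ∈ N, ⋂ _ : g ≠ f, {V | V g ∈ Set.Icc p q}ᶜ := by
    ext V; simp
  rw [this]
  exact Finset.measurableSet_biInter _ fun g _ => MeasurableSet.iInter fun _ =>
    (measurable_label g measurableSet_Icc).compl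

theorem le_measure_stepEvent {d κ n : ℕ} {P : Measure (Config d)} (hP : IsProductUniform P)
    {p q : ℝ} (hp : 0 ≤ p) (hpq : p ≤ q) (hq : q ≤ 1) (N : Finset (Sym2 (Vertex d)))
    (f : Sym2 (Vertex d)) :
    (q - p) * (P.real (pivotal κ n p f) - N.card * (q - p)) ≤
      P.real (stepEvent κ n p q N f) := by
  classical
  have := hP.1
  set B : Set (Config d) := {V | ∀ g ∈ N, g ≠ f → V g ∉ Set.Icc p q} ∩ pivotal κ n p f with hB
  have h1 : P (stepEvent κ n p q N f) = ENNReal.ofReal (q - p) * P B := by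
    rw [← labelLaw_Ioc hp hq]
    refine hP.label_inter f measurableSet_Ioc fun U t => and_congr ?_ ?_
    · refine forall₃_congr fun g _ hg => ?_
      rw [Function.update_of_ne hg]
    · simp [pivotal, Function.update_idem]
  have h2 : P.real (pivotal κ n p f) ≤ P.real B + N.card * (q - p) := by
    have hsub : pivotal κ n p f ⊆ B ∪ ⋃ g ∈ N, {V | V g ∈ Set.Icc p q} := by
      intro V hV
      by_cases h : ∀ g ∈ N, g ≠ f → V g ∉ Set.Icc p q
      · exact Or.inl ⟨h, hV⟩
      · push Not at h
        obtain ⟨g, hg, -, hgV⟩ := h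
        exact Or.inr (Set.mem_biUnion hg hgV)
    refine (measureReal_mono hsub).trans ((measureReal_union_le _ _).trans ?_)
    gcongr
    refine (measureReal_biUnion_finset_le _ _).trans (le_of_eq ?_)
    rw [Finset.sum_congr rfl fun g _ => show P.real {V : Config d | V g ∈ Set.Icc p q} = q - p by
      rw [measureReal_def, hP.measure_label g measurableSet_Icc, labelLaw_Icc hp hq,
        ENNReal.toReal_ofReal (by linarith)]]
    rw [Finset.sum_const, nsmul_eq_mul]
  rw [measureReal_def, measureReal_def, h1, ENNReal.toReal_mul,
    ENNReal.toReal_ofReal (by linarith)]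
  rw [measureReal_def, measureReal_def] at h2
  exact mul_le_mul_of_nonneg_left (by linarith) (by linarith)

theorem increment_ge {d κ n : ℕ} {P : Measure (Config d)} (hP : IsProductUniform P)
    (F : Finset (Sym2 (Vertex d))) : ∃ C : ℝ, ∀ p q : ℝ, 0 ≤ p → p ≤ q → q ≤ 1 →
    (q - p) * (∑ f ∈ F, P.real (pivotal κ n p f) - C * (q - p)) ≤
      P.real (armEvent κ n q) - P.real (armEvent κ n p) := by
  classical
  have := hP.1
  set N : Finset (Sym2 (Vertex d)) := F ∪ F.biUnion edgeNbrs with hN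
  refine ⟨F.card * N.card, fun p q hp hpq hq => ?_⟩
  have hdisj : (F : Set (Sym2 (Vertex d))).PairwiseDisjoint (stepEvent κ n p q N) := by
    intro f hf g hg hfg
    refine Set.disjoint_left.2 fun V hVf hVg => ?_
    exact hVf.2.1 g (Finset.mem_union_left _ hg) hfg.symm (Set.Ioc_subset_Icc_self hVg.1)
  have hsub : (⋃ f ∈ F, stepEvent κ n p q N f : Set (Config d)) ≤ᵐ[P]
      (armEvent κ n q \ armEvent κ n p : Set (Config d)) := by
    filter_upwards [hP.ae_good] with V hV hVmem
    obtain ⟨f, hf, hVf⟩ := Set.mem_iUnion₂.1 hVmem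
    obtain ⟨⟨h1, h2⟩, h3, h4, h5⟩ := hVf
    refine ⟨h5.mono (openSet_update_subset hV.wf h1 h2 fun g hg hgf => h3 g ?_ hgf), fun h6 => h4 ?_⟩
    · exact Finset.mem_union_right _ (Finset.mem_biUnion.2 ⟨f, hf, hg⟩)
    · have : openSet κ V p = openSet κ (Function.update V f 2) p := by
        refine openSet_congr_of_le hV.wf (wellFounded_below_update hV.wf f 2) fun e he => ?_
        by_cases hef : e = f
        · subst hef
          rw [Function.update_self] at he
          rcases he with he | he <;> linarith
        · rw [Function.update_of_ne hef]
      change Arm n (openSet κ V p) at h6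
      rwa [this] at h6
  have hmono : (armEvent κ n p : Set (Config d)) ⊆ armEvent κ n q :=
    fun V hV => Arm.mono hV (openSet_mono V hpq)
  have h1 : P.real (⋃ f ∈ F, stepEvent κ n p q N f) ≤
      P.real (armEvent κ n q) - P.real (armEvent κ n p) := by
    rw [← measureReal_sdiff hmono (measurableSet_armEvent p)]
    exact ENNReal.toReal_mono (measure_ne_top _ _) (measure_mono_ae hsub)
  rw [measureReal_biUnion_finset hdisj fun f _ => measurableSet_stepEvent p q N f] at h1
  refine le_trans ?_ h1
  refine le_trans (le_of_eq ?_) (Finset.sum_le_sum fun f _ => le_measure_stepEvent hP hp hpq hq N f)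
  rw [← Finset.mul_sum, Finset.sum_sub_distrib, Finset.sum_const, nsmul_eq_mul, mul_assoc]

theorem exists_increment_ge {d κ n : ℕ} {P : Measure (Config d)} (hP : IsProductUniform P)
    {p m : ℝ} (hp : 0 ≤ p) (hm : ENNReal.ofReal m < ∑' f, P (pivotal κ n p f)) :
    ∃ δ > 0, ∀ q, p < q → q < p + δ → q ≤ 1 →
      (q - p) * m ≤ P.real (armEvent κ n q) - P.real (armEvent κ n p) := by
  have := hP.1
  rw [ENNReal.tsum_eq_iSup_sum, lt_iSup_iff] at hm
  obtain ⟨F, hF⟩ := hm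
  have hF' : m < ∑ f ∈ F, P.real (pivotal κ n p f) := by
    by_contra hcon
    refine absurd hF (not_lt.2 ((le_of_eq ?_).trans (ENNReal.ofReal_le_ofReal (not_lt.1 hcon))))
    rw [ENNReal.ofReal_sum_of_nonneg fun _ _ => measureReal_nonneg]
    exact Finset.sum_congr rfl fun f _ => (ofReal_measureReal).symm
  obtain ⟨C, hC⟩ := increment_ge (κ := κ) (n := n) hP F
  set D := ∑ f ∈ F, P.real (pivotal κ n p f) - m with hD
  have hD0 : 0 < D := sub_pos.2 hF'
  refine ⟨D / (|C| + 1), by positivity, fun q h1 h2 h3 => ?_⟩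
  refine le_trans (mul_le_mul_of_nonneg_left ?_ (sub_nonneg.2 h1.le)) (hC p q hp h1.le h3)
  have h4 : (q - p) * (|C| + 1) < D := by
    rw [← lt_div_iff₀ (by positivity)]; linarith
  have h5 : C * (q - p) ≤ |C| * (q - p) :=
    mul_le_mul_of_nonneg_right (le_abs_self C) (by linarith)
  linarith

/-! ### Integrating a family of differential inequalities -/

open Filter Topology in
theorem le_of_locally_le {G : ℝ → ℝ} {a b : ℝ} (hab : a ≤ b)
    (hr : ∀ p ∈ Set.Ico a b, ∃ δ > 0, ∀ q, p < q → q < p + δ → q ≤ b → G p ≤ G q)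
    (hl : ∀ p ∈ Set.Ioc a b, ∀ m, (∃ᶠ q in 𝓝[<] p, a ≤ q ∧ m ≤ G q) → m ≤ G p) :
    G a ≤ G b := by
  set S : Set ℝ := {p | p ∈ Set.Icc a b ∧ G a ≤ G p} with hS
  have haS : a ∈ S := ⟨⟨le_rfl, hab⟩, le_rfl⟩
  have hbdd : BddAbove S := ⟨b, fun x hx => hx.1.2⟩
  set s := sSup S with hs
  have has : a ≤ s := le_csSup hbdd haS
  have hsb : s ≤ b := csSup_le ⟨a, haS⟩ fun x hx => hx.1.2
  have hsS : G a ≤ G s := by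
    by_cases h : s ∈ S
    · exact h.2
    · have has' : a < s := lt_of_le_of_ne has fun h' => h (h' ▸ haS)
      refine hl s ⟨has', hsb⟩ _ ?_
      rw [frequently_iff]
      intro W hW
      obtain ⟨l, hl, hlW⟩ := (mem_nhdsLT_iff_exists_Ioo_subset).1 hW
      obtain ⟨x, hx, hlx⟩ := exists_lt_of_lt_csSup ⟨a, haS⟩ (show l < sSup S from hl)
      have hxs : x < s := lt_of_le_of_ne (le_csSup hbdd hx) fun h' => h (h' ▸ hx)
      exact ⟨x, hlW ⟨hlx, hxs⟩, hx.1.1, hx.2⟩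
  rcases hsb.eq_or_lt with h | h
  · rwa [← h]
  · exfalso
    obtain ⟨δ, hδ, H⟩ := hr s ⟨has, h⟩
    obtain ⟨q, hq1, hq2⟩ := exists_between (lt_min h (lt_add_of_pos_right s hδ))
    have hqS : q ∈ S := ⟨⟨has.trans hq1.le, (hq2.trans_le (min_le_left _ _)).le⟩,
      hsS.trans (H q hq1 (hq2.trans_le (min_le_right _ _)) (hq2.trans_le (min_le_left _ _)).le)⟩
    exact absurd (le_csSup hbdd hqS) (not_le.2 hq1)

open Filter Topology in
theorem mul_exp_le_of_dini {g : ℝ → ℝ} {a b K : ℝ} (hab : a ≤ b) (hK : 0 ≤ K)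
    (hg : MonotoneOn g (Set.Icc a b)) (hg0 : ∀ p ∈ Set.Icc a b, 0 ≤ g p)
    (h : ∀ p ∈ Set.Ico a b, ∃ δ > 0, ∀ q, p < q → q < p + δ → q ≤ b →
      (q - p) * (K * g p) ≤ g q - g p) : g a * Real.exp (K / 2 * (b - a)) ≤ g b := by
  have key : g a * Real.exp (-(K / 2 * a)) ≤ g b * Real.exp (-(K / 2 * b)) := by
    refine le_of_locally_le (G := fun p => g p * Real.exp (-(K / 2 * p))) hab ?_ ?_
    · intro p hp
      obtain ⟨δ, hδ, H⟩ := h p hp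
      refine ⟨min δ (1 / (K + 1)), lt_min hδ (by positivity), fun q hpq hq hqb => ?_⟩
      have hx := H q hpq (hq.trans_le (by gcongr; exact min_le_left _ _)) hqb
      have hK1 : (q - p) * (K + 1) ≤ 1 := by
        have : q - p ≤ 1 / (K + 1) := by linarith [min_le_right δ (1 / (K + 1))]
        rwa [le_div_iff₀ (by positivity)] at this
      have hgp := hg0 p (Set.Ico_subset_Icc_self hp)
      set x := K / 2 * (q - p) with hxdef
      have hx0 : 0 ≤ x := by have := sub_pos.2 hpq; positivity
      have hx1 : x ≤ 1 / 2 := by nlinarith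
      have hexp : Real.exp x ≤ 1 + 2 * x := by
        have h1 := Real.one_sub_le_exp_neg x
        have h2 : Real.exp x * Real.exp (-x) = 1 := by rw [← Real.exp_add]; simp
        have h3 := Real.exp_pos x
        nlinarith
      have e : Real.exp (-(K / 2 * p)) = Real.exp x * Real.exp (-(K / 2 * q)) := by
        rw [← Real.exp_add]; congr 1; rw [hxdef]; ring
      change g p * Real.exp (-(K / 2 * p)) ≤ g q * Real.exp (-(K / 2 * q))
      rw [e, ← mul_assoc]
      refine mul_le_mul_of_nonneg_right ?_ (Real.exp_pos _).le
      calc g p * Real.exp x ≤ g p * (1 + 2 * x) := by gcongr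
        _ ≤ g q := by rw [hxdef]; linarith
    · intro p hp m hm
      have hev : ∀ᶠ q in 𝓝[<] p, q < p := self_mem_nhdsWithin
      have hcont : Tendsto (fun q => g p * Real.exp (-(K / 2 * q))) (𝓝[<] p)
          (𝓝 (g p * Real.exp (-(K / 2 * p)))) :=
        ((by fun_prop : Continuous fun q : ℝ => g p * Real.exp (-(K / 2 * q))).tendsto p).mono_left
          nhdsWithin_le_nhds
      refine ge_of_tendsto_of_frequently hcont ((hm.and_eventually hev).mono fun q hq => ?_)
      refine hq.1.2.trans (mul_le_mul_of_nonneg_right ?_ (Real.exp_pos _).le)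
      exact hg ⟨hq.1.1, hq.2.le.trans hp.2⟩ ⟨hp.1.le, hp.2⟩ hq.2.le
  have := mul_le_mul_of_nonneg_right key (Real.exp_pos (K / 2 * b)).le
  rw [mul_assoc, mul_assoc, ← Real.exp_add, ← Real.exp_add] at this
  have e : -(K / 2 * a) + K / 2 * b = K / 2 * (b - a) := by ring
  rw [e] at this
  simpa using this

open Filter Topology in
theorem add_mul_le_of_dini {g : ℝ → ℝ} {a b K : ℝ} (hab : a ≤ b)
    (hg : MonotoneOn g (Set.Icc a b))
    (h : ∀ p ∈ Set.Ico a b, ∃ δ > 0, ∀ q, p < q → q < p + δ → q ≤ b →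
      (q - p) * K ≤ g q - g p) : g a + K * (b - a) ≤ g b := by
  have key : g a - K * a ≤ g b - K * b := by
    refine le_of_locally_le (G := fun p => g p - K * p) hab ?_ ?_
    · intro p hp
      obtain ⟨δ, hδ, H⟩ := h p hp
      refine ⟨δ, hδ, fun q h1 h2 h3 => ?_⟩
      have := H q h1 h2 h3
      change g p - K * p ≤ g q - K * q
      linarith
    · intro p hp m hm
      have hev : ∀ᶠ q in 𝓝[<] p, q < p := self_mem_nhdsWithin
      have hcont : Tendsto (fun q => g p - K * q) (𝓝[<] p) (𝓝 (g p - K * p)) :=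
        ((by fun_prop : Continuous fun q : ℝ => g p - K * q).tendsto p).mono_left
          nhdsWithin_le_nhds
      refine ge_of_tendsto_of_frequently hcont ((hm.and_eventually hev).mono fun q hq => ?_)
      have := hg ⟨hq.1.1, hq.2.le.trans hp.2⟩ ⟨hp.1.le, hp.2⟩ hq.2.le
      linarith [hq.1.2]
  linarith

theorem log_sum_le {u : ℕ → ℝ} (h0 : u 0 = 1) (hu : ∀ n, 0 ≤ u n) (n : ℕ) :
    Real.log (∑ j ∈ Finset.range (n + 1), u j) ≤
      ∑ i ∈ Finset.range n, u (i + 1) / ∑ j ∈ Finset.range (i + 1), u j := by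
  induction n with
  | zero => simp [h0]
  | succ n ih =>
    rw [Finset.sum_range_succ _ n, Finset.sum_range_succ _ (n + 1)]
    set S := ∑ j ∈ Finset.range (n + 1), u j with hS
    have hS1 : 1 ≤ S := by
      rw [← h0]
      exact Finset.single_le_sum (f := u) (fun i _ => hu i) (Finset.mem_range.2 n.succ_pos)
    have hpos : 0 < S := by linarith
    have h1 : S + u (n + 1) = S * (1 + u (n + 1) / S) := by field_simp
    have h2 : 0 ≤ u (n + 1) / S := div_nonneg (hu _) hpos.le
    rw [h1, Real.log_mul (by positivity) (by positivity)]
    have h3 := Real.log_le_sub_one_of_pos (show 0 < 1 + u (n + 1) / S by positivity)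
    linarith

theorem sum_inv_le (n : ℕ) : ∑ i ∈ Finset.range n, (1 : ℝ) / (i + 1) ≤ 1 + Real.log n := by
  have := harmonic_le_one_add_log n
  simpa [harmonic] using this

theorem exists_weighted_sum_le {u : ℕ → ℝ} (hu1 : ∀ n, u n ≤ 1)
    (hlim : Filter.Tendsto u Filter.atTop (nhds 0)) {ε : ℝ} (hε : 0 < ε) :
    ∃ C, ∀ n ≥ 1, ∑ i ∈ Finset.range n, u (i + 1) / (i + 1) ≤ C + ε * Real.log n := by
  obtain ⟨N, hN⟩ := Filter.eventually_atTop.1 (hlim.eventually (gt_mem_nhds hε))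
  refine ⟨N + ε, fun n hn => ?_⟩
  have h : ∀ i ∈ Finset.range n, u (i + 1) / (i + 1) ≤
      (if i < N then 1 else 0) + ε * ((1 : ℝ) / (i + 1)) := by
    intro i _
    have hpos : (0 : ℝ) < i + 1 := by positivity
    split_ifs with hi
    · have : u (i + 1) / (i + 1) ≤ 1 := by
        rw [div_le_one hpos]; linarith [hu1 (i + 1), (Nat.cast_nonneg i : (0 : ℝ) ≤ i)]
      have : 0 ≤ ε * ((1 : ℝ) / (i + 1)) := by positivity
      linarith
    · rw [zero_add, mul_one_div]
      exact div_le_div_of_nonneg_right (hN (i + 1) (by omega)).le hpos.le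
  refine (Finset.sum_le_sum h).trans ?_
  rw [Finset.sum_add_distrib, ← Finset.mul_sum]
  have h1 : ∑ i ∈ Finset.range n, (if i < N then (1 : ℝ) else 0) ≤ N := by
    rw [← Finset.sum_filter, Finset.sum_const, nsmul_eq_mul, mul_one]
    exact_mod_cast (Finset.card_le_card fun i hi => Finset.mem_range.2
      (Finset.mem_filter.1 hi).2).trans (Finset.card_range N).le
  have h2 := mul_le_mul_of_nonneg_left (sum_inv_le n) hε.le
  linarith

theorem exponential_decay_of_dini {θ : ℕ → ℝ → ℝ} {a b c : ℝ} (hab : a < b) (hc : 0 < c)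
    (h0 : ∀ p ∈ Set.Icc a b, θ 0 p = 1) (hpos : ∀ n, ∀ p, 0 ≤ θ n p) (hle : ∀ n, ∀ p, θ n p ≤ 1)
    (hmono : ∀ n, MonotoneOn (θ n) (Set.Icc a b))
    (hlim : Filter.Tendsto (fun n => θ n b) Filter.atTop (nhds 0))
    (hdini : ∀ n ≥ 1, ∀ p ∈ Set.Ico a b, ∃ δ > 0, ∀ q, p < q → q < p + δ → q ≤ b →
      (q - p) * (c * n * θ n p / ∑ j ∈ Finset.range n, θ j p) ≤ θ n q - θ n p) :
    ∃ α > 0, ∀ n : ℕ, 1 ≤ n → θ n a ≤ Real.exp (-(α * n)) := by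
  have sum_ge : ∀ n ≥ 1, ∀ p ∈ Set.Icc a b, 1 ≤ ∑ j ∈ Finset.range n, θ j p := by
    intro n hn p hp
    rw [← h0 p hp]
    exact Finset.single_le_sum (f := fun j => θ j p) (fun i _ => hpos i p) (Finset.mem_range.2 hn)
  have decay : ∀ r s, a ≤ r → r < s → s ≤ b → ∀ n ≥ 1, ∀ M,
      (∑ j ∈ Finset.range n, θ j s) ≤ M → θ n r ≤ Real.exp (-(c * n / M / 2 * (s - r))) := by
    intro r s har hrs hsb n hn M hM
    have hM0 : 0 < M := by linarith [sum_ge n hn s ⟨har.trans hrs.le, hsb⟩]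
    have key := mul_exp_le_of_dini (g := θ n) (K := c * n / M) hrs.le (by positivity)
      ((hmono n).mono (Set.Icc_subset_Icc har hsb)) (fun p _ => hpos n p) (by
        intro p hp
        obtain ⟨δ, hδ, H⟩ := hdini n hn p ⟨har.trans hp.1, hp.2.trans_le hsb⟩
        refine ⟨δ, hδ, fun q h1 h2 h3 => le_trans ?_ (H q h1 h2 (h3.trans hsb))⟩
        refine mul_le_mul_of_nonneg_left ?_ (sub_nonneg.2 h1.le)
        have h4 : ∑ j ∈ Finset.range n, θ j p ≤ M := le_trans (Finset.sum_le_sum fun j _ =>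
          hmono j ⟨har.trans hp.1, hp.2.le.trans hsb⟩ ⟨har.trans hrs.le, hsb⟩ hp.2.le) hM
        have h5 := sum_ge n hn p ⟨har.trans hp.1, hp.2.le.trans hsb⟩
        have h6 := hpos n p
        rw [div_mul_eq_mul_div]
        exact div_le_div_of_nonneg_left (by positivity) (by linarith) h4)
    rw [Real.exp_neg, ← one_div, le_div_iff₀ (Real.exp_pos _)]
    exact key.trans (hle n s)
  set r := a + (b - a) / 3 with hr
  set s := a + 2 * (b - a) / 3 with hs
  have har : a < r := by linarith
  have hrs : r < s := by linarith
  have hsb : s < b := by linarith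
  have hs_mem : s ∈ Set.Icc a b := ⟨by linarith, hsb.le⟩
  obtain ⟨C, hC⟩ : ∃ C > 0, ∀ n ≥ 1, ∑ j ∈ Finset.range n, θ j s ≤ C * Real.sqrt n := by
    have hcb : 0 < c * (b - s) := mul_pos hc (by linarith)
    obtain ⟨C, hC⟩ := exists_weighted_sum_le (u := fun n => θ n b) (fun n => hle n b) hlim
      (ε := c * (b - s) / 2) (by positivity)
    refine ⟨Real.exp (C / (c * (b - s))), Real.exp_pos _, fun n hn => ?_⟩
    set L := Real.log (∑ j ∈ Finset.range (n + 1), θ j s) with hL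
    have key := add_mul_le_of_dini (K := c * L)
      (g := fun p => ∑ i ∈ Finset.range n, θ (i + 1) p / (i + 1)) hsb.le
      (by
        intro p hp q hq hpq
        refine Finset.sum_le_sum fun i _ => div_le_div_of_nonneg_right ?_ (by positivity)
        exact hmono _ ⟨hs_mem.1.trans hp.1, hp.2⟩ ⟨hs_mem.1.trans hq.1, hq.2⟩ hpq)
      (by
        intro p hp
        have hp' : p ∈ Set.Ico a b := ⟨hs_mem.1.trans hp.1, hp.2⟩
        have : ∀ i : ℕ, ∃ δ > 0, ∀ q, p < q → q < p + δ → q ≤ b →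
            (q - p) * (c * (θ (i + 1) p / ∑ j ∈ Finset.range (i + 1), θ j p)) ≤
              θ (i + 1) q / (i + 1) - θ (i + 1) p / (i + 1) := by
          intro i
          obtain ⟨δ, hδ, H⟩ := hdini (i + 1) (by omega) p hp'
          refine ⟨δ, hδ, fun q h1 h2 h3 => ?_⟩
          have := H q h1 h2 h3
          have hi : (0 : ℝ) < i + 1 := by positivity
          rw [← sub_div, le_div_iff₀ hi]
          refine le_trans (le_of_eq ?_) this
          push_cast
          ring
        choose δ hδ H using this
        refine ⟨(Finset.range (n + 1)).inf' ⟨0, by simp⟩ δ,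
          (Finset.lt_inf'_iff _).2 fun i _ => hδ i, fun q h1 h2 h3 => ?_⟩
        have hsum : L ≤ ∑ i ∈ Finset.range n, θ (i + 1) p / ∑ j ∈ Finset.range (i + 1), θ j p := by
          refine le_trans ?_ (log_sum_le (h0 p ⟨hp'.1, hp'.2.le⟩) (fun n => hpos n p) n)
          refine Real.log_le_log (by linarith [sum_ge (n + 1) (by omega) s hs_mem]) ?_
          exact Finset.sum_le_sum fun j _ => hmono j hs_mem ⟨hp'.1, hp'.2.le⟩ hp.1
        calc (q - p) * (c * L) ≤ (q - p) * (c * ∑ i ∈ Finset.range n,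
              θ (i + 1) p / ∑ j ∈ Finset.range (i + 1), θ j p) := by
              refine mul_le_mul_of_nonneg_left ?_ (sub_nonneg.2 h1.le)
              exact mul_le_mul_of_nonneg_left hsum hc.le
          _ = ∑ i ∈ Finset.range n, (q - p) * (c *
              (θ (i + 1) p / ∑ j ∈ Finset.range (i + 1), θ j p)) := by
              rw [Finset.mul_sum, Finset.mul_sum]
          _ ≤ ∑ i ∈ Finset.range n, (θ (i + 1) q / (i + 1) - θ (i + 1) p / (i + 1)) := by
              refine Finset.sum_le_sum fun i hi => H i q h1 (h2.trans_le ?_) h3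
              gcongr
              exact Finset.inf'_le _ (Finset.mem_range.2 (by
                have := Finset.mem_range.1 hi; omega))
          _ = _ := by rw [Finset.sum_sub_distrib])
    have hT := hC n hn
    have hT0 : 0 ≤ ∑ i ∈ Finset.range n, θ (i + 1) s / (i + 1) :=
      Finset.sum_nonneg fun i _ => div_nonneg (hpos _ _) (by positivity)
    have hLle : L ≤ C / (c * (b - s)) + Real.log n / 2 := by
      have : L * (c * (b - s)) ≤ C + c * (b - s) / 2 * Real.log n := by
        linarith
      rw [← le_div_iff₀ hcb] at this
      have hne := (sub_pos.2 hsb).ne'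
      refine this.trans (le_of_eq ?_)
      field_simp
    have hn0 : (0 : ℝ) < n := by exact_mod_cast hn
    calc ∑ j ∈ Finset.range n, θ j s ≤ ∑ j ∈ Finset.range (n + 1), θ j s := by
          rw [Finset.sum_range_succ]; linarith [hpos n s]
      _ = Real.exp L := (Real.exp_log (by linarith [sum_ge (n + 1) (by omega) s hs_mem])).symm
      _ ≤ Real.exp (C / (c * (b - s)) + Real.log n / 2) := Real.exp_le_exp.2 hLle
      _ = _ := by
          rw [Real.exp_add, Real.sqrt_eq_rpow, Real.rpow_def_of_pos hn0]
          congr 2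
          ring
  obtain ⟨hC0, hC⟩ := hC
  obtain ⟨M, hM⟩ : ∃ M, ∀ n, ∑ j ∈ Finset.range n, θ j r ≤ M := by
    set k := c * (s - r) / (2 * C) with hk
    have hk0 : 0 < k := by have := sub_pos.2 hrs; positivity
    have hsummable : Summable fun n => θ n r := by
      refine Summable.of_norm_bounded_eventually_nat
        (g := fun n : ℕ => 24 / k ^ 4 * (1 / (n : ℝ) ^ 2))
        ((Real.summable_one_div_nat_pow.2 one_lt_two).mul_left _) ?_
      filter_upwards [Filter.eventually_ge_atTop 1] with n hn
      have hn0 : (0 : ℝ) < n := by exact_mod_cast hn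
      have hsq : 0 < Real.sqrt n := Real.sqrt_pos.2 hn0
      rw [Real.norm_of_nonneg (hpos n r)]
      refine (decay r s har.le hrs hsb.le n hn _ (hC n hn)).trans ?_
      have e : c * n / (C * Real.sqrt n) / 2 * (s - r) = k * Real.sqrt n := by
        have : (n : ℝ) = Real.sqrt n * Real.sqrt n := (Real.mul_self_sqrt hn0.le).symm
        rw [hk, div_div, div_mul_eq_mul_div, div_mul_eq_mul_div,
          div_eq_div_iff (by positivity) (by positivity)]
        nth_rewrite 1 [this]
        ring
      rw [e, Real.exp_neg]
      have h4 := Real.pow_div_factorial_le_exp (k * Real.sqrt n) (by positivity) 4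
      have h5 : (k * Real.sqrt n) ^ 4 = k ^ 4 * (n : ℝ) ^ 2 := by
        rw [mul_pow]
        congr 1
        rw [show (4 : ℕ) = 2 * 2 from rfl, pow_mul, Real.sq_sqrt hn0.le]
      rw [h5, show ((Nat.factorial 4 : ℕ) : ℝ) = 24 by norm_num [Nat.factorial]] at h4
      refine (inv_anti₀ (by positivity) h4).trans (le_of_eq ?_)
      field_simp
    exact ⟨∑' n, θ n r, fun n => hsummable.sum_le_tsum _ fun i _ => hpos i r⟩
  have hM0 : 0 < M := by
    have := sum_ge 1 le_rfl r ⟨har.le, (hrs.trans hsb).le⟩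
    linarith [hM 1]
  refine ⟨c / M / 2 * (r - a), by have := sub_pos.2 har; positivity, fun n hn => ?_⟩
  refine (decay a r le_rfl har (hrs.trans hsb).le n hn M (hM n)).trans (le_of_eq ?_)
  congr 1
  ring

/-! ### Infinite clusters contain infinite paths -/

theorem exists_ray {V : Type*} (G : SimpleGraph V) (hfin : ∀ v, (G.neighborSet v).Finite) (o : V)
    (hinf : {w | G.Reachable o w}.Infinite) :
    ∃ x : ℕ → V, x 0 = o ∧ (∀ i, G.Adj (x i) (x (i + 1))) ∧ Function.Injective x := by
  set D : V → Set V := fun v => {w | G.Reachable v w ∧ G.dist o w = G.dist o v + G.dist v w} with hD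
  set T : Set V := {v | G.Reachable o v ∧ (D v).Infinite} with hT
  have hstep : ∀ v : T, ∃ w : T, G.Adj v w ∧ G.dist o (w : V) = G.dist o (v : V) + 1 := by
    rintro ⟨v, hov, hv⟩
    have hsub : D v \ {v} ⊆ ⋃ w ∈ {w ∈ G.neighborSet v | G.dist o w = G.dist o v + 1}, D w := by
      rintro w ⟨⟨hvw, hdist⟩, hne⟩
      obtain ⟨q, hq⟩ := hvw.exists_walk_length_eq_dist
      cases q with
      | nil => exact absurd rfl hne
      | @cons _ u _ hvu q =>
        rw [SimpleGraph.Walk.length_cons] at hq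
        have h1 : G.dist u w ≤ q.length := SimpleGraph.dist_le q
        obtain ⟨r, hr⟩ := hov.exists_walk_length_eq_dist
        have h2 : G.dist o u ≤ G.dist o v + 1 := by
          rw [← hr, ← SimpleGraph.Walk.length_concat r hvu]
          exact SimpleGraph.dist_le _
        obtain ⟨s, hs⟩ := (hov.trans hvu.reachable).exists_walk_length_eq_dist
        obtain ⟨t, ht⟩ := q.reachable.exists_walk_length_eq_dist
        have h3 : G.dist o w ≤ G.dist o u + G.dist u w := by
          rw [← hs, ← ht, ← SimpleGraph.Walk.length_append]
          exact SimpleGraph.dist_le _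
        exact Set.mem_biUnion (x := u) ⟨hvu, by omega⟩ ⟨q.reachable, by omega⟩
    have hinf' := (hv.sdiff (Set.finite_singleton v)).mono hsub
    by_contra hcon
    refine hinf' (Set.Finite.biUnion ((hfin v).subset fun w hw => hw.1) fun w hw => ?_)
    by_contra hw'
    exact hcon ⟨⟨w, hov.trans (SimpleGraph.Adj.reachable hw.1), hw'⟩, hw.1, hw.2⟩
  choose f hf1 hf2 using hstep
  have ho : o ∈ T := ⟨SimpleGraph.Reachable.refl _, hinf.mono fun w hw => ⟨hw, by simp⟩⟩
  set y : ℕ → T := fun i => f^[i] ⟨o, ho⟩ with hy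
  have hy1 : ∀ i, y (i + 1) = f (y i) := fun i => Function.iterate_succ_apply' _ _ _
  have hy2 : ∀ i, G.dist o (y i : V) = i := by
    intro i
    induction i with
    | zero => simp [hy]
    | succ i ih => rw [hy1, hf2, ih]
  refine ⟨fun i => y i, rfl, fun i => ?_, fun i j hij => ?_⟩
  · change G.Adj (y i) (y (i + 1))
    rw [hy1]
    exact hf1 _
  · rw [← hy2 i, ← hy2 j]
    exact congrArg _ hij

theorem finite_neighborSet_openGraph {d κ : ℕ} (U : Config d) (p : ℝ) (v : Vertex d) :
    ((openGraph κ U p).neighborSet v).Finite := by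
  refine Set.Finite.of_finite_image (f := fun w => s(v, w))
    ((Finset.finite_toSet (edgesAt v)).subset ?_) fun a _ b _ h => Sym2.congr_right.1 h
  rintro _ ⟨w, hw, rfl⟩
  exact (mem_edgesAt _ _).2 ⟨(openGraph_adj.1 hw).1, Sym2.mem_mk_left _ _⟩

theorem Good.zeroToInf {d κ : ℕ} {U : Config d} (hU : Good U) {p q : ℝ} (hpq : p ≤ q)
    (h : ∀ n, U ∈ armEvent κ n p) : zeroToInf κ U q := by
  obtain ⟨x, h0, hadj, hinj⟩ := exists_ray (openGraph κ U p) (finite_neighborSet_openGraph U p) 0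
    (by
      choose b hb hr using h
      refine Set.infinite_of_injective_forall_mem (f := b) (fun i j hij => ?_) hr
      have := congrArg norm1 hij
      rw [hb, hb] at this
      exact_mod_cast this)
  have hx := fun i => openGraph_adj.1 (hadj i)
  exact ⟨x, h0, fun i => (isNNEdge_mk _ _).1 (hx i).1, hinj,
    fun i => (openEdge_iff hU.wf _ _).2 (openSet_mono U hpq (hx i))⟩

theorem tendsto_armEvent {d κ : ℕ} {P : Measure (Config d)} (hP : IsProductUniform P) {p q : ℝ}
    (hpq : p ≤ q) (h : thetaInf κ P q = 0) :
    Filter.Tendsto (fun n => P.real (armEvent κ n p)) Filter.atTop (nhds 0) := by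
  have := hP.1
  have h0 : P (⋂ n, armEvent κ n p) = 0 := by
    have hz : P {U | U ∈ goodConfigs d ∧ zeroToInf κ U q} = 0 := by
      rcases (ENNReal.toReal_eq_zero_iff _).1 h with h | h
      · exact h
      · exact absurd h (measure_ne_top _ _)
    refine le_antisymm (le_trans (measure_mono_ae ?_) hz.le) zero_le
    filter_upwards [hP.ae_good] with U hU hmem
    exact ⟨hU.mem_goodConfigs, hU.zeroToInf hpq (Set.mem_iInter.1 hmem)⟩
  have := tendsto_measure_iInter_atTop (μ := P) (s := fun n => armEvent κ n p)
    (fun n => (measurableSet_armEvent p).nullMeasurableSet) (armEvent_anti p)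
    ⟨0, measure_ne_top _ _⟩
  rw [h0] at this
  exact (ENNReal.tendsto_toReal ENNReal.zero_ne_top).comp this

theorem armEvent_zero {d κ : ℕ} (p : ℝ) : armEvent (d := d) κ 0 p = Set.univ :=
  Set.eq_univ_of_forall fun _ => ⟨0, norm1_zero, SimpleGraph.Reachable.refl _⟩

theorem labelLaw_Iic {p : ℝ} (hp1 : p ≤ 1) :
    labelLaw (Set.Iic p) = ENNReal.ofReal p := by
  have : Set.Iic p ∩ Set.Icc 0 1 = Set.Icc 0 p := by
    ext x
    simp only [Set.mem_inter_iff, Set.mem_Iic, Set.mem_Icc]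
    constructor
    · exact fun h => ⟨h.2.1, h.1⟩
    · exact fun h => ⟨h.2, h.1, h.2.trans hp1⟩
  rw [labelLaw, Measure.restrict_apply measurableSet_Iic, this, Real.volume_Icc, sub_zero]

theorem labelLaw_Ioi {p : ℝ} (hp : 0 ≤ p) : labelLaw (Set.Ioi p) = ENNReal.ofReal (1 - p) := by
  have : Set.Ioi p ∩ Set.Icc 0 1 = Set.Ioc p 1 := by
    ext x
    simp only [Set.mem_inter_iff, Set.mem_Ioi, Set.mem_Icc, Set.mem_Ioc]
    constructor
    · exact fun h => ⟨h.1, h.2.2⟩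
    · exact fun h => ⟨h.1, hp.trans h.1.le, h.2⟩
  rw [labelLaw, Measure.restrict_apply measurableSet_Ioi, this, Real.volume_Ioc]

theorem measure_armEvent_one_lt {d κ : ℕ} {P : Measure (Config d)} (hP : IsProductUniform P)
    {p : ℝ} (hp : 0 ≤ p) (hp1 : p < 1) : P.real (armEvent κ 1 p) < 1 := by
  have := hP.1
  have hpos : 0 < P {U | ∀ e ∈ edgesAt (0 : Vertex d), U e ∈ Set.Ioi p} := by
    rw [hP.cyl _ (fun _ => Set.Ioi p) fun _ _ => measurableSet_Ioi]
    simp only [labelLaw_Ioi hp]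
    exact pos_iff_ne_zero.2 (Finset.prod_ne_zero_iff.2 fun _ _ => by simpa using hp1)
  have hsub : {U | ∀ e ∈ edgesAt (0 : Vertex d), U e ∈ Set.Ioi p} ⊆ (armEvent κ 1 p)ᶜ := by
    rintro U hU ⟨b, hb, ⟨w⟩⟩
    cases w with
    | nil => simp [norm1_zero] at hb
    | cons h _ =>
      have h1 := openGraph_adj.1 h
      exact absurd h1.2.1 (not_le.2 (hU _ ((mem_edgesAt _ _).2 ⟨h1.1, Sym2.mem_mk_left _ _⟩)))
  have h2 : 0 < P.real (armEvent κ 1 p)ᶜ :=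
    ENNReal.toReal_pos (hpos.trans_le (measure_mono hsub)).ne' (measure_ne_top _ _)
  rw [probReal_compl_eq_one_sub (measurableSet_armEvent p)] at h2
  linarith

theorem theta_le {d κ n : ℕ} {P : Measure (Config d)} (hP : IsProductUniform P) {p q : ℝ}
    (hpq : p ≤ q) : theta κ P n p ≤ P.real (armEvent κ n q) := by
  have := hP.1
  refine ENNReal.toReal_mono (measure_ne_top _ _) (measure_mono_ae ?_)
  filter_upwards [hP.ae_good] with U hU hmem
  obtain ⟨-, b, hb, k, x, hx, h0, hk, ho⟩ := hmem
  refine ⟨b, hb, ?_⟩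
  have walk : ∀ m ≤ k, (openGraph κ U q).Reachable (x 0) (x m) := by
    intro m
    induction m with
    | zero => exact fun _ => SimpleGraph.Reachable.refl _
    | succ m ih =>
      exact fun hm => (ih (by omega)).trans (SimpleGraph.Adj.reachable
        (openGraph_adj.2 (openSet_mono U hpq ((openEdge_iff hU.wf _ _).1 (ho m hm)))))
  have := walk k le_rfl
  rwa [h0, hk] at this

theorem theta_eq_zero {d κ n : ℕ} (P : Measure (Config d)) (hn : 1 ≤ n) {p : ℝ} (hp : p < 0) :
    theta κ P n p = 0 := by
  have : {U | U ∈ goodConfigs d ∧ ∃ b, norm1 b = (n : ℤ) ∧ openConn κ U p 0 b} = ∅ := by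
    refine Set.eq_empty_of_forall_notMem ?_
    rintro U ⟨hU, b, hb, k, x, hx, h0, hk, ho⟩
    rcases Nat.eq_zero_or_pos k with rfl | hk0
    · rw [← hk, h0, norm1_zero] at hb
      omega
    · obtain ⟨h1, h2, -⟩ := ho 0 hk0
      linarith [(hU.1 _ h1).1]
  rw [theta, this, measure_empty, ENNReal.toReal_zero]

theorem armEvent_dini {d κ : ℕ} (hκ : 2 ≤ κ) {P : Measure (Config d)} (hP : IsProductUniform P)
    {a b : ℝ} (ha : 0 < a) (hab : a < b) (hb : b < 1) :
    ∃ c > 0, ∀ n ≥ 1, ∀ p ∈ Set.Ico a b, ∃ δ > 0, ∀ q, p < q → q < p + δ → q ≤ b →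
      (q - p) * (c * n * P.real (armEvent κ n p) /
        ∑ j ∈ Finset.range n, P.real (armEvent κ j p)) ≤
      P.real (armEvent κ n q) - P.real (armEvent κ n p) := by
  have := hP.1
  set c₀ : ENNReal := ENNReal.ofReal (min a (1 - b)) with hc₀
  have hc₀0 : c₀ ≠ 0 := by
    rw [hc₀, ne_eq, ENNReal.ofReal_eq_zero, not_le]
    exact lt_min ha (by linarith)
  set W := (totalWeight d c₀).toReal with hW
  set t := P.real (armEvent κ 1 b) with ht
  have ht1 : 0 < 1 - t := sub_pos.2 (measure_armEvent_one_lt hP (ha.trans hab).le hb)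
  refine ⟨(1 - t) / (2 * W ^ 2 + 1), by positivity, fun n hn p hp => ?_⟩
  set c := (1 - t) / (2 * W ^ 2 + 1) with hc
  have hc0 : 0 < c := by positivity
  have hp0 : 0 ≤ p := ha.le.trans hp.1
  set x := P.real (armEvent κ n p) with hx
  set S := ∑ j ∈ Finset.range n, P.real (armEvent κ j p) with hS
  rcases measureReal_nonneg.eq_or_lt' (a := x) with h0 | h0
  · exact ⟨1, one_pos, fun q _ _ _ => by simp [h0]⟩
  have hS1 : 1 ≤ S := by
    have : P.real (armEvent κ 0 p) = 1 := by rw [armEvent_zero]; simp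
    rw [← this]
    exact Finset.single_le_sum (f := fun j => P.real (armEvent κ j p))
      (fun _ _ => measureReal_nonneg) (Finset.mem_range.2 hn)
  obtain ⟨δ, hδ, H⟩ := exists_increment_ge (κ := κ) (n := n) (m := c * n * x / S) hP hp0 (by
    by_contra hcon
    have hv := mul_variance_le hκ hP (p := p) (by linarith [hp.2]) hc₀0
      (by
        rw [labelLaw_Iic (by linarith [hp.2])]
        exact ENNReal.ofReal_le_ofReal ((min_le_left _ _).trans hp.1))
      (by
        rw [labelLaw_Ioi hp0]
        exact ENNReal.ofReal_le_ofReal ((min_le_right _ _).trans (by linarith [hp.2]))) n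
    have hv' := hv.trans (mul_le_mul' le_rfl (not_lt.1 hcon))
    have hfin : ∑ j ∈ Finset.range n, P (armEvent κ j p) ≠ ⊤ :=
      (ENNReal.sum_lt_top.2 fun _ _ => measure_lt_top _ _).ne
    have hreal := ENNReal.toReal_mono (ENNReal.mul_ne_top (ENNReal.mul_ne_top (ENNReal.mul_ne_top
      (by simp) (ENNReal.pow_ne_top (totalWeight_ne_top d hc₀0))) hfin) ENNReal.ofReal_ne_top) hv'
    simp only [ENNReal.toReal_mul, ENNReal.toReal_natCast, ENNReal.toReal_pow,
      ENNReal.toReal_ofNat, ENNReal.toReal_sum fun _ _ => measure_ne_top _ _] at hreal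
    rw [ENNReal.toReal_ofReal (by positivity)] at hreal
    simp only [← measureReal_def] at hreal
    rw [probReal_compl_eq_one_sub (measurableSet_armEvent p), ← hx, ← hS, ← hW] at hreal
    have hxt : x ≤ t := (measureReal_mono (armEvent_anti p hn)).trans
      (measureReal_mono fun V hV => Arm.mono hV (openSet_mono V hp.2.le))
    have e : 2 * W ^ 2 * S * (c * n * x / S) = (2 * W ^ 2 * c) * (n * x) := by
      field_simp
    rw [e, ← mul_assoc, mul_comm] at hreal
    have hn0 : (0 : ℝ) < n := by exact_mod_cast hn
    have h1 := le_of_mul_le_mul_right hreal (mul_pos hn0 h0)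
    have h2 : (2 * W ^ 2 + 1) * c = 1 - t := by rw [hc]; field_simp
    nlinarith)
  exact ⟨δ, hδ, fun q h1 h2 h3 => H q h1 h2 (h3.trans hb.le)⟩

/-- **Sharp phase transition** for constrained-degree percolation on `ℤ^d`, `d ≥ 2`,
with `κ ∈ {2, …, 2d}`: for `p < p_c` the one-arm probability decays exponentially. -/
theorem sharp_phase_transition (d κ : ℕ) (hd : 2 ≤ d) (hκ₁ : 2 ≤ κ) (hκ₂ : κ ≤ 2 * d)
    (P : Measure (Config d)) (hP : IsProductUniform P)
    (p : ℝ) (hp : p < pc κ P) :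
    ∃ α : ℝ, 0 < α ∧ ∀ n : ℕ, 1 ≤ n → theta κ P n p ≤ Real.exp (-(α * n)) := by
  have := hP.1
  rcases lt_or_ge p 0 with hp0 | hp0
  · exact ⟨1, one_pos, fun n hn => (theta_eq_zero P hn hp0).trans_le (Real.exp_pos _).le⟩
  have hne : {p : ℝ | p ∈ Set.Icc (0 : ℝ) 1 ∧ thetaInf κ P p = 0}.Nonempty := by
    by_contra hcon
    rw [pc, Set.not_nonempty_iff_eq_empty.1 hcon, Real.sSup_empty] at hp
    linarith
  obtain ⟨p', ⟨hp'1, hp'2⟩, hpp'⟩ := exists_lt_of_lt_csSup hne hp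
  set a := p + (p' - p) / 3 with ha
  set b := p + 2 * (p' - p) / 3 with hb
  have hpa : p < a := by linarith
  have hab : a < b := by linarith
  have hbp : b < p' := by linarith
  obtain ⟨c, hc, hdini⟩ := armEvent_dini hκ₁ hP (hp0.trans_lt hpa) hab (hbp.trans_le hp'1.2)
  obtain ⟨α, hα, h⟩ := exponential_decay_of_dini (θ := fun n p => P.real (armEvent κ n p)) hab hc
    (fun p _ => by rw [armEvent_zero]; simp) (fun _ _ => measureReal_nonneg)
    (fun _ _ => measureReal_le_one)
    (fun n x _ y _ hxy => measureReal_mono fun V hV => Arm.mono hV (openSet_mono V hxy))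
    (tendsto_armEvent hP hbp.le hp'2) hdini
  exact ⟨α, hα, fun n hn => (theta_le hP hpa.le).trans (h n hn)⟩

end CDP
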